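/- Let d ≥ 1 and let H : ℝ^{2d} × ℝ × ℝ → ℝ be a smooth function, 1-periodic in the θ coordinate (H(x, θ+1, μ) = H(x, θ, μ)), with H ≥ 0, H ≡ 0 on some nonempty open set, and suppose there is a compact set K such that H(z) = m := max H > 0 for every z outside K_per := {(x, θ+j, μ) : (x,θ,μ) ∈ K, j ∈ ℤ}. Let U ⊇ K_per be an open set invariant under θ ↦ θ+1 such that the closure of U intersected with ℝ^{2d} × [0,1] × ℝ is compact, and set A equal to the 2-dimensional Lebesgue measure of {(θ, μ) ∈ [0,1) × ℝ : (x, θ, μ) ∈ U for some x}. Then there exist a nonconstant smooth solution z : ℝ → ℝ^{2d} × ℝ × ℝ of z′(t) = X_H^Ω(z(t)), a real number T with 0 < T < A/m, and an integer j such that z(t+T) = z(t) + (0, j, 0) for all t. (This is Theorem 3.1 of the paper — the Hofer–Viterbo/Lu-type existence theorem on M × T*S¹ — for the geometrically bounded, rational case M = (ℝ^{2d}, ω₀), stated in the universal cover of ℝ^{2d} × T*S¹; the conclusion that the homotopy class of the orbit lies in π₁(S¹) is encoded by the closing-up condition z(t+T) = z(t) + (0, j, 0).) -/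

import Mathlib

noncomputable section

open Set

/-- Phase space `ℝ^{2d}`, written as pairs `(p, q)` with `p q : Fin d → ℝ`. -/
abbrev Phase (d : ℕ) := (Fin d → ℝ) × (Fin d → ℝ)

/-- The standard symplectic form `ω₀` on `ℝ^{2d}`:
`ω₀(u,v) = ∑ i, (u_i v_{d+i} - u_{d+i} v_i)`. -/
def omega0 {d : ℕ} (u v : Phase d) : ℝ :=
  ∑ i, (u.1 i * v.2 i - u.2 i * v.1 i)

/-- The Hamiltonian vector field `X_H` of `H`, characterized by
`ω₀(X_H(x), v) = DH(x) v` for all `v`. -/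
def hamVF {d : ℕ} (H : Phase d → ℝ) (x : Phase d) : Phase d :=
  (fun i => fderiv ℝ H x (0, Pi.single i 1),
   fun i => - fderiv ℝ H x (Pi.single i 1, 0))

/-- `γ` is a `T`-periodic orbit of `X_H`. -/
def IsPeriodicOrbit {d : ℕ} (H : Phase d → ℝ) (γ : ℝ → Phase d) (T : ℝ) : Prop :=
  (∀ t, HasDerivAt γ (hamVF H (γ t)) t) ∧ (∀ t, γ (t + T) = γ t)

/-- `H` is pre-admissible supported in `U`, with maximum value `m`:
`0 ≤ H ≤ m`, `H ≡ 0` on some nonempty open subset of `U`, and `H ≡ m`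
outside some compact subset of `U`. -/
def PreAdmissible {d : ℕ} (H : Phase d → ℝ) (U : Set (Phase d)) (m : ℝ) : Prop :=
  ContDiff ℝ (⊤ : ℕ∞) H ∧ (∀ x, 0 ≤ H x ∧ H x ≤ m) ∧
  (∃ V : Set (Phase d), IsOpen V ∧ V.Nonempty ∧ V ⊆ U ∧ ∀ x ∈ V, H x = 0) ∧
  (∃ K : Set (Phase d), IsCompact K ∧ K ⊆ U ∧ ∀ x ∉ K, H x = m)

/-- A free Hamiltonian circle action of period 1 on the open set `N`,
generated by `H₁`. -/
def FreeHamCircleAction {d : ℕ} (N : Set (Phase d)) (H₁ : Phase d → ℝ)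
    (φ : ℝ → Phase d → Phase d) : Prop :=
  ContDiffOn ℝ (⊤ : ℕ∞) (fun p : ℝ × Phase d => φ p.1 p.2) (Set.univ ×ˢ N) ∧
  (∀ t, ∀ x ∈ N, φ t x ∈ N) ∧
  (∀ x ∈ N, φ 0 x = x) ∧
  (∀ s t, ∀ x ∈ N, φ s (φ t x) = φ (s + t) x) ∧
  (∀ t, ∀ x ∈ N, φ (t + 1) x = φ t x) ∧
  (∀ t, ∀ x ∈ N, HasDerivAt (fun s => φ s x) (hamVF H₁ (φ t x)) t) ∧
  (∀ t, ∀ x ∈ N, φ t x = x → ∃ j : ℤ, t = (j : ℝ))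

/-- The product symplectic form `Ω = ω₀ ⊕ ω₀^{ℝ²}` on `ℝ^{2d} × ℝ × ℝ`
(coordinates `(x, θ, μ)`): `Ω((u,a,b),(v,c,e)) = ω₀(u,v) + a·e − b·c`. -/
def OmegaP {d : ℕ} (ξ η : Phase d × ℝ × ℝ) : ℝ :=
  omega0 ξ.1 η.1 + ξ.2.1 * η.2.2 - ξ.2.2 * η.2.1

section Part1
/-- Euclidean space. -/
abbrev EV (n : ℕ) := EuclideanSpace ℝ (Fin n)

open MeasureTheory in
/-- change of variables for a small perturbation of the identity -/
theorem brw_change {n : ℕ} (g : EV n → EV n)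
    (hg : ContDiff ℝ 1 g) (R : ℝ) (hR : ∀ x, R ≤ ‖x‖ → g x = 0) :
    ∃ t0 : ℝ, 0 < t0 ∧ ∀ t, 0 ≤ t → t ≤ t0 →
      ∀ P : EV n → ℝ,
      ∫ x in Metric.ball (0 : EV n) R,
        (ContinuousLinearMap.id ℝ _ + t • fderiv ℝ g x).det * P (x + t • g x) =
      ∫ x in Metric.ball (0 : EV n) R, P x := by
  have hgc : HasCompactSupport g := by
    refine HasCompactSupport.of_support_subset_isCompact (isCompact_closedBall (0 : EV n) R) ?_
    intro x hx
    by_contra h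
    apply hx
    apply hR
    simp only [Metric.mem_closedBall, dist_zero_right, not_le] at h
    exact h.le
  obtain ⟨C, hC⟩ := hg.lipschitzWith_of_hasCompactSupport hgc one_ne_zero
  -- det positive near the identity
  have hdet : ∃ ε > 0, ∀ M : EV n →L[ℝ] EV n, ‖M‖ < ε → 0 < (ContinuousLinearMap.id ℝ (EV n) + M).det := by
    have hc : Continuous fun M : EV n →L[ℝ] (EV n) => (ContinuousLinearMap.id ℝ (EV n) + M).det :=
      ContinuousLinearMap.continuous_det.comp (continuous_const.add continuous_id)
    have h0 : (0 : ℝ) < (ContinuousLinearMap.id ℝ (EV n) + 0).det := by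
      simp [ContinuousLinearMap.det]
    have := (hc.tendsto 0).eventually (lt_mem_nhds h0)
    rw [Metric.eventually_nhds_iff] at this
    obtain ⟨ε, he, h⟩ := this
    exact ⟨ε, he, fun M hM => h (by simpa using hM)⟩
  obtain ⟨ε, he, hdet⟩ := hdet
  have hgd : Differentiable ℝ g := hg.differentiable one_ne_zero
  have hfd : ∀ x, ‖fderiv ℝ g x‖ ≤ C := fun x => norm_fderiv_le_of_lipschitz ℝ hC
  refine ⟨min ε 1 / (2 * (C + 1)), by positivity, fun t ht0 ht P => ?_⟩
  have hC0 : (0 : ℝ) ≤ C := C.2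
  have htC : t * (C + 1) ≤ min ε 1 / 2 := by
    have h1 : (0 : ℝ) < C + 1 := by positivity
    calc t * (C + 1) ≤ min ε 1 / (2 * (C + 1)) * (C + 1) := by gcongr
      _ = min ε 1 / 2 := by field_simp
  have htC' : t * C ≤ min ε 1 / 2 := by nlinarith
  have hlt1 : t * C < 1 := by
    have := min_le_right ε 1
    have := lt_min he one_pos
    linarith
  have hlte : t * C < ε := by
    have := min_le_left ε 1
    have := lt_min he one_pos
    linarith
  let G : (EV n) → (EV n) := fun x => x + t • g x
  have hG : ∀ x y, ‖G x - G y - (x - y)‖ ≤ (t * C) * ‖x - y‖ := by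
    intro x y
    have : G x - G y - (x - y) = t • (g x - g y) := by
      simp only [G, smul_sub]; abel
    rw [this, norm_smul, Real.norm_of_nonneg ht0, mul_assoc]
    gcongr
    exact hC.norm_sub_le x y
  have hinj : Function.Injective G := by
    intro x y hxy
    have := hG x y
    rw [hxy, sub_self, zero_sub, norm_neg] at this
    have h2 : ‖x - y‖ ≤ 0 := by
      by_contra h; push Not at h; nlinarith
    exact sub_eq_zero.1 (norm_le_zero_iff.1 h2)
  have hsurj : Function.Surjective G := by
    intro y
    have hcon : ContractingWith (Real.toNNReal (t * C)) (fun x : (EV n) => y - t • g x) := by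
      refine ⟨by rw [← NNReal.coe_lt_coe]; simpa [Real.coe_toNNReal _ (mul_nonneg ht0 hC0)] using hlt1, ?_⟩
      refine LipschitzWith.of_dist_le_mul fun a b => ?_
      rw [Real.coe_toNNReal _ (mul_nonneg ht0 hC0), dist_eq_norm, dist_eq_norm]
      have : y - t • g a - (y - t • g b) = t • (g b - g a) := by rw [smul_sub]; abel
      rw [this, norm_smul, Real.norm_of_nonneg ht0, mul_assoc, norm_sub_rev a b]
      gcongr
      exact hC.norm_sub_le b a
    refine ⟨ContractingWith.fixedPoint _ hcon, ?_⟩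
    have := hcon.fixedPoint_isFixedPt
    simp only [Function.IsFixedPt] at this
    simp only [G]
    nth_rewrite 1 [← this]
    abel
  have himg : G '' Metric.ball (0 : EV n) R = Metric.ball (0 : EV n) R := by
    have hfix : ∀ x, R ≤ ‖x‖ → G x = x := fun x hx => by simp [G, hR x hx]
    ext y
    constructor
    · rintro ⟨x, hx, rfl⟩
      by_contra h
      simp only [Metric.mem_ball, dist_zero_right, not_lt] at h hx
      have := hinj (hfix _ h)
      rw [this] at h
      linarith
    · intro hy
      obtain ⟨x, rfl⟩ := hsurj y
      refine ⟨x, ?_, rfl⟩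
      by_contra h
      simp only [Metric.mem_ball, dist_zero_right, not_lt] at h hy
      rw [hfix x h] at hy
      linarith
  have hder : ∀ x ∈ Metric.ball (0 : EV n) R, HasFDerivWithinAt G
      (ContinuousLinearMap.id ℝ (EV n) + t • fderiv ℝ g x) (Metric.ball (0 : EV n) R) x := by
    intro x _
    exact ((hasFDerivAt_id x).add ((hgd x).hasFDerivAt.const_smul t)).hasFDerivWithinAt
  have key := integral_image_eq_integral_abs_det_fderiv_smul volume measurableSet_ball hder
    hinj.injOn P
  rw [himg] at key
  rw [key]
  refine setIntegral_congr_fun measurableSet_ball fun x _ => ?_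
  have : 0 < (ContinuousLinearMap.id ℝ (EV n) + t • fderiv ℝ g x).det := by
    apply hdet
    rw [norm_smul, Real.norm_of_nonneg ht0]
    exact lt_of_le_of_lt (mul_le_mul_of_nonneg_left (hfd x) ht0) hlte
  simp only [abs_of_pos this, smul_eq_mul, G]

theorem brw_poly {n : ℕ} (A : EV n →L[ℝ] EV n) :
    ∃ p : Polynomial ℝ, p.natDegree ≤ n ∧
      ∀ t, p.eval t = (ContinuousLinearMap.id ℝ _ + t • A).det := by
  classical
  set b := (EuclideanSpace.basisFun (Fin n) ℝ).toBasis
  set M := LinearMap.toMatrix b b (A : EV n →ₗ[ℝ] EV n)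
  refine ⟨Matrix.det ((Polynomial.X : Polynomial ℝ) • M.map Polynomial.C
    + (1 : Matrix (Fin n) (Fin n) ℝ).map Polynomial.C), ?_, fun t => ?_⟩
  · simpa using Polynomial.natDegree_det_X_add_C_le M 1
  · rw [ContinuousLinearMap.det, ← LinearMap.det_toMatrix b]
    rw [← Polynomial.coe_evalRingHom, RingHom.map_det]
    congr 1
    ext i j
    simp [M, LinearMap.toMatrix_apply, Matrix.one_apply, Finsupp.single_apply, apply_ite, eq_comm]
    split_ifs <;> ring

theorem brw_lagrange (D : ℕ) (t0 : ℝ) (ht0 : 0 < t0) :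
    ∃ (v w : ℕ → ℝ), (∀ i, 0 ≤ v i ∧ v i ≤ t0) ∧ ∀ p : Polynomial ℝ, p.natDegree ≤ D →
      p.eval 1 = ∑ i ∈ Finset.range (D + 1), w i * p.eval (v i) := by
  classical
  let v : ℕ → ℝ := fun i => t0 / (i + 1)
  have hv : Function.Injective v := by
    intro i j hij
    simp only [v] at hij
    have h1 : (0 : ℝ) < i + 1 := by positivity
    have h2 : (0 : ℝ) < j + 1 := by positivity
    rw [div_eq_div_iff h1.ne' h2.ne'] at hij
    have := mul_left_cancel₀ ht0.ne' hij
    exact_mod_cast (by linarith : (i : ℝ) = j)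
  refine ⟨v, fun i => (Lagrange.basis (Finset.range (D + 1)) v i).eval 1, fun i => ⟨by positivity, ?_⟩, ?_⟩
  · apply div_le_self ht0.le
    have : (0 : ℝ) ≤ i := by positivity
    linarith
  · intro p hp
    have h := Lagrange.eq_interpolate (s := Finset.range (D + 1)) (v := v) (f := p) hv.injOn (by
      rw [Finset.card_range]
      exact lt_of_le_of_lt Polynomial.degree_le_natDegree (by exact_mod_cast Nat.lt_succ_of_le hp))
    conv_lhs => rw [h]
    rw [Lagrange.interpolate_apply, Polynomial.eval_finsetSum]
    refine Finset.sum_congr rfl fun i _ => ?_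
    simp [mul_comm]

open MeasureTheory in
theorem brw_identity {n : ℕ} (g : EV n → EV n)
    (hg : ContDiff ℝ 1 g) (R : ℝ) (hR : ∀ x, R ≤ ‖x‖ → g x = 0) (y : EV n) (ρ : ℝ) (k : ℕ) :
    ∫ x in Metric.ball (0 : EV n) R, (ContinuousLinearMap.id ℝ _ + fderiv ℝ g x).det *
        (1 - ‖x + g x - y‖ ^ 2 / ρ ^ 2) ^ k =
    ∫ x in Metric.ball (0 : EV n) R, (1 - ‖x - y‖ ^ 2 / ρ ^ 2) ^ k := by
  obtain ⟨t0, ht0, h⟩ := brw_change g hg R hR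
  obtain ⟨v, w, hv, hw⟩ := brw_lagrange (n + 2 * k) t0 ht0
  have hpoly : ∀ x, ∃ p : Polynomial ℝ, p.natDegree ≤ n + 2 * k ∧ ∀ t, p.eval t =
      (ContinuousLinearMap.id ℝ _ + t • fderiv ℝ g x).det *
        (1 - ‖x + t • g x - y‖ ^ 2 / ρ ^ 2) ^ k := by
    intro x
    obtain ⟨p, hp, hpe⟩ := brw_poly (fderiv ℝ g x)
    let q : Polynomial ℝ := Polynomial.C (1 - ‖x - y‖ ^ 2 / ρ ^ 2)
      + Polynomial.C (- 2 * inner ℝ (x - y) (g x) / ρ ^ 2) * Polynomial.X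
      + Polynomial.C (- ‖g x‖ ^ 2 / ρ ^ 2) * Polynomial.X ^ 2
    have hq : q.natDegree ≤ 2 := by
      simp only [q]
      compute_degree
    refine ⟨p * q ^ k, ?_, fun t => ?_⟩
    · refine Polynomial.natDegree_mul_le.trans (add_le_add hp ?_)
      refine Polynomial.natDegree_pow_le.trans ?_
      rw [mul_comm]
      exact Nat.mul_le_mul_right k hq
    · rw [Polynomial.eval_mul, Polynomial.eval_pow, hpe]
      congr 2
      have : x + t • g x - y = (x - y) + t • g x := by abel
      rw [this, norm_add_sq_real, inner_smul_right, norm_smul, mul_pow, Real.norm_eq_abs, sq_abs]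
      simp [q]
      ring
  choose p hp hpe using hpoly
  have hcont : ∀ t : ℝ, Continuous fun x => (ContinuousLinearMap.id ℝ _ + t • fderiv ℝ g x).det *
        (1 - ‖x + t • g x - y‖ ^ 2 / ρ ^ 2) ^ k := by
    intro t
    have h1 : Continuous (fderiv ℝ g) := hg.continuous_fderiv one_ne_zero
    have h2 : Continuous g := hg.continuous
    refine Continuous.mul (ContinuousLinearMap.continuous_det.comp (by fun_prop)) (by fun_prop)
  have hintg : ∀ t : ℝ, IntegrableOn (fun x => (ContinuousLinearMap.id ℝ _ + t • fderiv ℝ g x).det *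
        (1 - ‖x + t • g x - y‖ ^ 2 / ρ ^ 2) ^ k) (Metric.ball (0 : EV n) R) := fun t =>
    ((hcont t).continuousOn.integrableOn_compact (isCompact_closedBall (0 : EV n) R)).mono_set
      Metric.ball_subset_closedBall
  have e1 : ∫ x in Metric.ball (0 : EV n) R, (ContinuousLinearMap.id ℝ _ + fderiv ℝ g x).det *
        (1 - ‖x + g x - y‖ ^ 2 / ρ ^ 2) ^ k =
      ∫ x in Metric.ball (0 : EV n) R, ∑ i ∈ Finset.range (n + 2 * k + 1), w i *
        ((ContinuousLinearMap.id ℝ _ + v i • fderiv ℝ g x).det *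
        (1 - ‖x + v i • g x - y‖ ^ 2 / ρ ^ 2) ^ k) := by
    refine setIntegral_congr_fun measurableSet_ball fun x _ => ?_
    have := hw (p x) (hp x)
    rw [hpe] at this
    simp only [hpe, one_smul] at this
    exact this
  rw [e1, integral_finsetSum _ (fun i _ => (hintg (v i)).const_mul (w i))]
  have hsum : ∑ i ∈ Finset.range (n + 2 * k + 1), w i = 1 := by
    have := hw 1 (by simp)
    simp at this
    exact this.symm
  have : ∀ i ∈ Finset.range (n + 2 * k + 1), ∫ x in Metric.ball (0 : EV n) R, w i *
        ((ContinuousLinearMap.id ℝ _ + v i • fderiv ℝ g x).det *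
        (1 - ‖x + v i • g x - y‖ ^ 2 / ρ ^ 2) ^ k) =
      w i * ∫ x in Metric.ball (0 : EV n) R, (1 - ‖x - y‖ ^ 2 / ρ ^ 2) ^ k := by
    intro i _
    rw [integral_const_mul]
    congr 1
    exact h (v i) (hv i).1 (hv i).2 (fun z => (1 - ‖z - y‖ ^ 2 / ρ ^ 2) ^ k)
  rw [Finset.sum_congr rfl this, ← Finset.sum_mul, hsum, one_mul]

open MeasureTheory in
theorem brw_smooth {n : ℕ} (g : EV n → EV n)
    (hg : ContDiff ℝ 1 g) (R : ℝ) (hR : ∀ x, R ≤ ‖x‖ → g x = 0) :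
    Function.Surjective fun x => x + g x := by
  intro y
  by_contra hy
  push Not at hy
  have hyR : ‖y‖ < R := by
    by_contra h
    push Not at h
    exact hy y (by simp [hR y h])
  have hR0 : 0 < R := lt_of_le_of_lt (norm_nonneg _) hyR
  have hcg : Continuous g := hg.continuous
  have hcG : Continuous fun x => ‖x + g x - y‖ := by fun_prop
  have hK := isCompact_closedBall (0 : EV n) R
  have hKne : (Metric.closedBall (0 : EV n) R).Nonempty := ⟨0, by simp [hR0.le]⟩
  obtain ⟨x0, -, hx0⟩ := hK.exists_isMinOn hKne hcG.continuousOn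
  obtain ⟨x1, -, hx1⟩ := hK.exists_isMaxOn hKne hcG.continuousOn
  set r := ‖x0 + g x0 - y‖ with hr
  have hr0 : 0 < r := norm_pos_iff.2 (sub_ne_zero.2 (hy x0))
  set ρ := ‖x1 + g x1 - y‖ + 2 * R with hρ
  have hr_le : ∀ x ∈ Metric.ball (0 : EV n) R, r ≤ ‖x + g x - y‖ := fun x hx =>
    hx0 (Metric.ball_subset_closedBall hx)
  have hle_ρ : ∀ x ∈ Metric.ball (0 : EV n) R, ‖x + g x - y‖ ≤ ρ := fun x hx => by
    have : ‖x + g x - y‖ ≤ ‖x1 + g x1 - y‖ := hx1 (Metric.ball_subset_closedBall hx)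
    linarith
  have hle_ρ' : ∀ x ∈ Metric.ball (0 : EV n) R, ‖x - y‖ ≤ ρ := fun x hx => by
    have h1 := norm_sub_le x y
    have h2 : ‖x‖ < R := by simpa using hx
    have := norm_nonneg (x1 + g x1 - y)
    linarith
  have hρ0 : 0 < ρ := by positivity
  set r' := min (r / 2) (R - ‖y‖) with hr'
  have hr'0 : 0 < r' := lt_min (by positivity) (by linarith)
  have hr'r : r' < r := lt_of_le_of_lt (min_le_left _ _) (by linarith)
  have hrρ : r ≤ ρ := (hr_le 0 (by simpa using hR0)).trans (hle_ρ 0 (by simpa using hR0))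
  set a := 1 - r ^ 2 / ρ ^ 2 with ha
  set b := 1 - r' ^ 2 / ρ ^ 2 with hb
  have ha0 : 0 ≤ a := by
    rw [ha, sub_nonneg]
    apply div_le_one_of_le₀ _ (by positivity)
    gcongr
  have hab : a < b := by
    rw [ha, hb]
    have : r' ^ 2 / ρ ^ 2 < r ^ 2 / ρ ^ 2 := by gcongr
    linarith
  have hb0 : 0 < b := lt_of_le_of_lt ha0 hab
  have hdc : Continuous fun x => (ContinuousLinearMap.id ℝ (EV n) + fderiv ℝ g x).det := by
    have h1 : Continuous (fderiv ℝ g) := hg.continuous_fderiv one_ne_zero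
    exact ContinuousLinearMap.continuous_det.comp (by fun_prop)
  have hion : ∀ f : EV n → ℝ, Continuous f → IntegrableOn f (Metric.ball (0 : EV n) R) := fun f hf =>
    (hf.continuousOn.integrableOn_compact hK).mono_set Metric.ball_subset_closedBall
  set C := ∫ x in Metric.ball (0 : EV n) R, |(ContinuousLinearMap.id ℝ (EV n) + fderiv ℝ g x).det|
  set c := (volume (Metric.ball y r')).toReal with hc
  have hc0 : 0 < c := ENNReal.toReal_pos (Metric.measure_ball_pos volume y hr'0).ne'
    measure_ball_lt_top.ne
  have hsub : Metric.ball y r' ⊆ Metric.ball (0 : EV n) R := by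
    apply Metric.ball_subset_ball'
    rw [dist_zero_right]
    have := min_le_right (r / 2) (R - ‖y‖)
    linarith
  have main : ∀ k : ℕ, b ^ k * c ≤ a ^ k * C := by
    intro k
    have e := brw_identity g hg R hR y ρ k
    have h1 : b ^ k * c ≤ ∫ x in Metric.ball (0 : EV n) R, (1 - ‖x - y‖ ^ 2 / ρ ^ 2) ^ k := by
      calc b ^ k * c = ∫ x in Metric.ball y r', b ^ k := by
            rw [setIntegral_const]; simp [hc, Measure.real, mul_comm]
        _ ≤ ∫ x in Metric.ball y r', (1 - ‖x - y‖ ^ 2 / ρ ^ 2) ^ k := by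
            refine setIntegral_mono_on ?_ ?_ measurableSet_ball ?_
            · exact integrableOn_const measure_ball_lt_top.ne
            · exact (hion _ (by fun_prop)).mono_set hsub
            · intro x hx
              have : ‖x - y‖ ≤ r' := by
                rw [← dist_eq_norm]; exact (Metric.mem_ball.1 hx).le
              apply pow_le_pow_left₀ hb0.le
              rw [hb]
              gcongr
        _ ≤ _ := by
            refine setIntegral_mono_set (hion _ (by fun_prop)) ?_ hsub.eventuallyLE
            refine (ae_restrict_iff' measurableSet_ball).2 (Filter.Eventually.of_forall fun x hx => ?_)
            apply pow_nonneg
            rw [sub_nonneg]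
            apply div_le_one_of_le₀ _ (by positivity)
            have := hle_ρ' x hx
            gcongr
    have h2 : ∫ x in Metric.ball (0 : EV n) R, (ContinuousLinearMap.id ℝ _ + fderiv ℝ g x).det *
        (1 - ‖x + g x - y‖ ^ 2 / ρ ^ 2) ^ k ≤ a ^ k * C := by
      rw [← integral_const_mul]
      refine setIntegral_mono_on ?_ ?_ measurableSet_ball ?_
      · exact hion _ (hdc.mul (by fun_prop))
      · exact hion _ (continuous_const.mul hdc.abs)
      · intro x hx
        rw [mul_comm (a ^ k)]
        have h3 : 0 ≤ 1 - ‖x + g x - y‖ ^ 2 / ρ ^ 2 := by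
          rw [sub_nonneg]
          apply div_le_one_of_le₀ _ (by positivity)
          have := hle_ρ x hx
          gcongr
        have h4 : 1 - ‖x + g x - y‖ ^ 2 / ρ ^ 2 ≤ a := by
          rw [ha]
          have := hr_le x hx
          gcongr
        calc _ ≤ |(ContinuousLinearMap.id ℝ (EV n) + fderiv ℝ g x).det| *
              (1 - ‖x + g x - y‖ ^ 2 / ρ ^ 2) ^ k := by
              gcongr
              exact le_abs_self _
          _ ≤ _ := by gcongr
    linarith [e ▸ h2]
  have hlim : Filter.Tendsto (fun k : ℕ => (a / b) ^ k * C) Filter.atTop (nhds (0 * C)) :=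
    (tendsto_pow_atTop_nhds_zero_of_lt_one (by positivity) ((div_lt_one hb0).2 hab)).mul_const C
  have : c ≤ 0 * C := by
    refine ge_of_tendsto' hlim fun k => ?_
    rw [div_pow, div_mul_eq_mul_div, le_div_iff₀ (by positivity), mul_comm c]
    exact main k
  linarith

/-- A continuous self-map of a finite dimensional space that is the identity outside a bounded
set is surjective. -/
theorem brw_euclid {n : ℕ} (G : EV n → EV n) (hG : Continuous G) (R : ℝ)
    (hR : ∀ x, R ≤ ‖x‖ → G x = x) : Function.Surjective G := by
  intro y
  by_contra hy
  push Not at hy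
  -- distance to y is bounded below
  have hr : ∃ r > 0, ∀ x, r ≤ ‖G x - y‖ := by
    have hcl : IsClosed (range G) := by
      have : range G = G '' Metric.closedBall 0 R ∪ {x | R ≤ ‖x‖} := by
        ext z
        constructor
        · rintro ⟨x, rfl⟩
          by_cases h : R ≤ ‖x‖
          · right; rw [hR x h]; exact h
          · left; exact ⟨x, by simpa using (not_le.1 h).le, rfl⟩
        · rintro (⟨x, -, rfl⟩ | h)
          · exact ⟨x, rfl⟩
          · exact ⟨z, hR z h⟩
      rw [this]
      exact ((isCompact_closedBall _ _).image hG).isClosed.union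
        (isClosed_le continuous_const continuous_norm)
    have hmem : y ∈ (range G)ᶜ := by rintro ⟨x, hx⟩; exact hy x hx
    obtain ⟨r, hr, hsub⟩ := Metric.isOpen_iff.1 hcl.isOpen_compl y hmem
    refine ⟨r, hr, fun x => ?_⟩
    by_contra h
    push Not at h
    exact hsub (by rwa [Metric.mem_ball, dist_eq_norm]) ⟨x, rfl⟩
  obtain ⟨r, hr, hGr⟩ := hr
  have hgc : Continuous fun x => G x - x := hG.sub continuous_id
  have hcs : HasCompactSupport fun x => G x - x := by
    refine HasCompactSupport.of_support_subset_isCompact (isCompact_closedBall (0 : EV n) R) ?_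
    intro x hx
    by_contra h
    apply hx
    simp only [Metric.mem_closedBall, dist_zero_right, not_le] at h
    simp [hR x h.le]
  obtain ⟨f, hf, hfd⟩ := (hcs.uniformContinuous_of_continuous hgc).exists_contDiff_dist_le hr
  let χ : ContDiffBump (0 : EV n) := ⟨|R| + 1, |R| + 2, by positivity, by linarith⟩
  have hs := brw_smooth (fun x => χ x • f x) ((χ.contDiff.smul hf).of_le (by simp)) (|R| + 2) (by
    intro x hx
    rw [χ.zero_of_le_dist (by simpa [χ] using hx), zero_smul])
  obtain ⟨x, hx⟩ := hs y
  have h1 := hGr x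
  rw [← hx] at h1
  have h2 : ‖G x - (x + χ x • f x)‖ < r := by
    have : G x - (x + χ x • f x) = χ x • ((G x - x) - f x) := by
      by_cases h : R ≤ ‖x‖
      · rw [hR x h]; simp
      · rw [χ.one_of_mem_closedBall (by
          simp only [Metric.mem_closedBall, dist_zero_right, χ]
          have := le_abs_self R
          linarith)]
        simp only [one_smul]; abel
    rw [this, norm_smul, Real.norm_of_nonneg χ.nonneg]
    have h3 := hfd x
    rw [dist_comm, dist_eq_norm] at h3
    calc _ ≤ 1 * ‖G x - x - f x‖ := by gcongr; exact χ.le_one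
      _ < r := by rw [one_mul]; exact h3
  exact absurd h1 (not_le.2 h2)

theorem brw_main {V : Type*} [NormedAddCommGroup V] [NormedSpace ℝ V] [FiniteDimensional ℝ V]
    (G : V → V) (hG : Continuous G) (R : ℝ)
    (hR : ∀ x, R ≤ ‖x‖ → G x = x) : Function.Surjective G := by
  let e := toEuclidean (E := V)
  have h := brw_euclid (n := Module.finrank ℝ V) (fun x => e (G (e.symm x)))
    (e.continuous.comp (hG.comp e.symm.continuous)) (‖(e : V →L[ℝ] EV (Module.finrank ℝ V))‖ * |R|) (by
    intro x hx
    by_cases hRp : R ≤ ‖e.symm x‖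
    · simp [hR _ hRp]
    · push Not at hRp
      have h1 : ‖x‖ ≤ ‖(e : V →L[ℝ] EV (Module.finrank ℝ V))‖ * ‖e.symm x‖ := by
        simpa using (e : V →L[ℝ] EV (Module.finrank ℝ V)).le_opNorm (e.symm x)
      have h2 : ‖e.symm x‖ < |R| := hRp.trans_le (le_abs_self R)
      by_cases he : ‖(e : V →L[ℝ] EV (Module.finrank ℝ V))‖ = 0
      · have hx0 : x = 0 := by
          rw [he, zero_mul] at h1
          exact norm_le_zero_iff.1 h1
        have : ∀ z : V, z = 0 := by
          intro z
          have h5 := (e : V →L[ℝ] EV (Module.finrank ℝ V)).le_opNorm z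
          rw [he, zero_mul] at h5
          have h6 : e z = 0 := norm_le_zero_iff.1 h5
          simpa using h6
        rw [this (G (e.symm x)), hx0]; simp
      · have : 0 < ‖(e : V →L[ℝ] EV (Module.finrank ℝ V))‖ := lt_of_le_of_ne (norm_nonneg _) (Ne.symm he)
        have h7 := mul_lt_mul_of_pos_left h2 this
        exact absurd hx (not_le.2 (h1.trans_lt h7)))
  intro y
  obtain ⟨x, hx⟩ := h (e y)
  exact ⟨e.symm x, e.injective hx⟩

end Part1

section Part2
/-- Finite dimensional linking theorem: existence of almost critical points. -/
theorem minimax_link {E : Type*} [NormedAddCommGroup E] [InnerProductSpace ℝ E]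
    [FiniteDimensional ℝ E] (F : Submodule ℝ E) (P : E →L[ℝ] F) (hP : ∀ f : F, P f = f)
    (e p : E) (hPe : P e = 0) (nu : E → ℝ) (hnu : Continuous nu)
    (hnue : ∀ (f : F) (s : ℝ), 0 ≤ s → nu ((f : E) + s • e) = s)
    (psi : E → ℝ) (hpsi : Continuous psi) (Gr : E → E) (hGr : Continuous Gr)
    (L : ℝ) (hL : 0 < L)
    (hquad : ∀ x v, psi (x + v) ≤ psi x + inner ℝ (Gr x) v + L / 2 * ‖v‖ ^ 2)
    (h0 : ∀ f : F, psi (p + f) ≤ 0)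
    (τ : ℝ) (hτ : ∀ (f : F) (s : ℝ), 0 ≤ s → (τ ≤ ‖f‖ ∨ τ ≤ s) → psi (p + f + s • e) ≤ 0)
    (α β : ℝ) (hα : 0 < α) (hβ : 0 < β)
    (hΓ : ∀ y, P y = 0 → nu y = α → β ≤ psi (p + y)) (δ : ℝ) (hδ : 0 < δ) :
    ∃ x, β / 2 ≤ psi x ∧ ‖Gr x‖ < δ := by
  by_contra hcon
  push Not at hcon
  let χ : ℝ → ℝ := fun s => max 0 (min 1 (2 * s / β))
  have hχc : Continuous χ := by fun_prop
  have hχ0 : ∀ s, 0 ≤ χ s := fun s => le_max_left _ _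
  have hχ1 : ∀ s, χ s ≤ 1 := fun s => max_le zero_le_one (min_le_left _ _)
  have hχz : ∀ s, s ≤ 0 → χ s = 0 := fun s hs => by
    apply max_eq_left
    exact (min_le_right _ _).trans (div_nonpos_of_nonpos_of_nonneg (by linarith) hβ.le)
  have hχo : ∀ s, β / 2 ≤ s → χ s = 1 := fun s hs => by
    have : 1 ≤ 2 * s / β := by rw [le_div_iff₀ hβ]; linarith
    simp [χ, min_eq_left this]
  let S : E → E := fun x => x - (L⁻¹ * χ (psi x)) • Gr x
  have hSc : Continuous S := by
    have := hχc.comp hpsi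
    simp only [Function.comp_def] at this
    exact continuous_id.sub ((continuous_const.mul this).smul hGr)
  have hSd : ∀ x, psi (S x) ≤ psi x - L⁻¹ / 2 * χ (psi x) * ‖Gr x‖ ^ 2 := by
    intro x
    have h := hquad x (-((L⁻¹ * χ (psi x)) • Gr x))
    rw [← sub_eq_add_neg] at h
    rw [inner_neg_right, inner_smul_right, real_inner_self_eq_norm_sq, norm_neg, norm_smul,
      Real.norm_of_nonneg (mul_nonneg (inv_nonneg.2 hL.le) (hχ0 _))] at h
    refine h.trans ?_
    have hc2 : χ (psi x) * χ (psi x) ≤ χ (psi x) := by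
      nlinarith [hχ0 (psi x), hχ1 (psi x)]
    have e1 : L / 2 * (L⁻¹ * χ (psi x) * ‖Gr x‖) ^ 2
        = L⁻¹ / 2 * (χ (psi x) * χ (psi x)) * ‖Gr x‖ ^ 2 := by
      field_simp
    rw [e1]
    have : L⁻¹ / 2 * (χ (psi x) * χ (psi x)) * ‖Gr x‖ ^ 2
        ≤ L⁻¹ / 2 * χ (psi x) * ‖Gr x‖ ^ 2 := by gcongr
    linarith
  have hSz : ∀ x, psi x ≤ 0 → S x = x := fun x hx => by simp [S, hχz _ hx]
  have hSn : ∀ x, psi (S x) ≤ psi x := fun x => by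
    have h := hSd x
    have : 0 ≤ L⁻¹ / 2 * χ (psi x) * ‖Gr x‖ ^ 2 := by have := hχ0 (psi x); positivity
    linarith
  set κ := L⁻¹ / 2 * δ ^ 2 with hκ
  have hκ0 : 0 < κ := by positivity
  have hSs : ∀ x, β / 2 ≤ psi x → psi (S x) ≤ psi x - κ := fun x hx => by
    have h := hSd x
    rw [hχo _ hx, mul_one] at h
    have h2 := hcon x hx
    have : L⁻¹ / 2 * δ ^ 2 ≤ L⁻¹ / 2 * ‖Gr x‖ ^ 2 := by gcongr
    linarith
  have hit : ∀ (k : ℕ) (x : E), psi (S^[k] x) ≤ max (β / 2) (psi x - k * κ) := by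
    intro k x
    induction k with
    | zero => simp
    | succ k ih =>
      rw [Function.iterate_succ_apply']
      by_cases h : β / 2 ≤ psi (S^[k] x)
      · have h1 := hSs _ h
        rcases le_max_iff.1 ih with h2 | h2
        · exact le_max_of_le_left (by linarith)
        · refine le_max_of_le_right ?_
          push_cast
          linarith
      · exact le_max_of_le_left ((hSn _).trans (not_le.1 h).le)
  have hitz : ∀ (k : ℕ) (x : E), psi x ≤ 0 → S^[k] x = x := by
    intro k x hx
    exact Function.iterate_fixed (hSz x hx) k
  -- a bound for psi on the linking set
  obtain ⟨M, hM⟩ : ∃ M : ℝ, ∀ (f : F) (s : ℝ), 0 ≤ s → psi (p + f + s • e) ≤ M := by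
    have hc : Continuous fun q : F × ℝ => psi (p + q.1 + q.2 • e) := by fun_prop
    obtain ⟨M, hM⟩ := ((isCompact_closedBall (0 : F) |τ|).prod
      (isCompact_Icc (a := (0 : ℝ)) (b := |τ|))).bddAbove_image hc.continuousOn
    refine ⟨max M 0, fun f s hs => ?_⟩
    by_cases h : τ ≤ ‖f‖ ∨ τ ≤ s
    · exact le_max_of_le_right (hτ f s hs h)
    · push Not at h
      refine le_max_of_le_left (hM ⟨(f, s), ⟨?_, hs, ?_⟩, rfl⟩)
      · simpa using h.1.le.trans (le_abs_self τ)
      · exact h.2.le.trans (le_abs_self τ)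
  obtain ⟨k, hk⟩ := exists_nat_gt (M / κ)
  have hk' : M - k * κ < 0 := by
    rw [div_lt_iff₀ hκ0] at hk; linarith
  let h : E → E := S^[k]
  have hhc : Continuous h := hSc.iterate k
  let G : F × ℝ → F × ℝ := fun q =>
    if 0 ≤ q.2 then (P (h (p + q.1 + q.2 • e) - p), nu (h (p + q.1 + q.2 • e) - p)) else q
  have hid : ∀ (f : F) (s : ℝ), 0 ≤ s → psi (p + f + s • e) ≤ 0 →
      (P (h (p + f + s • e) - p), nu (h (p + f + s • e) - p)) = (f, s) := by
    intro f s hs hle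
    have e1 : h (p + f + s • e) = p + f + s • e := hitz k _ hle
    have e2 : p + f + s • e - p = (f : E) + s • e := by abel
    rw [e1, e2, hnue f s hs, map_add, map_smul, hPe, hP, smul_zero, add_zero]
  have hGc : Continuous G := by
    refine Continuous.if_le ?_ continuous_id continuous_const continuous_snd ?_
    · have : Continuous fun q : F × ℝ => h (p + q.1 + q.2 • e) - p := by
        refine Continuous.sub (hhc.comp ?_) continuous_const
        fun_prop
      exact (P.continuous.comp this).prodMk (hnu.comp this)
    · rintro ⟨f, s⟩ hs
      simp only at hs
      subst hs
      exact hid f 0 le_rfl (by simpa using h0 f)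
  obtain ⟨⟨f, s⟩, hfs⟩ := brw_main G hGc τ (by
    rintro ⟨f, s⟩ hq
    simp only [G]
    split_ifs with hs
    · apply hid f s hs
      apply hτ f s hs
      rw [Prod.norm_def] at hq
      rcases le_max_iff.1 hq with h1 | h1
      · exact Or.inl h1
      · right; simpa [abs_of_nonneg hs] using h1
    · rfl) (0, α)
  simp only [G] at hfs
  split_ifs at hfs with hs
  · rw [Prod.mk.injEq] at hfs
    have h1 := hΓ _ hfs.1 hfs.2
    rw [add_sub_cancel] at h1
    have h2 := hit k (p + f + s • e)
    have h3 := hM f s hs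
    have h4 : psi (h (p + f + s • e)) ≤ β / 2 := by
      refine h2.trans (max_le le_rfl ?_)
      linarith
    linarith
  · rw [Prod.mk.injEq] at hfs
    push Not at hs
    linarith [hfs.2]

end Part2

section Part3
open MeasureTheory AddCircle

/-- complex Euclidean space -/
abbrev CZ (ι : Type) := EuclideanSpace ℂ ι
/-- the circle -/
abbrev Cir := AddCircle (1 : ℝ)
/-- Fourier modes -/
abbrev Kx (N : ℕ) := ↥(Finset.Icc (-(N : ℤ)) N)
/-- truncated loops -/
abbrev LSp (ι : Type) [Fintype ι] (N : ℕ) := PiLp 2 (fun _ : Kx N => CZ ι)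

theorem cz_inner_smul {ι : Type} [Fintype ι] (z : ℂ) (a b : CZ ι) :
    inner ℝ (z • a) b = inner ℝ a ((starRingEnd ℂ z) • b) := by
  simp only [PiLp.inner_apply, PiLp.smul_apply, Complex.inner]
  refine Finset.sum_congr rfl fun i _ => ?_
  simp only [smul_eq_mul, map_mul]
  congr 1
  ring

/-- The loop with given Fourier coefficients. -/
def loop {ι : Type} [Fintype ι] {N : ℕ} (c : LSp ι N) (t : Cir) : CZ ι :=
  ∑ k : Kx N, fourier (k : ℤ) t • c k

theorem cir_integrable {E : Type*} [NormedAddCommGroup E] {f : Cir → E}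
    (hf : Continuous f) : Integrable f haarAddCircle :=
  hf.integrable_of_hasCompactSupport (HasCompactSupport.of_compactSpace f)

theorem loop_continuous {ι : Type} [Fintype ι] {N : ℕ} (c : LSp ι N) : Continuous (loop c) := by
  unfold loop
  fun_prop

theorem loop_continuous₂ {ι : Type} [Fintype ι] {N : ℕ} :
    Continuous fun q : LSp ι N × Cir => loop q.1 q.2 := by
  unfold loop
  fun_prop

theorem loop_add {ι : Type} [Fintype ι] {N : ℕ} (c v : LSp ι N) (t : Cir) :
    loop (c + v) t = loop c t + loop v t := by
  simp [loop, Finset.sum_add_distrib]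

theorem loop_inner {ι : Type} [Fintype ι] {N : ℕ} (u : Cir → CZ ι) (hu : Continuous u)
    (v : LSp ι N) :
    ∫ t, inner ℝ (u t) (loop v t) ∂haarAddCircle =
      ∑ k : Kx N, inner ℝ (fourierCoeff u k) (v k) := by
  have h1 : ∀ t, inner ℝ (u t) (loop v t) =
      ∑ k : Kx N, inner ℝ (v k) (fourier (-(k : ℤ)) t • u t) := by
    intro t
    rw [loop, inner_sum]
    refine Finset.sum_congr rfl fun k _ => ?_
    rw [real_inner_comm, cz_inner_smul, fourier_neg]
  simp_rw [h1]
  rw [integral_finsetSum]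
  · refine Finset.sum_congr rfl fun k _ => ?_
    rw [integral_inner (cir_integrable (by fun_prop)), fourierCoeff, real_inner_comm]
  · intro k _
    exact cir_integrable (by fun_prop)

theorem fourierCoeff_loop {ι : Type} [Fintype ι] {N : ℕ} (c : LSp ι N) (k : Kx N) :
    fourierCoeff (loop c) k = c k := by
  have h : ∀ t, fourier (-(k : ℤ)) t • loop c t =
      ∑ j : Kx N, (fourier (-(k : ℤ)) t • fourier (j : ℤ) t) • c j := by
    intro t
    rw [loop, Finset.smul_sum]
    simp [smul_smul]
  unfold fourierCoeff
  simp_rw [h]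
  rw [integral_finsetSum _ (fun j _ => cir_integrable (by fun_prop))]
  have h2 : ∀ j : Kx N, ∫ t : Cir, (fourier (-(k : ℤ)) t • fourier (j : ℤ) t) • c j ∂haarAddCircle
      = if j = k then c j else 0 := by
    intro j
    rw [integral_smul_const]
    have := fourierCoeff_fourier (T := (1 : ℝ)) (j : ℤ)
    have h3 := congrFun this (k : ℤ)
    unfold fourierCoeff at h3
    rw [h3]
    by_cases hjk : j = k
    · simp [hjk]
    · have : (k : ℤ) ≠ j := fun h => hjk (Subtype.ext h.symm)
      simp [hjk, Pi.single_apply, this]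
  simp_rw [h2]
  simp

theorem loop_parseval {ι : Type} [Fintype ι] {N : ℕ} (c v : LSp ι N) :
    ∫ t, inner ℝ (loop c t) (loop v t) ∂haarAddCircle = inner ℝ c v := by
  rw [loop_inner _ (loop_continuous c), PiLp.inner_apply]
  simp_rw [fourierCoeff_loop]

theorem loop_norm {ι : Type} [Fintype ι] {N : ℕ} (c : LSp ι N) :
    ∫ t, ‖loop c t‖ ^ 2 ∂haarAddCircle = ‖c‖ ^ 2 := by
  simp_rw [← real_inner_self_eq_norm_sq]
  exact loop_parseval c c

/-- truncated Fourier transform -/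
def trunc {ι : Type} [Fintype ι] (N : ℕ) (u : Cir → CZ ι) : LSp ι N :=
  WithLp.toLp 2 fun k => fourierCoeff u k

theorem inner_trunc {ι : Type} [Fintype ι] {N : ℕ} (u : Cir → CZ ι) (hu : Continuous u)
    (v : LSp ι N) :
    ∫ t, inner ℝ (u t) (loop v t) ∂haarAddCircle = inner ℝ (trunc N u) v := by
  rw [loop_inner u hu, PiLp.inner_apply]
  rfl

theorem trunc_bessel {ι : Type} [Fintype ι] {N : ℕ} (u : Cir → CZ ι) (hu : Continuous u) :
    ‖trunc N u‖ ^ 2 ≤ ∫ t, ‖u t‖ ^ 2 ∂haarAddCircle := by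
  have h1 := inner_trunc u hu (trunc N u)
  rw [real_inner_self_eq_norm_sq] at h1
  have h2 := loop_norm (trunc N u)
  have hl := loop_continuous (trunc N u)
  have h3 : ∫ t, inner ℝ (u t) (loop (trunc N u) t) ∂haarAddCircle ≤
      ∫ t, ((1 / 2) * ‖u t‖ ^ 2 + (1 / 2) * ‖loop (trunc N u) t‖ ^ 2) ∂haarAddCircle := by
    refine integral_mono (cir_integrable (by fun_prop)) (cir_integrable (by fun_prop)) fun t => ?_
    have := real_inner_le_norm (u t) (loop (trunc N u) t)
    simp only
    nlinarith [sq_nonneg (‖u t‖ - ‖loop (trunc N u) t‖)]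
  rw [integral_add (cir_integrable (by fun_prop)) (cir_integrable (by fun_prop)),
    integral_const_mul, integral_const_mul] at h3
  linarith

theorem trunc_sub {ι : Type} [Fintype ι] {N : ℕ} (u v : Cir → CZ ι) (hu : Continuous u)
    (hv : Continuous v) : trunc N (fun t => u t - v t) = trunc N u - trunc N v := by
  ext1 k
  simp only [trunc, PiLp.sub_apply]
  unfold fourierCoeff
  simp_rw [smul_sub]
  exact integral_sub (cir_integrable (by fun_prop)) (cir_integrable (by fun_prop))

/-- finite scalar Parseval identity -/
theorem scalar_parseval (s : Finset ℤ) (d : ℤ → ℂ) :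
    ∫ t : Cir, ‖∑ k ∈ s, d k * fourier k t‖ ^ 2 ∂haarAddCircle = ∑ k ∈ s, ‖d k‖ ^ 2 := by
  have h : ∀ t : Cir, ‖∑ k ∈ s, d k * fourier k t‖ ^ 2 =
      (∑ k ∈ s, ∑ j ∈ s, d k * (starRingEnd ℂ (d j)) * (fourier (-j) t • fourier k t)).re := by
    intro t
    rw [← Complex.normSq_eq_norm_sq]
    have : (Complex.normSq (∑ k ∈ s, d k * fourier k t) : ℂ) =
        ∑ k ∈ s, ∑ j ∈ s, d k * (starRingEnd ℂ (d j)) * (fourier (-j) t • fourier k t) := by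
      rw [← Complex.mul_conj, map_sum, Finset.sum_mul_sum]
      refine Finset.sum_congr rfl fun k _ => Finset.sum_congr rfl fun j _ => ?_
      rw [map_mul, fourier_neg, smul_eq_mul]
      ring
    rw [← this, Complex.ofReal_re]
  simp_rw [h]
  have hi : ∀ k j : ℤ, ∫ t : Cir, d k * (starRingEnd ℂ (d j)) * (fourier (-j) t • fourier k t)
      ∂haarAddCircle = if j = k then d k * (starRingEnd ℂ (d j)) else 0 := by
    intro k j
    rw [integral_const_mul]
    have := congrFun (fourierCoeff_fourier (T := (1 : ℝ)) k) j
    unfold fourierCoeff at this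
    rw [this, Pi.single_apply]
    simp
  have e : ∫ t : Cir, (∑ k ∈ s, ∑ j ∈ s, d k * (starRingEnd ℂ (d j)) *
      (fourier (-j) t • fourier k t)).re ∂haarAddCircle =
      (∫ t : Cir, (∑ k ∈ s, ∑ j ∈ s, d k * (starRingEnd ℂ (d j)) *
      (fourier (-j) t • fourier k t)) ∂haarAddCircle).re := by
    exact integral_re (𝕜 := ℂ) (cir_integrable (by fun_prop))
  rw [e, integral_finsetSum _ (fun k _ => cir_integrable (by fun_prop)), Complex.re_sum]
  refine Finset.sum_congr rfl fun k hk => ?_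
  rw [integral_finsetSum _ (fun k _ => cir_integrable (by fun_prop))]
  simp_rw [hi]
  rw [Finset.sum_ite_eq' s k, if_pos hk, Complex.mul_conj, Complex.ofReal_re,
    Complex.normSq_eq_norm_sq]

theorem scalar_L4 (N : ℕ) (a : ℤ → ℂ) :
    ∫ t : Cir, ‖∑ k ∈ Finset.Icc 1 (N : ℤ), a k * fourier k t‖ ^ 4 ∂haarAddCircle ≤
      (∑ k ∈ Finset.Icc 1 (N : ℤ), (k : ℝ) * ‖a k‖ ^ 2) ^ 2 := by
  classical
  set s := Finset.Icc 1 (N : ℤ)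
  let T := Finset.Icc 1 (2 * (N : ℤ))
  let fib : ℤ → Finset (ℤ × ℤ) := fun k => (s ×ˢ s).filter fun q => q.1 + q.2 = k
  let d : ℤ → ℂ := fun k => ∑ q ∈ fib k, a q.1 * a q.2
  have hmaps : ∀ q ∈ s ×ˢ s, q.1 + q.2 ∈ T := by
    intro q hq
    simp only [s, T, Finset.mem_product, Finset.mem_Icc] at hq ⊢
    lia
  have hsq : ∀ t : Cir, ‖∑ k ∈ s, a k * fourier k t‖ ^ 4 = ‖∑ k ∈ T, d k * fourier k t‖ ^ 2 := by
    intro t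
    have : (∑ k ∈ s, a k * fourier k t) ^ 2 = ∑ k ∈ T, d k * fourier k t := by
      rw [sq, Finset.sum_mul_sum, ← Finset.sum_product', ← Finset.sum_fiberwise_of_maps_to hmaps]
      refine Finset.sum_congr rfl fun k _ => ?_
      simp only [d, fib, Finset.sum_mul]
      refine Finset.sum_congr rfl fun q hq => ?_
      rw [← (Finset.mem_filter.1 hq).2, fourier_add]
      ring
    rw [← this, norm_pow, ← pow_mul]
  simp_rw [hsq]
  rw [scalar_parseval]
  have hd : ∀ k ∈ T, ‖d k‖ ^ 2 ≤ ∑ q ∈ fib k, ((q.1 : ℝ) * ‖a q.1‖ ^ 2) * (q.2 * ‖a q.2‖ ^ 2) := by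
    intro k _
    have hpos : ∀ q ∈ fib k, (1 : ℝ) ≤ q.1 ∧ (1 : ℝ) ≤ q.2 ∧ (q.1 : ℝ) + q.2 = k := by
      intro q hq
      simp only [fib, s, Finset.mem_filter, Finset.mem_product, Finset.mem_Icc] at hq
      exact ⟨by exact_mod_cast hq.1.1.1, by exact_mod_cast hq.1.2.1, by exact_mod_cast hq.2⟩
    have h1 : ‖d k‖ ≤ ∑ q ∈ fib k, ‖a q.1‖ * ‖a q.2‖ := by
      refine (norm_sum_le _ _).trans_eq ?_
      simp
    have h2 := Finset.sum_sq_le_sum_mul_sum_of_sq_eq_mul (fib k)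
      (r := fun q => ‖a q.1‖ * ‖a q.2‖) (f := fun q => 1 / ((q.1 : ℝ) * q.2))
      (g := fun q => ((q.1 : ℝ) * ‖a q.1‖ ^ 2) * (q.2 * ‖a q.2‖ ^ 2))
      (fun q hq => by have := hpos q hq; have := this.1; have := (hpos q hq).2.1; positivity)
      (fun q hq => by have := hpos q hq; have := this.1; have := (hpos q hq).2.1; positivity)
      (fun q hq => by
        obtain ⟨h1, h2, -⟩ := hpos q hq
        have h3 : (q.1 : ℝ) ≠ 0 := by positivity
        have h4 : (q.2 : ℝ) ≠ 0 := by positivity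
        field_simp)
    have h3 : ∑ q ∈ fib k, 1 / ((q.1 : ℝ) * q.2) ≤ 1 := by
      rcases (fib k).eq_empty_or_nonempty with he | ⟨q0, hq0⟩
      · rw [he]; simp
      · have hk1 : (1 : ℝ) ≤ k - 1 := by
          obtain ⟨h1, h2, h3⟩ := hpos q0 hq0
          linarith
        have hcard : ((fib k).card : ℝ) ≤ k - 1 := by
          have : (fib k).card ≤ (Finset.Icc 1 (k - 1)).card := by
            refine Finset.card_le_card_of_injOn (fun q => q.1) ?_ ?_
            · intro q hq
              simp only [fib, s, Finset.coe_filter, Finset.mem_product, Finset.mem_Icc, Set.mem_ofPred_eq] at hq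
              simp only [Finset.coe_Icc, Set.mem_Icc]
              lia
            · intro q hq q' hq' h
              simp only [fib, Finset.coe_filter, Set.mem_ofPred_eq] at hq hq' h
              ext
              · exact h
              · lia
          rw [Int.card_Icc] at this
          have h5 : ((k - 1 + 1 - 1).toNat : ℤ) = k - 1 := by
            rw [Int.toNat_of_nonneg]
            · ring
            · have : (1 : ℤ) ≤ k - 1 := by exact_mod_cast hk1
              lia
          have h6 : ((fib k).card : ℤ) ≤ k - 1 := by rw [← h5]; exact_mod_cast this
          exact_mod_cast h6
        calc ∑ q ∈ fib k, 1 / ((q.1 : ℝ) * q.2) ≤ ∑ q ∈ fib k, 1 / ((k : ℝ) - 1) := by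
              refine Finset.sum_le_sum fun q hq => ?_
              obtain ⟨h1, h2, h3⟩ := hpos q hq
              apply one_div_le_one_div_of_le (by linarith)
              rw [← h3]
              nlinarith
          _ = (fib k).card * (1 / ((k : ℝ) - 1)) := by rw [Finset.sum_const, nsmul_eq_mul]
          _ ≤ 1 := by
              rw [mul_one_div]
              exact div_le_one_of_le₀ hcard (by linarith)
    have h4 : 0 ≤ ∑ q ∈ fib k, ((q.1 : ℝ) * ‖a q.1‖ ^ 2) * (q.2 * ‖a q.2‖ ^ 2) :=
      Finset.sum_nonneg fun q hq => by
        obtain ⟨h1, h2, -⟩ := hpos q hq; positivity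
    calc ‖d k‖ ^ 2 ≤ (∑ q ∈ fib k, ‖a q.1‖ * ‖a q.2‖) ^ 2 := by gcongr
      _ ≤ _ := h2
      _ ≤ 1 * _ := by gcongr
      _ = _ := one_mul _
  refine (Finset.sum_le_sum hd).trans_eq ?_
  rw [sq, Finset.sum_mul_sum, ← Finset.sum_product', ← Finset.sum_fiberwise_of_maps_to hmaps]

end Part3

section Part4
open MeasureTheory AddCircle

/-- diagonal weights -/
def Qd {ι : Type} [Fintype ι] (q : ι → ℝ) (z : CZ ι) : CZ ι :=
  WithLp.toLp 2 fun i => (q i : ℂ) * z i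

theorem Qd_apply {ι : Type} [Fintype ι] (q : ι → ℝ) (z : CZ ι) (i : ι) :
    Qd q z i = (q i : ℂ) * z i := rfl

theorem Qd_continuous {ι : Type} [Fintype ι] (q : ι → ℝ) : Continuous (Qd q) := by
  unfold Qd
  fun_prop

theorem Qd_inner {ι : Type} [Fintype ι] (q : ι → ℝ) (z : CZ ι) :
    inner ℝ (Qd q z) z = ∑ i, q i * ‖z i‖ ^ 2 := by
  rw [PiLp.inner_apply]
  refine Finset.sum_congr rfl fun i _ => ?_
  rw [Qd_apply, ← Complex.real_smul, real_inner_smul_left, real_inner_self_eq_norm_sq]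

/-- Assumptions of the abstract existence theorem. -/
structure HZHyp {ι : Type} [Fintype ι] [DecidableEq ι] (H : CZ ι → ℝ) (g : CZ ι → CZ ι)
    (q : ι → ℝ) (i0 : ι) (p : CZ ι) (L B C C4 κ : ℝ) : Prop where
  cH : Continuous H
  cg : Continuous g
  hL : 0 < L
  quad : ∀ z v, H z + inner ℝ (g z) v - L / 2 * ‖v‖ ^ 2 ≤ H (z + v)
  nonneg : ∀ z, 0 ≤ H z
  hB : ∀ z, ‖g z - Qd q z‖ ≤ B
  low : ∀ z, (∑ i, q i * ‖z i‖ ^ 2) / 2 - C ≤ H z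
  hC : 0 ≤ C
  up : ∀ z, H (p + z) ≤ C4 * ‖z‖ ^ 4
  hC4 : 0 < C4
  hκ : 0 < κ
  κ1 : ∀ i, κ ≤ q i / 2
  κ2 : κ ≤ q i0 / 2 - Real.pi
  κ3 : ∀ (k : ℤ) (i : ι), κ ≤ |2 * Real.pi * k - q i|
  q4 : ∀ i, q i ≤ 4 * Real.pi

/-- truncated action functional -/
def psiN {ι : Type} [Fintype ι] (H : CZ ι → ℝ) {N : ℕ} (c : LSp ι N) : ℝ :=
  Real.pi * ∑ k : Kx N, ((k : ℤ) : ℝ) * ‖c k‖ ^ 2 - ∫ t, H (loop c t) ∂haarAddCircle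

/-- multiplication by the frequency -/
def DD {ι : Type} [Fintype ι] {N : ℕ} (c : LSp ι N) : LSp ι N :=
  WithLp.toLp 2 fun k => (2 * Real.pi * ((k : ℤ) : ℝ)) • c k

/-- gradient of the truncated action functional -/
def GrN {ι : Type} [Fintype ι] (g : CZ ι → CZ ι) {N : ℕ} (c : LSp ι N) : LSp ι N :=
  DD c - trunc N (fun t => g (loop c t))

theorem psiN_continuous {ι : Type} [Fintype ι] {H : CZ ι → ℝ} (hH : Continuous H) {N : ℕ} :
    Continuous (psiN H : LSp ι N → ℝ) := by
  unfold psiN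
  refine Continuous.sub (by fun_prop) ?_
  have : Continuous (Function.uncurry fun (c : LSp ι N) (t : Cir) => H (loop c t)) :=
    hH.comp loop_continuous₂
  have h2 := continuous_parametric_integral_of_continuous (μ := haarAddCircle (T := (1 : ℝ)))
    (s := univ) this isCompact_univ
  simpa using h2

theorem GrN_continuous {ι : Type} [Fintype ι] {g : CZ ι → CZ ι} (hg : Continuous g) {N : ℕ} :
    Continuous (GrN g : LSp ι N → LSp ι N) := by
  unfold GrN
  refine Continuous.sub (by unfold DD; fun_prop) ?_
  unfold trunc
  refine (PiLp.continuous_toLp 2 _).comp (continuous_pi fun k => ?_)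
  unfold fourierCoeff
  have : Continuous (Function.uncurry fun (c : LSp ι N) (t : Cir) =>
      fourier (-(k : ℤ)) t • g (loop c t)) :=
    ((fourier (-(k : ℤ))).continuous.comp continuous_snd).smul (hg.comp loop_continuous₂)
  have h2 := continuous_parametric_integral_of_continuous (μ := haarAddCircle (T := (1 : ℝ)))
    (s := univ) this isCompact_univ
  simpa using h2

theorem psiN_quad {ι : Type} [Fintype ι] {H : CZ ι → ℝ} {g : CZ ι → CZ ι} (hH : Continuous H)
    (hg : Continuous g) {L : ℝ} 
    (quad : ∀ z v, H z + inner ℝ (g z) v - L / 2 * ‖v‖ ^ 2 ≤ H (z + v)) {N : ℕ} (c v : LSp ι N) :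
    psiN H (c + v) ≤ psiN H c + inner ℝ (GrN g c) v + (2 * Real.pi * N + L) / 2 * ‖v‖ ^ 2 := by
  have hl := loop_continuous c
  have hlv := loop_continuous v
  have h1 : ∫ t, (H (loop c t) + inner ℝ (g (loop c t)) (loop v t) - L / 2 * ‖loop v t‖ ^ 2)
      ∂haarAddCircle ≤ ∫ t, H (loop (c + v) t) ∂haarAddCircle := by
    refine integral_mono (cir_integrable (by fun_prop))
      (cir_integrable (hH.comp (loop_continuous _))) fun t => ?_
    simp only [loop_add]
    exact quad _ _
  rw [integral_sub (cir_integrable (by fun_prop)) (cir_integrable (by fun_prop)),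
    integral_add (cir_integrable (by fun_prop)) (cir_integrable (by fun_prop)),
    integral_const_mul, loop_norm, inner_trunc (fun t => g (loop c t)) (by fun_prop)] at h1
  have h2 : Real.pi * ∑ k : Kx N, ((k : ℤ) : ℝ) * ‖(c + v) k‖ ^ 2 ≤
      Real.pi * ∑ k : Kx N, ((k : ℤ) : ℝ) * ‖c k‖ ^ 2 + inner ℝ (DD c) v
        + Real.pi * N * ‖v‖ ^ 2 := by
    rw [PiLp.inner_apply, PiLp.norm_sq_eq_of_L2, Finset.mul_sum, Finset.mul_sum, Finset.mul_sum,
      ← Finset.sum_add_distrib, ← Finset.sum_add_distrib]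
    refine Finset.sum_le_sum fun k _ => ?_
    have hk : ((k : ℤ) : ℝ) ≤ N := by exact_mod_cast (Finset.mem_Icc.1 k.2).2
    simp only [DD, PiLp.add_apply, norm_add_sq_real, real_inner_smul_left]
    have : Real.pi * (((k : ℤ) : ℝ) * ‖v k‖ ^ 2) ≤ Real.pi * N * ‖v k‖ ^ 2 := by
      rw [mul_assoc]
      gcongr
    nlinarith
  unfold psiN GrN
  rw [inner_sub_left]
  linarith

/-- coordinate inclusion in mode `k` -/
def sing {ι : Type} [Fintype ι] {N : ℕ} (k : Kx N) (a : CZ ι) : LSp ι N :=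
  WithLp.toLp 2 fun j => if j = k then a else 0

theorem loop_sing_zero {ι : Type} [Fintype ι] {N : ℕ} (k : Kx N) (hk : (k : ℤ) = 0) (a : CZ ι)
    (t : Cir) : loop (sing k a) t = a := by
  unfold loop sing
  rw [Finset.sum_eq_single k]
  · simp [hk]
  · intro j _ hj
    simp [hj]
  · simp

/-- kill positive modes -/
def cutL {ι : Type} [Fintype ι] {N : ℕ} : LSp ι N →ₗ[ℝ] LSp ι N where
  toFun c := WithLp.toLp 2 fun k => if 0 < (k : ℤ) then 0 else c k
  map_add' a b := by
    ext1 k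
    by_cases h : 0 < (k : ℤ) <;> simp [h]
  map_smul' a b := by
    ext1 k
    by_cases h : 0 < (k : ℤ) <;> simp [h]

theorem cutL_apply {ι : Type} [Fintype ι] {N : ℕ} (c : LSp ι N) (k : Kx N) :
    cutL c k = if 0 < (k : ℤ) then 0 else c k := rfl

/-- the negative space -/
def FF (ι : Type) [Fintype ι] (N : ℕ) : Submodule ℝ (LSp ι N) where
  carrier := {c | ∀ k : Kx N, 0 < (k : ℤ) → c k = 0}
  add_mem' := by
    intro a b ha hb k hk
    simp [ha k hk, hb k hk]
  zero_mem' := by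
    intro k hk
    rfl
  smul_mem' := by
    intro r a ha k hk
    simp [ha k hk]

/-- projection on the negative space -/
def PP {ι : Type} [Fintype ι] {N : ℕ} : LSp ι N →L[ℝ] FF ι N :=
  LinearMap.toContinuousLinearMap (cutL.codRestrict (FF ι N) (by
    intro c k hk
    rw [cutL_apply, if_pos hk]))

theorem PP_coe {ι : Type} [Fintype ι] {N : ℕ} (c : LSp ι N) : ((PP c : FF ι N) : LSp ι N) = cutL c :=
  rfl

/-- size of the positive part -/
def nuN {ι : Type} [Fintype ι] {N : ℕ} (c : LSp ι N) : ℝ :=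
  Real.sqrt (∑ k : Kx N, max ((k : ℤ) : ℝ) 0 * ‖c k‖ ^ 2)

theorem nuN_continuous {ι : Type} [Fintype ι] {N : ℕ} : Continuous (nuN : LSp ι N → ℝ) := by
  unfold nuN
  fun_prop

theorem loop_L4 {ι : Type} [Fintype ι] {N : ℕ} (y : LSp ι N)
    (hy : ∀ k : Kx N, ¬ 0 < (k : ℤ) → y k = 0) :
    ∫ t, ‖loop y t‖ ^ 4 ∂haarAddCircle ≤ Fintype.card ι * (nuN y ^ 2) ^ 2 := by
  classical
  let a : ι → ℤ → ℂ := fun i k => if h : k ∈ Finset.Icc (-(N : ℤ)) N then y ⟨k, h⟩ i else 0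
  have hz : ∀ i, ∀ k ∈ Finset.Icc (-(N : ℤ)) N, k ∉ Finset.Icc 1 (N : ℤ) → a i k = 0 := by
    intro i k hk hk'
    simp only [a, dif_pos hk]
    rw [hy ⟨k, hk⟩]
    · rfl
    · simp only [Finset.mem_Icc] at hk hk' ⊢
      lia
  have hsub : Finset.Icc 1 (N : ℤ) ⊆ Finset.Icc (-(N : ℤ)) N := by
    intro k hk
    simp only [Finset.mem_Icc] at hk ⊢
    lia
  have hli : ∀ i t, loop y t i = ∑ k ∈ Finset.Icc 1 (N : ℤ), a i k * fourier k t := by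
    intro i t
    rw [Finset.sum_subset hsub (fun k hk hk' => by rw [hz i k hk hk', zero_mul])]
    rw [← Finset.sum_coe_sort (Finset.Icc (-(N : ℤ)) N)]
    simp only [loop, WithLp.ofLp_sum, WithLp.ofLp_smul, Finset.sum_apply, Pi.smul_apply, smul_eq_mul]
    refine Finset.sum_congr rfl fun k _ => ?_
    simp only [a, dif_pos k.2]
    ring
  have hS : ∀ i, ∑ k ∈ Finset.Icc 1 (N : ℤ), (k : ℝ) * ‖a i k‖ ^ 2 =
      ∑ k : Kx N, max ((k : ℤ) : ℝ) 0 * ‖y k i‖ ^ 2 := by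
    intro i
    have e1 : ∑ k ∈ Finset.Icc 1 (N : ℤ), (k : ℝ) * ‖a i k‖ ^ 2 =
        ∑ k ∈ Finset.Icc 1 (N : ℤ), max (k : ℝ) 0 * ‖a i k‖ ^ 2 := by
      refine Finset.sum_congr rfl fun k hk => ?_
      have : (1 : ℝ) ≤ k := by exact_mod_cast (Finset.mem_Icc.1 hk).1
      rw [max_eq_left (by linarith)]
    rw [e1, Finset.sum_subset hsub (fun k hk hk' => by rw [hz i k hk hk']; simp),
      ← Finset.sum_coe_sort (Finset.Icc (-(N : ℤ)) N)]
    refine Finset.sum_congr rfl fun k _ => ?_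
    simp only [a, dif_pos k.2]
  have hS0 : ∀ i, 0 ≤ ∑ k : Kx N, max ((k : ℤ) : ℝ) 0 * ‖y k i‖ ^ 2 := fun i =>
    Finset.sum_nonneg fun k _ => by positivity
  have hnu : nuN y ^ 2 = ∑ i, ∑ k : Kx N, max ((k : ℤ) : ℝ) 0 * ‖y k i‖ ^ 2 := by
    rw [nuN, Real.sq_sqrt (Finset.sum_nonneg fun k _ => by positivity), Finset.sum_comm]
    refine Finset.sum_congr rfl fun k _ => ?_
    rw [EuclideanSpace.norm_sq_eq, Finset.mul_sum]
  have hpt : ∀ t, ‖loop y t‖ ^ 4 ≤ Fintype.card ι * ∑ i, ‖loop y t i‖ ^ 4 := by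
    intro t
    have h1 : ‖loop y t‖ ^ 4 = (∑ i, ‖loop y t i‖ ^ 2) ^ 2 := by
      rw [← EuclideanSpace.norm_sq_eq]; ring
    rw [h1]
    refine (sq_sum_le_card_mul_sum_sq).trans_eq ?_
    rw [Finset.card_univ]
    congr 1
    refine Finset.sum_congr rfl fun i _ => by ring
  have hl := loop_continuous y
  calc ∫ t, ‖loop y t‖ ^ 4 ∂haarAddCircle
      ≤ ∫ t, Fintype.card ι * ∑ i, ‖loop y t i‖ ^ 4 ∂haarAddCircle :=
        integral_mono (cir_integrable (by fun_prop)) (cir_integrable (by fun_prop)) hpt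
    _ = Fintype.card ι * ∑ i, ∫ t, ‖loop y t i‖ ^ 4 ∂haarAddCircle := by
        rw [integral_const_mul, integral_finsetSum _ (fun i _ => cir_integrable (by fun_prop))]
    _ ≤ Fintype.card ι * ∑ i, (∑ k : Kx N, max ((k : ℤ) : ℝ) 0 * ‖y k i‖ ^ 2) ^ 2 := by
        refine mul_le_mul_of_nonneg_left (Finset.sum_le_sum fun i _ => ?_) (by positivity)
        rw [← hS i]
        simp_rw [hli i]
        exact scalar_L4 N (a i)
    _ ≤ Fintype.card ι * (nuN y ^ 2) ^ 2 := by
        rw [hnu]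
        refine mul_le_mul_of_nonneg_left ?_ (by positivity)
        exact Finset.sum_sq_le_sq_sum_of_nonneg fun i _ => hS0 i

end Part4

section Part5
open MeasureTheory AddCircle

theorem loop_Q {ι : Type} [Fintype ι] {N : ℕ} (q : ι → ℝ) (c : LSp ι N) (t : Cir) :
    Qd q (loop c t) = loop (WithLp.toLp 2 fun k => Qd q (c k)) t := by
  ext i
  simp only [Qd, loop, WithLp.ofLp_sum, WithLp.ofLp_smul, Finset.sum_apply, Pi.smul_apply,
    smul_eq_mul, Finset.mul_sum]
  refine Finset.sum_congr rfl fun k _ => ?_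
  ring

theorem trunc_loop {ι : Type} [Fintype ι] {N : ℕ} (c : LSp ι N) : trunc N (loop c) = c := by
  ext1 k
  exact fourierCoeff_loop c k

theorem cir_int_const (a : ℝ) : ∫ _ : Cir, a ∂haarAddCircle = a := by simp

theorem psi_upper {ι : Type} [Fintype ι] [DecidableEq ι] {H : CZ ι → ℝ} {g : CZ ι → CZ ι}
    {q : ι → ℝ} {i0 : ι} {p : CZ ι} {L B C C4 κ : ℝ} (h : HZHyp H g q i0 p L B C C4 κ) {N : ℕ}
    (c : LSp ι N) : psiN H c ≤ ∑ k : Kx N, (Real.pi * ((k : ℤ) : ℝ) * ‖c k‖ ^ 2 -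
      (∑ i, q i * ‖c k i‖ ^ 2) / 2) + C := by
  have hl := loop_continuous c
  have h1 : ∫ t, ((inner ℝ (Qd q (loop c t)) (loop c t)) / 2 - C) ∂haarAddCircle ≤
      ∫ t, H (loop c t) ∂haarAddCircle := by
    have := Qd_continuous q
    refine integral_mono (cir_integrable (by fun_prop))
      (cir_integrable (h.cH.comp hl)) fun t => ?_
    simp only [Qd_inner]
    exact h.low _
  simp_rw [loop_Q] at h1
  have hl2 := loop_continuous (WithLp.toLp 2 fun k => Qd q (c k))
  rw [integral_sub (cir_integrable (by fun_prop)) (cir_integrable (by fun_prop)),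
    integral_div, loop_parseval, cir_int_const, PiLp.inner_apply] at h1
  simp only [Qd_inner] at h1
  unfold psiN
  rw [Finset.sum_sub_distrib, ← Finset.sum_div, Finset.mul_sum]
  simp only [mul_assoc]
  linarith

theorem cut_norm {ι : Type} [Fintype ι] {N : ℕ} (c : LSp ι N) : ‖cutL c‖ ≤ ‖c‖ := by
  rw [← sq_le_sq₀ (norm_nonneg _) (norm_nonneg _), PiLp.norm_sq_eq_of_L2, PiLp.norm_sq_eq_of_L2]
  refine Finset.sum_le_sum fun k _ => ?_
  rw [cutL_apply]
  split_ifs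
  · simp
  · exact le_rfl

theorem norm_coord {ι : Type} [Fintype ι] {N : ℕ} (c : LSp ι N) (k : Kx N) : ‖c k‖ ≤ ‖c‖ :=
  PiLp.norm_apply_le c k

theorem norm_sing {ι : Type} [Fintype ι] {N : ℕ} (k : Kx N) (a : CZ ι) : 
    ‖(sing k a : LSp ι N)‖ = ‖a‖ := by
  rw [← sq_eq_sq₀ (norm_nonneg _) (norm_nonneg _), PiLp.norm_sq_eq_of_L2]
  rw [Finset.sum_eq_single k]
  · simp [sing]
  · intro j _ hj
    simp [sing, hj]
  · simp

theorem hz_ps {ι : Type} [Fintype ι] [DecidableEq ι] {H : CZ ι → ℝ} {g : CZ ι → CZ ι}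
    {q : ι → ℝ} {i0 : ι} {p : CZ ι} {L B C C4 κ : ℝ} (h : HZHyp H g q i0 p L B C C4 κ) :
    ∃ β : ℝ, 0 < β ∧ ∀ N : ℕ, 1 ≤ N → ∀ δ : ℝ, 0 < δ →
      ∃ c : LSp ι N, β ≤ psiN H c ∧ ‖GrN g c‖ < δ := by
  haveI : Nonempty ι := ⟨i0⟩
  have hcard : (0 : ℝ) < Fintype.card ι := by exact_mod_cast Fintype.card_pos
  set M := C4 * Fintype.card ι with hM
  have hMpos : 0 < M := mul_pos h.hC4 hcard
  have hpi := Real.pi_pos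
  have hκ := h.hκ
  set α := Real.sqrt (Real.pi / (2 * M)) with hα
  have hα0 : 0 < α := Real.sqrt_pos.2 (by positivity)
  have hα2 : α ^ 2 = Real.pi / (2 * M) := Real.sq_sqrt (by positivity)
  have hαM : M * α ^ 2 = Real.pi / 2 := by rw [hα2]; field_simp
  refine ⟨(Real.pi / 2 * α ^ 2) / 2, by positivity, fun N hN δ hδ => ?_⟩
  have h0m : (0 : ℤ) ∈ Finset.Icc (-(N : ℤ)) N := by simp
  have h1m : (1 : ℤ) ∈ Finset.Icc (-(N : ℤ)) N := by simp; lia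
  let k0 : Kx N := ⟨0, h0m⟩
  let k1 : Kx N := ⟨1, h1m⟩
  let e : LSp ι N := sing k1 (EuclideanSpace.single i0 (1 : ℂ))
  let ph : LSp ι N := sing k0 p
  have hek : ∀ k : Kx N, k ≠ k1 → e k = 0 := by
    intro k hk
    simp [e, sing, hk]
  have he1 : e k1 = EuclideanSpace.single i0 (1 : ℂ) := by simp [e, sing]
  have hpk : ∀ k : Kx N, k ≠ k0 → ph k = 0 := by
    intro k hk
    simp [ph, sing, hk]
  have hne : k1 ≠ k0 := by
    intro hh
    have := congrArg Subtype.val hh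
    simp [k0, k1] at this
  have hnonneg : ∀ c : LSp ι N, 0 ≤ ∫ t, H (loop c t) ∂haarAddCircle := fun c =>
    integral_nonneg fun t => h.nonneg _
  refine minimax_link (FF ι N) PP ?_ e ph ?_ nuN nuN_continuous ?_ (psiN H) (psiN_continuous h.cH)
    (GrN g) (GrN_continuous h.cg) (2 * Real.pi * N + L) ?_ ?_ ?_ (‖p‖ + Real.sqrt (C / κ)) ?_ α
    (Real.pi / 2 * α ^ 2) hα0 (by positivity) ?_ δ hδ
  · intro f
    ext1
    rw [PP_coe]
    ext1 k
    rw [cutL_apply]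
    split_ifs with hk
    · exact (f.2 k hk).symm
    · rfl
  · ext1
    rw [PP_coe]
    ext1 k
    rw [cutL_apply]
    split_ifs with hk
    · rfl
    · rw [hek]
      · rfl
      · rintro rfl
        simp [k1] at hk
  · intro f s hs
    unfold nuN
    rw [Finset.sum_eq_single k1]
    · have : (f : LSp ι N) k1 = 0 := f.2 k1 (by simp [k1])
      simp only [PiLp.add_apply, PiLp.smul_apply, this, he1, zero_add, norm_smul]
      simp [k1, abs_of_nonneg hs, Real.sqrt_sq hs]
    · intro k _ hk
      simp only [PiLp.add_apply, PiLp.smul_apply, hek k hk, smul_zero, add_zero]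
      by_cases hk0 : 0 < (k : ℤ)
      · rw [f.2 k hk0]; simp
      · have : ((k : ℤ) : ℝ) ≤ 0 := by exact_mod_cast not_lt.1 hk0
        rw [max_eq_right this, zero_mul]
    · simp
  · have := h.hL
    positivity
  · exact fun x v => psiN_quad h.cH h.cg h.quad x v
  · intro f
    unfold psiN
    have h1 : ∑ k : Kx N, ((k : ℤ) : ℝ) * ‖(ph + (f : LSp ι N)) k‖ ^ 2 ≤ 0 := by
      refine Finset.sum_nonpos fun k _ => ?_
      by_cases hk0 : 0 < (k : ℤ)
      · have : k ≠ k0 := by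
          rintro rfl
          simp [k0] at hk0
        rw [PiLp.add_apply, f.2 k hk0, hpk k this]; simp
      · have : ((k : ℤ) : ℝ) ≤ 0 := by exact_mod_cast not_lt.1 hk0
        exact mul_nonpos_of_nonpos_of_nonneg this (by positivity)
    have h2 := hnonneg (ph + f)
    nlinarith
  · intro f s hs hfs
    have hfe : ‖p‖ + Real.sqrt (C / κ) ≤ ‖(f : LSp ι N) + s • e‖ := by
      rcases hfs with hf | hs'
      · have : cutL ((f : LSp ι N) + s • e) = f := by
          ext1 k
          rw [cutL_apply]
          split_ifs with hk
          · exact (f.2 k hk).symm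
          · rw [PiLp.add_apply, PiLp.smul_apply, hek k, smul_zero, add_zero]
            rintro rfl
            simp [k1] at hk
        have h2 := cut_norm ((f : LSp ι N) + s • e)
        rw [this] at h2
        exact hf.trans h2
      · have h2 := norm_coord ((f : LSp ι N) + s • e) k1
        have : (f : LSp ι N) k1 = 0 := f.2 k1 (by simp [k1])
        rw [PiLp.add_apply, PiLp.smul_apply, this, he1, zero_add, norm_smul] at h2
        simp [abs_of_nonneg hs] at h2
        exact hs'.trans h2
    set c := ph + (f : LSp ι N) + s • e with hc
    have hcn : Real.sqrt (C / κ) ≤ ‖c‖ := by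
      have : (f : LSp ι N) + s • e = c - ph := by rw [hc]; abel
      rw [this] at hfe
      have h3 := norm_sub_le c ph
      have h4 : ‖ph‖ = ‖p‖ := norm_sing _ _
      linarith
    have hcn2 : C ≤ κ * ‖c‖ ^ 2 := by
      have h3 : C / κ ≤ ‖c‖ ^ 2 := (Real.sqrt_le_left (norm_nonneg _)).1 hcn
      rw [div_le_iff₀ hκ] at h3
      linarith
    have h1 := psi_upper h c
    have h2 : ∑ k : Kx N, (Real.pi * ((k : ℤ) : ℝ) * ‖c k‖ ^ 2 -
      (∑ i, q i * ‖c k i‖ ^ 2) / 2) ≤ ∑ k : Kx N, (- κ * ‖c k‖ ^ 2) := by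
      refine Finset.sum_le_sum fun k _ => ?_
      by_cases hk0 : 0 < (k : ℤ)
      · have hkk0 : k ≠ k0 := by
          rintro rfl
          simp [k0] at hk0
        have hck : c k = s • e k := by
          rw [hc, PiLp.add_apply, PiLp.add_apply, f.2 k hk0, hpk k hkk0, PiLp.smul_apply]; simp
        by_cases hk1 : k = k1
        · have e1 : ‖c k‖ ^ 2 = s ^ 2 := by
            rw [hck, hk1, he1, norm_smul]; simp
          have e2 : ∑ i, q i * ‖c k i‖ ^ 2 = q i0 * s ^ 2 := by
            rw [Finset.sum_eq_single i0]
            · rw [hck, hk1, he1]; simp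
            · intro i _ hi
              rw [hck, hk1, he1]; simp [hi]
            · simp
          rw [e1, e2, hk1]
          simp only [k1]
          have := h.κ2
          push_cast
          nlinarith [mul_le_mul_of_nonneg_right this (sq_nonneg s)]
        · rw [hck, hek k hk1]; simp
      · have : ((k : ℤ) : ℝ) ≤ 0 := by exact_mod_cast not_lt.1 hk0
        have e1 : κ * ‖c k‖ ^ 2 ≤ (∑ i, q i * ‖c k i‖ ^ 2) / 2 := by
          rw [EuclideanSpace.norm_sq_eq, Finset.mul_sum, Finset.sum_div]
          refine Finset.sum_le_sum fun i _ => ?_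
          have := h.κ1 i
          nlinarith [mul_le_mul_of_nonneg_right this (sq_nonneg ‖c k i‖)]
        have e2 : Real.pi * ((k : ℤ) : ℝ) * ‖c k‖ ^ 2 ≤ 0 :=
          mul_nonpos_of_nonpos_of_nonneg (mul_nonpos_of_nonneg_of_nonpos hpi.le this)
            (by positivity)
        linarith
    rw [← Finset.mul_sum, ← PiLp.norm_sq_eq_of_L2] at h2
    linarith
  · intro y hy hnu
    have hyk : ∀ k : Kx N, ¬ 0 < (k : ℤ) → y k = 0 := by
      intro k hk
      have h1 := congrArg (fun w : FF ι N => (w : LSp ι N) k) hy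
      simp only [PP_coe, cutL_apply, if_neg hk] at h1
      exact h1
    have h4 := loop_L4 y hyk
    have hl := loop_continuous y
    have h5 : ∫ t, H (loop (ph + y) t) ∂haarAddCircle ≤ ∫ t, C4 * ‖loop y t‖ ^ 4 ∂haarAddCircle := by
      refine integral_mono (cir_integrable (h.cH.comp (loop_continuous _)))
        (cir_integrable (by fun_prop)) fun t => ?_
      simp only [loop_add]
      have : loop ph t = p := loop_sing_zero k0 rfl p t
      rw [this]
      exact h.up _
    rw [integral_const_mul] at h5
    have h6 : ∑ k : Kx N, ((k : ℤ) : ℝ) * ‖(ph + y) k‖ ^ 2 = nuN y ^ 2 := by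
      rw [nuN, Real.sq_sqrt (Finset.sum_nonneg fun k _ => by positivity)]
      refine Finset.sum_congr rfl fun k _ => ?_
      by_cases hk0 : 0 < (k : ℤ)
      · have hkk0 : k ≠ k0 := by
          rintro rfl
          simp [k0] at hk0
        have : (0 : ℝ) ≤ ((k : ℤ) : ℝ) := by exact_mod_cast hk0.le
        rw [PiLp.add_apply, hpk k hkk0, zero_add, max_eq_left this]
      · rw [hyk k hk0]
        by_cases hkk0 : k = k0
        · rw [hkk0]; simp [k0]
        · rw [PiLp.add_apply, hpk k hkk0, hyk k hk0]; simp
    unfold psiN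
    rw [h6]
    rw [hnu] at h4 ⊢
    have h7 := mul_le_mul_of_nonneg_left h4 h.hC4.le
    have h8 : C4 * (Fintype.card ι * (α ^ 2) ^ 2) = Real.pi / 2 * α ^ 2 := by
      rw [← hαM, hM]; ring
    nlinarith

end Part5

section Part6
open MeasureTheory AddCircle

theorem ps_bound {ι : Type} [Fintype ι] [DecidableEq ι] {H : CZ ι → ℝ} {g : CZ ι → CZ ι}
    {q : ι → ℝ} {i0 : ι} {p : CZ ι} {L B C C4 κ : ℝ} (h : HZHyp H g q i0 p L B C C4 κ) {N : ℕ}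
    (c : LSp ι N) (hc : ‖GrN g c‖ ≤ 1) :
    ‖c‖ ≤ (1 + B) / κ ∧ ‖DD c‖ ≤ 1 + B + 4 * Real.pi * ((1 + B) / κ) := by
  have hl := loop_continuous c
  have hQ := Qd_continuous q
  have hg := h.cg
  have hκ := h.hκ
  have hB0 : 0 ≤ B := (norm_nonneg _).trans (h.hB 0)
  set QQ : LSp ι N := WithLp.toLp 2 fun k => Qd q (c k) with hQQ
  have e1 : trunc N (fun t => Qd q (loop c t)) = QQ := by
    have : (fun t => Qd q (loop c t)) = loop QQ := by
      ext1 t; exact loop_Q q c t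
    rw [this, trunc_loop]
  have e2 : trunc N (fun t => g (loop c t) - Qd q (loop c t)) =
      trunc N (fun t => g (loop c t)) - QQ := by
    rw [trunc_sub _ _ (by fun_prop) (by fun_prop), e1]
  have e3 : ‖trunc N (fun t => g (loop c t) - Qd q (loop c t))‖ ≤ B := by
    have h1 := trunc_bessel (N := N) (fun t => g (loop c t) - Qd q (loop c t)) (by fun_prop)
    have h2 : ∫ t, ‖g (loop c t) - Qd q (loop c t)‖ ^ 2 ∂haarAddCircle ≤
        ∫ _ : Cir, B ^ 2 ∂haarAddCircle := by
      refine integral_mono (cir_integrable (by fun_prop)) (cir_integrable (by fun_prop)) fun t => ?_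
      have := h.hB (loop c t)
      simp only
      gcongr
    rw [cir_int_const] at h2
    exact (sq_le_sq₀ (norm_nonneg _) hB0).1 (h1.trans h2)
  have e4 : DD c - QQ = GrN g c + trunc N (fun t => g (loop c t) - Qd q (loop c t)) := by
    rw [e2, GrN]; abel
  have e5 : ‖DD c - QQ‖ ≤ 1 + B := by
    rw [e4]
    exact (norm_add_le _ _).trans (add_le_add hc e3)
  have e6 : κ * ‖c‖ ≤ ‖DD c - QQ‖ := by
    rw [← sq_le_sq₀ (by positivity) (norm_nonneg _), mul_pow, PiLp.norm_sq_eq_of_L2,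
      PiLp.norm_sq_eq_of_L2, Finset.mul_sum]
    refine Finset.sum_le_sum fun k _ => ?_
    rw [EuclideanSpace.norm_sq_eq, EuclideanSpace.norm_sq_eq, Finset.mul_sum]
    refine Finset.sum_le_sum fun i _ => ?_
    have : (DD c - QQ) k i = ((2 * Real.pi * ((k : ℤ) : ℝ) - q i : ℝ) : ℂ) * c k i := by
      simp only [DD, hQQ, Qd, PiLp.sub_apply, PiLp.smul_apply, Complex.real_smul]
      push_cast
      ring
    rw [this, norm_mul, mul_pow, Complex.norm_real, Real.norm_eq_abs]
    have := h.κ3 k i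
    gcongr
  have e7 : ‖c‖ ≤ (1 + B) / κ := by
    rw [le_div_iff₀ hκ]
    linarith
  have e8 : ‖QQ‖ ≤ 4 * Real.pi * ‖c‖ := by
    have hpi := Real.pi_pos
    rw [← sq_le_sq₀ (norm_nonneg _) (by positivity), mul_pow, PiLp.norm_sq_eq_of_L2,
      PiLp.norm_sq_eq_of_L2, Finset.mul_sum]
    refine Finset.sum_le_sum fun k _ => ?_
    rw [EuclideanSpace.norm_sq_eq, EuclideanSpace.norm_sq_eq, Finset.mul_sum]
    refine Finset.sum_le_sum fun i _ => ?_
    have : QQ k i = (q i : ℂ) * c k i := rfl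
    rw [this, norm_mul, mul_pow, Complex.norm_real, Real.norm_eq_abs]
    have h1 := h.κ1 i
    rw [abs_of_nonneg (by linarith)]
    have h2 := h.q4 i
    have h3 : 0 ≤ q i := by linarith
    gcongr
  refine ⟨e7, ?_⟩
  have : DD c = (DD c - QQ) + QQ := by abel
  rw [this]
  refine (norm_add_le _ _).trans (add_le_add e5 (e8.trans ?_))
  have hpi := Real.pi_pos
  gcongr

theorem summ_w : Summable fun k : ℤ => 1 / (1 + (k : ℝ) ^ 2) := by
  have h1 : Summable fun k : ℤ => 1 / (k : ℝ) ^ 2 := Real.summable_one_div_int_pow.2 (by norm_num)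
  have h2 : Summable fun k : ℤ => if k = 0 then (1 : ℝ) else 0 := (hasSum_ite_eq 0 1).summable
  refine Summable.of_nonneg_of_le (fun k => by positivity) (fun k => ?_) (h1.add h2)
  by_cases hk : k = 0
  · simp [hk]
  · have : (k : ℝ) ≠ 0 := by exact_mod_cast hk
    rw [if_neg hk, add_zero]
    apply one_div_le_one_div_of_le (by positivity)
    linarith

theorem fou_norm (k : ℤ) (u : Cir) : ‖fourier k u‖ = 1 := by
  rw [fourier_apply]
  exact Circle.norm_coe _

/-- modulus of continuity -/
def Wm (u : Cir) : ℝ := ∑' k : ℤ, ‖fourier k u - 1‖ ^ 2 * (1 / (1 + (k : ℝ) ^ 2))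

theorem Wm_term (k : ℤ) (u : Cir) : ‖fourier k u - 1‖ ^ 2 * (1 / (1 + (k : ℝ) ^ 2)) ≤
    4 * (1 / (1 + (k : ℝ) ^ 2)) := by
  have h1 : ‖fourier k u - 1‖ ≤ 2 := by
    refine (norm_sub_le _ _).trans ?_
    rw [fou_norm]; norm_num
  have : ‖fourier k u - 1‖ ^ 2 ≤ 2 ^ 2 := by gcongr
  have h3 : 0 ≤ 1 / (1 + (k : ℝ) ^ 2) := by positivity
  nlinarith

theorem Wm_continuous : Continuous Wm := by
  unfold Wm
  refine continuous_tsum (u := fun k : ℤ => 4 * (1 / (1 + (k : ℝ) ^ 2))) (fun k => by fun_prop)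
    (summ_w.mul_left 4) fun k u => ?_
  rw [Real.norm_of_nonneg (by positivity)]
  exact Wm_term k u

theorem Wm_zero : Wm 0 = 0 := by simp [Wm]

theorem Wm_summable (u : Cir) :
    Summable fun k : ℤ => ‖fourier k u - 1‖ ^ 2 * (1 / (1 + (k : ℝ) ^ 2)) :=
  Summable.of_nonneg_of_le (fun k => by positivity) (fun k => Wm_term k u) (summ_w.mul_left 4)

theorem sum_Kx_le {N : ℕ} (f : ℤ → ℝ) (hf : ∀ k, 0 ≤ f k) (hs : Summable f) :
    ∑ k : Kx N, f k ≤ ∑' k, f k := by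
  rw [Finset.sum_coe_sort (Finset.Icc (-(N : ℤ)) N) f]
  exact hs.sum_le_tsum _ fun k _ => hf k

theorem loop_cs {ι : Type} [Fintype ι] {N : ℕ} (c : LSp ι N) (b : ℤ → ℂ)
    (hs : Summable fun k : ℤ => ‖b k‖ ^ 2 * (1 / (1 + (k : ℝ) ^ 2))) :
    ‖∑ k : Kx N, b k • c k‖ ^ 2 ≤ (‖c‖ ^ 2 + ‖DD c‖ ^ 2) *
      ∑' k : ℤ, ‖b k‖ ^ 2 * (1 / (1 + (k : ℝ) ^ 2)) := by
  have h1 : ‖∑ k : Kx N, b k • c k‖ ≤ ∑ k : Kx N, ‖b k‖ * ‖c k‖ := by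
    refine (norm_sum_le _ _).trans_eq ?_
    simp [norm_smul]
  have h2 := Finset.sum_sq_le_sum_mul_sum_of_sq_le_mul (Finset.univ : Finset (Kx N))
      (r := fun k => ‖b k‖ * ‖c k‖) (f := fun k => (1 + ((k : ℤ) : ℝ) ^ 2) * ‖c k‖ ^ 2)
      (g := fun k => ‖b k‖ ^ 2 * (1 / (1 + ((k : ℤ) : ℝ) ^ 2)))
      (fun k _ => by positivity) (fun k _ => by positivity) (fun k _ => by
        apply le_of_eq
        field_simp)
  have h3 := sum_Kx_le (N := N) _ (fun k => by positivity) hs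
  have h4 : ∑ k : Kx N, (1 + ((k : ℤ) : ℝ) ^ 2) * ‖c k‖ ^ 2 ≤ ‖c‖ ^ 2 + ‖DD c‖ ^ 2 := by
    rw [PiLp.norm_sq_eq_of_L2, PiLp.norm_sq_eq_of_L2, ← Finset.sum_add_distrib]
    refine Finset.sum_le_sum fun k _ => ?_
    simp only [DD, norm_smul, mul_pow, Real.norm_eq_abs, sq_abs]
    have h5 : 1 ≤ (2 * Real.pi) ^ 2 := by nlinarith [Real.pi_gt_three]
    have h6 : 0 ≤ ((k : ℤ) : ℝ) ^ 2 * ‖c k‖ ^ 2 := by positivity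
    nlinarith
  calc _ ≤ (∑ k : Kx N, ‖b k‖ * ‖c k‖) ^ 2 := by gcongr
    _ ≤ _ := h2
    _ ≤ _ := by gcongr

theorem loop_modulus {ι : Type} [Fintype ι] {N : ℕ} (c : LSp ι N) (s t : Cir) :
    ‖loop c s - loop c t‖ ^ 2 ≤ (‖c‖ ^ 2 + ‖DD c‖ ^ 2) * Wm (s - t) := by
  have hn : ∀ k : ℤ, ‖fourier k s - fourier k t‖ = ‖fourier k (s - t) - 1‖ := by
    intro k
    have : fourier k s - fourier k t = fourier k t * (fourier k (s - t) - 1) := by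
      rw [mul_sub, mul_one]
      congr 1
      rw [fourier_apply, fourier_apply, fourier_apply, ← Circle.coe_mul, ← toCircle_add, ← smul_add]
      congr 4
      abel
    rw [this, norm_mul, fou_norm, one_mul]
  have h := loop_cs c (fun k => fourier k s - fourier k t) (by
    simp_rw [hn]
    exact Wm_summable _)
  simp_rw [hn] at h
  have e : loop c s - loop c t = ∑ k : Kx N, (fourier k s - fourier k t) • c k := by
    simp only [loop, sub_smul, Finset.sum_sub_distrib]
  rw [e]
  exact h

theorem loop_sup {ι : Type} [Fintype ι] {N : ℕ} (c : LSp ι N) (t : Cir) :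
    ‖loop c t‖ ^ 2 ≤ (‖c‖ ^ 2 + ‖DD c‖ ^ 2) * ∑' k : ℤ, 1 / (1 + (k : ℝ) ^ 2) := by
  have h := loop_cs c (fun k => fourier k t) (by simpa only [fou_norm, one_pow, one_mul] using summ_w)
  simpa only [fou_norm, one_pow, one_mul, loop] using h

theorem psi_action {ι : Type} [Fintype ι] {H : CZ ι → ℝ} {g : CZ ι → CZ ι} (hH : Continuous H)
    (hg : Continuous g) {N : ℕ} (c : LSp ι N) :
    psiN H c = inner ℝ (GrN g c) c / 2 +
      ∫ t, (inner ℝ (g (loop c t)) (loop c t) / 2 - H (loop c t)) ∂haarAddCircle := by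
  have hl := loop_continuous c
  rw [integral_sub (cir_integrable (by fun_prop)) (cir_integrable (by fun_prop)), integral_div,
    inner_trunc (fun t => g (loop c t)) (by fun_prop)]
  have : Real.pi * ∑ k : Kx N, ((k : ℤ) : ℝ) * ‖c k‖ ^ 2 = inner ℝ (DD c) c / 2 := by
    rw [PiLp.inner_apply, Finset.mul_sum, Finset.sum_div]
    refine Finset.sum_congr rfl fun k _ => ?_
    simp only [DD, real_inner_smul_left, real_inner_self_eq_norm_sq]
    ring
  rw [psiN, GrN, inner_sub_left, this]
  ring

end Part6

section Part7
open MeasureTheory AddCircle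

theorem cir_dct {E : Type*} [NormedAddCommGroup E] [NormedSpace ℝ E] (F : ℕ → Cir → E) (f : Cir → E)
    (hF : ∀ n, Continuous (F n)) (M : ℝ) (hM : ∀ n t, ‖F n t‖ ≤ M)
    (hlim : ∀ t, Filter.Tendsto (fun n => F n t) Filter.atTop (nhds (f t))) :
    Filter.Tendsto (fun n => ∫ t, F n t ∂haarAddCircle) Filter.atTop
      (nhds (∫ t, f t ∂haarAddCircle)) := by
  refine tendsto_integral_of_dominated_convergence (fun _ => M) ?_ (cir_integrable (by fun_prop)) ?_ ?_
  · exact fun n => (cir_integrable (hF n)).aestronglyMeasurable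
  · exact fun n => Filter.Eventually.of_forall (hM n)
  · exact Filter.Eventually.of_forall hlim

theorem hz_limit {ι : Type} [Fintype ι] [DecidableEq ι] {H : CZ ι → ℝ} {g : CZ ι → CZ ι}
    {q : ι → ℝ} {i0 : ι} {p : CZ ι} {L B C C4 κ : ℝ} (h : HZHyp H g q i0 p L B C C4 κ) :
    ∃ x : Cir → CZ ι, Continuous x ∧
      (∀ k : ℤ, (2 * Real.pi * (k : ℝ)) • fourierCoeff x k = fourierCoeff (fun t => g (x t)) k) ∧
      0 < ∫ t, (inner ℝ (g (x t)) (x t) / 2 - H (x t)) ∂haarAddCircle := by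
  obtain ⟨β, hβ, hps⟩ := hz_ps h
  have hex : ∀ n : ℕ, ∃ c : LSp ι (n + 1), β ≤ psiN H c ∧ ‖GrN g c‖ < 1 / ((n : ℝ) + 1) :=
    fun n => hps (n + 1) (by lia) _ (by positivity)
  choose c hc1 hc2 using hex
  have hc3 : ∀ n, ‖GrN g (c n)‖ ≤ 1 := fun n => (hc2 n).le.trans (by
    rw [div_le_one (by positivity)]; linarith [(n.cast_nonneg : (0 : ℝ) ≤ n)])
  set D1 := (1 + B) / κ with hD1
  set D2 := 1 + B + 4 * Real.pi * D1 with hD2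
  have hb1 : ∀ n, ‖c n‖ ≤ D1 := fun n => (ps_bound h (c n) (hc3 n)).1
  have hb2 : ∀ n, ‖DD (c n)‖ ≤ D2 := fun n => (ps_bound h (c n) (hc3 n)).2
  have hD10 : 0 ≤ D1 := (norm_nonneg _).trans (hb1 0)
  set M := D1 ^ 2 + D2 ^ 2 with hM
  have hM0 : 0 ≤ M := by positivity
  have hbM : ∀ n, ‖c n‖ ^ 2 + ‖DD (c n)‖ ^ 2 ≤ M := by
    intro n
    have := hb1 n
    have := hb2 n
    rw [hM]
    gcongr
  set S := ∑' k : ℤ, 1 / (1 + (k : ℝ) ^ 2) with hS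
  have hS0 : 0 ≤ S := tsum_nonneg fun k => by positivity
  set R := Real.sqrt (M * S) with hR
  have hsup : ∀ n t, ‖loop (c n) t‖ ≤ R := by
    intro n t
    refine Real.le_sqrt_of_sq_le ((loop_sup (c n) t).trans ?_)
    exact mul_le_mul_of_nonneg_right (hbM n) hS0
  have hWn : ∀ u, 0 ≤ Wm u := fun u => tsum_nonneg fun k => by positivity
  have hmod : ∀ n s t, dist (loop (c n) s) (loop (c n) t) ≤ Real.sqrt (M * Wm (s - t)) := by
    intro n s t
    rw [dist_eq_norm]
    refine Real.le_sqrt_of_sq_le ((loop_modulus (c n) s t).trans ?_)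
    exact mul_le_mul_of_nonneg_right (hbM n) (hWn _)
  let X : ℕ → BoundedContinuousFunction Cir (CZ ι) := fun n =>
    BoundedContinuousFunction.mkOfCompact ⟨loop (c n), loop_continuous _⟩
  have hXa : ∀ n t, X n t = loop (c n) t := fun n t => rfl
  have hcomp : IsCompact (closure (Set.range X)) := by
    refine BoundedContinuousFunction.arzela_ascoli (Metric.closedBall 0 R)
      (isCompact_closedBall _ _) _ ?_ ?_
    · rintro f t ⟨n, rfl⟩
      rw [hXa, mem_closedBall_zero_iff]
      exact hsup n t
    · intro s
      refine Metric.equicontinuousAt_of_continuity_modulus (fun t => Real.sqrt (M * Wm (s - t))) ?_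
        _ ?_
      · have : Continuous fun t => Real.sqrt (M * Wm (s - t)) := by
          have := Wm_continuous
          fun_prop
        have h2 := this.tendsto s
        simpa [Wm_zero] using h2
      · refine Filter.Eventually.of_forall ?_
        rintro t ⟨f, n, rfl⟩
        exact hmod n s t
  obtain ⟨x, -, φ, hφ, hlim⟩ := hcomp.tendsto_subseq (x := X) (fun n => subset_closure ⟨n, rfl⟩)
  have hpt : ∀ t, Filter.Tendsto (fun n => loop (c (φ n)) t) Filter.atTop (nhds (x t)) := by
    intro t
    have := BoundedContinuousFunction.tendsto_iff_tendstoUniformly.1 hlim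
    exact this.tendsto_at t
  have hg := h.cg
  have hH := h.cH
  obtain ⟨Mg, hMg⟩ := (isCompact_closedBall (0 : CZ ι) R).exists_bound_of_continuousOn
    hg.continuousOn
  obtain ⟨Ma, hMa⟩ := (isCompact_closedBall (0 : CZ ι) R).exists_bound_of_continuousOn
    (f := fun z => inner ℝ (g z) z / 2 - H z) (by fun_prop)
  refine ⟨x, x.continuous, ?_, ?_⟩
  · intro k
    have t1 : Filter.Tendsto (fun n => fourierCoeff (loop (c (φ n))) k) Filter.atTop
        (nhds (fourierCoeff x k)) := by
      unfold fourierCoeff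
      refine cir_dct _ _ (fun n => ?_) R (fun n t => ?_) (fun t => ?_)
      · have := loop_continuous (c (φ n))
        fun_prop
      · rw [norm_smul, fou_norm, one_mul]
        exact hsup _ t
      · exact (hpt t).const_smul _
    have t2 : Filter.Tendsto (fun n => fourierCoeff (fun t => g (loop (c (φ n)) t)) k) Filter.atTop
        (nhds (fourierCoeff (fun t => g (x t)) k)) := by
      unfold fourierCoeff
      refine cir_dct _ _ (fun n => ?_) Mg (fun n t => ?_) (fun t => ?_)
      · have := loop_continuous (c (φ n))
        fun_prop
      · rw [norm_smul, fou_norm, one_mul]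
        exact hMg _ (by rw [mem_closedBall_zero_iff]; exact hsup _ t)
      · exact ((hg.tendsto _).comp (hpt t)).const_smul _
    have t3 := (t1.const_smul (2 * Real.pi * (k : ℝ))).sub t2
    have t4 : Filter.Tendsto (fun n => (2 * Real.pi * (k : ℝ)) • fourierCoeff (loop (c (φ n))) k -
        fourierCoeff (fun t => g (loop (c (φ n)) t)) k) Filter.atTop (nhds 0) := by
      have t5 : Filter.Tendsto (fun n : ℕ => 1 / ((φ n : ℝ) + 1)) Filter.atTop (nhds 0) :=
        tendsto_one_div_add_atTop_nhds_zero_nat.comp hφ.tendsto_atTop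
      refine squeeze_zero_norm' ?_ t5
      filter_upwards [Filter.eventually_ge_atTop k.natAbs] with n hn
      have hn2 : k.natAbs ≤ φ n := hn.trans (hφ.id_le n)
      have hmem : k ∈ Finset.Icc (-((φ n + 1 : ℕ) : ℤ)) ((φ n + 1 : ℕ) : ℤ) := by
        rw [Finset.mem_Icc]
        lia
      have e1 := fourierCoeff_loop (c (φ n)) ⟨k, hmem⟩
      have e2 := norm_coord (GrN g (c (φ n))) ⟨k, hmem⟩
      simp only at e1
      rw [e1]
      exact e2.trans (hc2 (φ n)).le
    exact sub_eq_zero.1 (tendsto_nhds_unique t3 t4)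
  · have t1 : Filter.Tendsto (fun n => ∫ t, (inner ℝ (g (loop (c (φ n)) t)) (loop (c (φ n)) t) / 2
        - H (loop (c (φ n)) t)) ∂haarAddCircle) Filter.atTop
        (nhds (∫ t, (inner ℝ (g (x t)) (x t) / 2 - H (x t)) ∂haarAddCircle)) := by
      refine cir_dct _ _ (fun n => ?_) Ma (fun n t => ?_) (fun t => ?_)
      · have := loop_continuous (c (φ n))
        fun_prop
      · exact hMa _ (by rw [mem_closedBall_zero_iff]; exact hsup _ t)
      · have : Continuous fun z => inner ℝ (g z) z / 2 - H z := by fun_prop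
        exact (this.tendsto _).comp (hpt t)
    have t5 : Filter.Tendsto (fun n : ℕ => 1 / ((φ n : ℝ) + 1)) Filter.atTop (nhds 0) :=
        tendsto_one_div_add_atTop_nhds_zero_nat.comp hφ.tendsto_atTop
    have t6 := t1.add (t5.mul_const (D1 / 2))
    have t7 : β ≤ ∫ t, (inner ℝ (g (x t)) (x t) / 2 - H (x t)) ∂haarAddCircle + 0 * (D1 / 2) := by
      refine ge_of_tendsto t6 (Filter.Eventually.of_forall fun n => ?_)
      have e1 := hc1 (φ n)
      rw [psi_action hH hg] at e1
      have e2 := real_inner_le_norm (GrN g (c (φ n))) (c (φ n))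
      have e3 : ‖GrN g (c (φ n))‖ * ‖c (φ n)‖ ≤ 1 / ((φ n : ℝ) + 1) * D1 := by
        have := (hc2 (φ n)).le
        have := hb1 (φ n)
        gcongr
      linarith
    linarith

theorem reg_scalar (x u : Cir → ℂ) (hx : Continuous x) (hu : Continuous u)
    (hk : ∀ k : ℤ, (2 * Real.pi * (k : ℂ)) * fourierCoeff x k = fourierCoeff u k) (t : ℝ) :
    HasDerivAt (fun s : ℝ => x s) (Complex.I * u t) t := by
  have hc : Continuous fun s : ℝ => Complex.I * u s := by
    have := AddCircle.continuous_mk' (1 : ℝ)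
    exact continuous_const.mul (hu.comp this)
  have hper : Function.Periodic (fun s : ℝ => Complex.I * u s) 1 := by
    intro s
    simp
  let y : ℝ → ℂ := fun t => x 0 + ∫ s in (0 : ℝ)..t, Complex.I * u s
  have hy : ∀ t : ℝ, HasDerivAt y (Complex.I * u t) t := fun t =>
    (intervalIntegral.integral_hasDerivAt_right (hc.intervalIntegrable _ _)
      hc.aestronglyMeasurable.stronglyMeasurableAtFilter hc.continuousAt).const_add _
  have hyc : Continuous y := continuous_iff_continuousAt.2 fun t => (hy t).continuousAt
  have hu0 : ∫ s in (0 : ℝ)..(0 + 1), Complex.I * u s = 0 := by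
    have h1 := hk 0
    rw [fourierCoeff_eq_intervalIntegral u 0 0] at h1
    simp only [Int.cast_zero, mul_zero, zero_mul, neg_zero, fourier_zero, one_smul, div_one] at h1
    rw [intervalIntegral.integral_const_mul, ← h1, mul_zero]
  have hyper : Function.Periodic y 1 := by
    intro t
    simp only [y]
    rw [← intervalIntegral.integral_add_adjacent_intervals (b := t) (hc.intervalIntegrable _ _)
      (hc.intervalIntegrable _ _), hper.intervalIntegral_add_eq t 0, hu0, add_zero]
  let Y : Cir → ℂ := hyper.lift
  have hYc : Continuous Y := by
    exact continuous_coinduced_dom.2 hyc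
  have hYa : ∀ s : ℝ, Y s = y s := fun s => rfl
  have hYk : ∀ k : ℤ, k ≠ 0 → fourierCoeff Y k = fourierCoeff x k := by
    intro k hk0
    have e1 := fourierCoeffOn_of_hasDerivAt (zero_lt_one (α := ℝ)) hk0 (fun s _ => hy s)
      (hc.intervalIntegrable _ _)
    have e2 : fourierCoeff Y k = fourierCoeffOn (zero_lt_one (α := ℝ)) y k := by
      rw [fourierCoeff_eq_intervalIntegral Y k 0, fourierCoeffOn_eq_integral]
      simp [hYa]
    have e3 : fourierCoeffOn (zero_lt_one (α := ℝ)) (fun s : ℝ => Complex.I * u s) k =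
        Complex.I * fourierCoeff u k := by
      rw [fourierCoeff_eq_intervalIntegral u k 0, fourierCoeffOn_eq_integral]
      simp only [sub_zero, zero_add, div_one, one_smul, smul_eq_mul]
      rw [← intervalIntegral.integral_const_mul]
      congr 1
      ext s
      rw [fourier_coe_apply, fourier_coe_apply, sub_zero]
      ring
    have e4 : y 1 - y 0 = 0 := by
      have := hyper 0
      rw [zero_add] at this
      rw [this, sub_self]
    rw [e2, e1, e4, e3, ← hk k]
    have hpi : (Real.pi : ℂ) ≠ 0 := by exact_mod_cast Real.pi_ne_zero
    have hkc : (k : ℂ) ≠ 0 := by exact_mod_cast hk0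
    have hI := Complex.I_ne_zero
    push_cast
    field_simp
    ring
  let D : C(Cir, ℂ) := ⟨fun t => x t - Y t, hx.sub hYc⟩
  have hDk : ∀ k : ℤ, k ≠ 0 → fourierCoeff D k = 0 := by
    intro k hk0
    have : fourierCoeff D k = fourierCoeff x k - fourierCoeff Y k := by
      unfold fourierCoeff
      simp only [D, ContinuousMap.coe_mk, smul_sub]
      exact integral_sub (cir_integrable (by fun_prop)) (cir_integrable (by fun_prop))
    rw [this, hYk k hk0, sub_self]
  have hsum : Summable (fourierCoeff D) :=
    summable_of_ne_finset_zero (s := {0}) fun k hk => hDk k (by simpa using hk)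
  have hval : ∀ t, D t = fourierCoeff D 0 := by
    intro t
    have h1 := has_pointwise_sum_fourier_series_of_summable hsum t
    have h2 := hasSum_single (f := fun i => fourierCoeff D i • fourier i t) 0 (fun k hk => by
      simp [hDk k hk])
    rw [h1.unique h2]
    simp
  have hxy : ∀ s : ℝ, x s = y s := by
    intro s
    have h1 := (hval s).trans (hval 0).symm
    have h2 : Y 0 = y 0 := hYa 0
    simp only [D, ContinuousMap.coe_mk, hYa, h2] at h1
    have h3 : y 0 = x 0 := by simp [y]
    rw [h3, sub_self] at h1
    exact sub_eq_zero.1 h1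
  have : (fun s : ℝ => x s) = y := funext hxy
  rw [this]
  exact hy t

theorem fourierCoeff_coord {ι : Type} [Fintype ι] (x : Cir → CZ ι) (hx : Continuous x) (k : ℤ)
    (i : ι) : fourierCoeff x k i = fourierCoeff (fun t => x t i) k := by
  unfold fourierCoeff
  have := (EuclideanSpace.proj (𝕜 := ℂ) i : CZ ι →L[ℂ] ℂ).integral_comp_comm
    (cir_integrable (f := fun t : Cir => fourier (-k) t • x t) (by fun_prop))
  simpa using this.symm

theorem cz_hasDerivAt {ι : Type} [Fintype ι] (x : ℝ → CZ ι) (v : CZ ι) (t : ℝ)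
    (h : ∀ i, HasDerivAt (fun s => x s i) (v i) t) : HasDerivAt x v t := by
  have h2 : HasDerivAt (fun s : ℝ => WithLp.ofLp (x s)) (WithLp.ofLp v) t := hasDerivAt_pi.2 h
  exact ((PiLp.continuousLinearEquiv 2 ℝ (fun _ : ι => ℂ)).symm :
    (ι → ℂ) →L[ℝ] CZ ι).hasFDerivAt.comp_hasDerivAt t h2

/-- Abstract existence theorem. -/
theorem hz_abstract {ι : Type} [Fintype ι] [DecidableEq ι] {H : CZ ι → ℝ} {g : CZ ι → CZ ι}
    {q : ι → ℝ} {i0 : ι} {p : CZ ι} {L B C C4 κ : ℝ} (h : HZHyp H g q i0 p L B C C4 κ) :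
    ∃ x : ℝ → CZ ι, (∀ t, x (t + 1) = x t) ∧ (∀ t, HasDerivAt x (Complex.I • g (x t)) t) ∧
      ∃ t, 0 < inner ℝ (g (x t)) (x t) / 2 - H (x t) := by
  obtain ⟨x, hx, hk, hpos⟩ := hz_limit h
  refine ⟨fun t => x t, fun t => by simp, fun t => ?_, ?_⟩
  · have hgx : Continuous fun t => g (x t) := h.cg.comp hx
    refine cz_hasDerivAt _ _ t fun i => ?_
    have hxi : Continuous fun t => x t i := by fun_prop
    have hgi : Continuous fun t => g (x t) i := (PiLp.continuous_apply 2 _ i).comp hgx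
    have hki : ∀ k : ℤ, (2 * Real.pi * (k : ℂ)) * fourierCoeff (fun t => x t i) k =
        fourierCoeff (fun t => g (x t) i) k := by
      intro k
      rw [← fourierCoeff_coord x hx k i, ← fourierCoeff_coord _ hgx k i, ← hk k]
      simp
    exact reg_scalar (fun t => x t i) (fun t => g (x t) i) hxi hgi hki t
  · by_contra hcon
    push Not at hcon
    have : ∫ t, (inner ℝ (g (x t)) (x t) / 2 - H (x t)) ∂haarAddCircle ≤ 0 := by
      refine integral_nonpos fun t => ?_
      induction t using QuotientAddGroup.induction_on with
      | H s => exact hcon s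
    linarith

end Part7

section Part8
/-- clamp -/
def clampS (σ u : ℝ) : ℝ := max 0 (min 1 (u / σ))
/-- convex cutoff -/
def zetaS (σ u : ℝ) : ℝ := clampS σ u * u - σ * clampS σ u ^ 2 / 2

theorem clampS_nonneg (σ u : ℝ) : 0 ≤ clampS σ u := le_max_left _ _
theorem clampS_le (σ u : ℝ) : clampS σ u ≤ 1 := max_le zero_le_one (min_le_left _ _)
theorem clampS_cont (σ : ℝ) : Continuous (clampS σ) := by unfold clampS; fun_prop
theorem clampS_neg {σ u : ℝ} (hσ : 0 < σ) (hu : u ≤ 0) : clampS σ u = 0 := by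
  unfold clampS
  rw [max_eq_left]
  exact (min_le_right _ _).trans (div_nonpos_of_nonpos_of_nonneg hu hσ.le)
theorem clampS_big {σ u : ℝ} (hσ : 0 < σ) (hu : σ ≤ u) : clampS σ u = 1 := by
  unfold clampS
  rw [min_eq_left, max_eq_right zero_le_one]
  rwa [le_div_iff₀ hσ, one_mul]

theorem zetaS_opt {σ : ℝ} (hσ : 0 < σ) (u s : ℝ) (h0 : 0 ≤ s) (h1 : s ≤ 1) :
    s * u - σ * s ^ 2 / 2 ≤ zetaS σ u := by
  unfold zetaS
  rcases le_total u 0 with hu | hu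
  · rw [clampS_neg hσ hu]
    nlinarith [sq_nonneg s, mul_nonneg h0 (neg_nonneg.2 hu)]
  · rcases le_total σ u with h | h
    · rw [clampS_big hσ h]
      nlinarith [mul_nonneg (sub_nonneg.2 h1) (sub_nonneg.2 h), mul_nonneg (sub_nonneg.2 h1) (sub_nonneg.2 h1)]
    · have : clampS σ u = u / σ := by
        unfold clampS
        rw [min_eq_right, max_eq_right (by positivity)]
        rwa [div_le_one hσ]
      rw [this]
      have e : u / σ * u - σ * (u / σ) ^ 2 / 2 - (s * u - σ * s ^ 2 / 2) = (u - σ * s) ^ 2 / (2 * σ) := by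
        field_simp
        ring
      have : 0 ≤ (u - σ * s) ^ 2 / (2 * σ) := by positivity
      linarith

theorem zetaS_conv {σ : ℝ} (hσ : 0 < σ) (u w : ℝ) :
    zetaS σ u + clampS σ u * (w - u) ≤ zetaS σ w := by
  have := zetaS_opt hσ w (clampS σ u) (clampS_nonneg _ _) (clampS_le _ _)
  unfold zetaS at *
  linarith

theorem zetaS_nonneg {σ : ℝ} (hσ : 0 < σ) (u : ℝ) : 0 ≤ zetaS σ u := by
  have := zetaS_opt hσ u 0 le_rfl zero_le_one
  simpa using this

theorem zetaS_low {σ : ℝ} (hσ : 0 < σ) (u : ℝ) : u - σ / 2 ≤ zetaS σ u := by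
  have := zetaS_opt hσ u 1 zero_le_one le_rfl
  simpa using this

theorem zetaS_neg {σ u : ℝ} (hσ : 0 < σ) (hu : u ≤ 0) : zetaS σ u = 0 := by
  unfold zetaS
  rw [clampS_neg hσ hu]; simp

theorem zetaS_up {σ u : ℝ} (hσ : 0 < σ) (w : ℝ) (hw : 0 ≤ w) (h : u ≤ w) : zetaS σ u ≤ w := by
  unfold zetaS
  have h1 := clampS_nonneg σ u
  have h2 := clampS_le σ u
  nlinarith [mul_nonneg hσ.le (sq_nonneg (clampS σ u)), mul_le_mul_of_nonneg_left h h1]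

theorem zetaS_deriv {σ : ℝ} (hσ : 0 < σ) (u : ℝ) : HasDerivAt (zetaS σ) (clampS σ u) u := by
  rw [hasDerivAt_iff_isLittleO]
  have h1 : (fun w => clampS σ w - clampS σ u) =o[nhds u] fun _ => (1 : ℝ) := by
    rw [Asymptotics.isLittleO_one_iff]
    have := (clampS_cont σ).tendsto u
    simpa using this.sub_const (clampS σ u)
  have h2 : (fun w => (clampS σ w - clampS σ u) * (w - u)) =o[nhds u] fun w => 1 * (w - u) :=
    h1.mul_isBigO (Asymptotics.isBigO_refl _ _)
  simp only [one_mul] at h2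
  refine Asymptotics.IsBigO.trans_isLittleO ?_ h2
  refine Asymptotics.IsBigO.of_bound 1 (Filter.Eventually.of_forall fun w => ?_)
  have e1 := zetaS_conv hσ u w
  have e2 := zetaS_conv hσ w u
  rw [one_mul, Real.norm_eq_abs, Real.norm_eq_abs, smul_eq_mul, abs_of_nonneg (by linarith)]
  refine le_trans ?_ (le_abs_self _)
  linarith

/-- gradient -/
def gr {ι : Type} [Fintype ι] (H : CZ ι → ℝ) (z : CZ ι) : CZ ι :=
  (InnerProductSpace.toDual ℝ (CZ ι)).symm (fderiv ℝ H z)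

theorem inner_gr {ι : Type} [Fintype ι] (H : CZ ι → ℝ) (z v : CZ ι) :
    inner ℝ (gr H z) v = fderiv ℝ H z v := InnerProductSpace.toDual_symm_apply

theorem Qd_symm {ι : Type} [Fintype ι] (q : ι → ℝ) (z v : CZ ι) :
    inner ℝ (Qd q z) v = inner ℝ z (Qd q v) := by
  rw [PiLp.inner_apply, PiLp.inner_apply]
  refine Finset.sum_congr rfl fun i _ => ?_
  rw [Qd_apply, Qd_apply, ← Complex.real_smul, ← Complex.real_smul, real_inner_smul_left,
    real_inner_smul_right]

theorem Qd_add {ι : Type} [Fintype ι] (q : ι → ℝ) (z v : CZ ι) :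
    Qd q (z + v) = Qd q z + Qd q v := by
  ext i
  simp [Qd, mul_add]

/-- linear version of the weights -/
def QdL {ι : Type} [Fintype ι] (q : ι → ℝ) : CZ ι →L[ℝ] CZ ι :=
  LinearMap.toContinuousLinearMap
    { toFun := Qd q
      map_add' := Qd_add q
      map_smul' := by
        intro r z
        ext i
        simp [Qd]
        ring }

theorem QdL_apply {ι : Type} [Fintype ι] (q : ι → ℝ) (z : CZ ι) : QdL q z = Qd q z := rfl

theorem inner_I_self {ι : Type} [Fintype ι] (z : CZ ι) : inner ℝ z (Complex.I • z) = 0 := by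
  have h := cz_inner_smul Complex.I z z
  rw [real_inner_comm, Complex.conj_I, neg_smul, inner_neg_right] at h
  linarith

theorem quad_of_lip {E : Type*} [NormedAddCommGroup E] [NormedSpace ℝ E] {H : E → ℝ}
    (hH : Differentiable ℝ H) (K : NNReal) (hK : LipschitzWith K (fderiv ℝ H)) (z v : E) :
    H z + fderiv ℝ H z v - K * ‖v‖ ^ 2 ≤ H (z + v) := by
  have hd : ∀ t : ℝ, HasDerivAt (fun s : ℝ => H (z + s • v)) (fderiv ℝ H (z + t • v) v) t := by
    intro t
    have h1 : HasDerivAt (fun s : ℝ => z + s • v) v t := by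
      simpa using ((hasDerivAt_id t).smul_const v).const_add z
    exact (hH (z + t • v)).hasFDerivAt.comp_hasDerivAt t h1
  obtain ⟨t, ht, hs⟩ := exists_hasDerivAt_eq_slope (fun s : ℝ => H (z + s • v)) _ zero_lt_one
    (fun t _ => (hd t).continuousAt.continuousWithinAt) (fun t _ => hd t)
  simp only [one_smul, zero_smul, add_zero, sub_zero, div_one] at hs
  have h2 := hK.dist_le_mul (z + t • v) z
  rw [dist_eq_norm, dist_eq_norm, add_sub_cancel_left, norm_smul] at h2
  have h3 : ‖t‖ ≤ 1 := by rw [Real.norm_of_nonneg ht.1.le]; exact ht.2.le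
  have h4 := (fderiv ℝ H (z + t • v) - fderiv ℝ H z).le_opNorm v
  rw [ContinuousLinearMap.sub_apply, Real.norm_eq_abs] at h4
  have h5 : ‖fderiv ℝ H (z + t • v) - fderiv ℝ H z‖ ≤ K * ‖v‖ := by
    refine h2.trans ?_
    have : ‖t‖ * ‖v‖ ≤ 1 * ‖v‖ := by gcongr
    rw [one_mul] at this
    exact mul_le_mul_of_nonneg_left this K.2
  have h6 := mul_le_mul_of_nonneg_right h5 (norm_nonneg v)
  have h7 := neg_abs_le (fderiv ℝ H (z + t • v) v - fderiv ℝ H z v)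
  nlinarith

end Part8

section Part9
theorem kap_aux {r : ℝ} (hr0 : 0 < r) (hr1 : r < 2 * Real.pi) (k : ℤ) :
    min r (2 * Real.pi - r) ≤ |2 * Real.pi * k - r| := by
  have hpi := Real.pi_pos
  rcases le_or_gt k 0 with hk | hk
  · have : (k : ℝ) ≤ 0 := by exact_mod_cast hk
    refine (min_le_left _ _).trans (le_trans ?_ (neg_le_abs _))
    nlinarith
  · have : (1 : ℝ) ≤ k := by exact_mod_cast hk
    refine (min_le_right _ _).trans (le_trans ?_ (le_abs_self _))
    nlinarith

theorem crit_max {E : Type*} [NormedAddCommGroup E] [NormedSpace ℝ E] {H : E → ℝ} {m : ℝ}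
    (hm : ∀ z, H z ≤ m) (z : E) (hz : H z = m) : fderiv ℝ H z = 0 := by
  have : IsLocalMax H z := Filter.Eventually.of_forall fun w => by
    simpa [hz] using hm w
  exact this.fderiv_eq_zero

set_option maxHeartbeats 1000000 in
theorem hz_euclid {ι : Type} [Fintype ι] [DecidableEq ι] {H : CZ ι → ℝ} (hH : ContDiff ℝ 2 H)
    {m : ℝ} (h0 : ∀ z, 0 ≤ H z) (hm : ∀ z, H z ≤ m) (p : CZ ι) (r : ℝ) (hr : 0 < r)
    (hp : ∀ z, ‖z - p‖ < r → H z = 0) {Cs : Set (CZ ι)} (hCs : IsCompact Cs)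
    (hout : ∀ z, z ∉ Cs → H z = m) (i0 : ι) {A0 : ℝ} (hA0 : 0 < A0) (hA0m : A0 < m)
    (hCA : ∀ z ∈ Cs, Real.pi * ‖z i0‖ ^ 2 ≤ A0) :
    ∃ x : ℝ → CZ ι, (∀ t, x (t + 1) = x t) ∧ (∀ t, HasDerivAt x (Complex.I • gr H (x t)) t) ∧
      (∀ t, H (x t) < m) ∧ ∃ t, gr H (x t) ≠ 0 := by
  have hpi := Real.pi_pos
  have hHd : Differentiable ℝ H := hH.differentiable (by norm_num)
  have hH1 : ContDiff ℝ 1 (fderiv ℝ H) := hH.fderiv_right (by norm_num)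
  have hfd0 : ∀ z, z ∉ Cs → fderiv ℝ H z = 0 := fun z hz => crit_max hm z (hout z hz)
  have hcs : HasCompactSupport (fderiv ℝ H) := HasCompactSupport.intro hCs hfd0
  obtain ⟨K, hK⟩ := hH1.lipschitzWith_of_hasCompactSupport hcs one_ne_zero
  obtain ⟨Bg, hBg⟩ := hcs.exists_bound_of_continuous hH1.continuous
  obtain ⟨ρ, hρ⟩ := hCs.isBounded.exists_norm_le
  have hgn : ∀ z, ‖gr H z‖ ≤ Bg := by
    intro z
    unfold gr
    rw [LinearIsometryEquiv.norm_map]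
    exact hBg z
  have hgc : Continuous (gr H) :=
    (InnerProductSpace.toDual ℝ (CZ ι)).symm.continuous.comp hH1.continuous
  -- parameters
  have hm0 : 0 < m := hA0.trans hA0m
  set A' := (A0 + m) / 2 with hA'
  have hA'1 : A0 < A' := by rw [hA']; linarith
  have hA'2 : A' < m := by rw [hA']; linarith
  have hA'0 : 0 < A' := hA0.trans hA'1
  set a := (A' + m) / 2 with ha
  have ha1 : A' < a := by rw [ha]; linarith
  have ha2 : a < m := by rw [ha]; linarith
  have ha0 : 0 < a := hA'0.trans ha1
  have ha3 : a < 2 * A' := by rw [hA']; linarith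
  set σ := 2 * (m - a) with hσd
  have hσ : 0 < σ := by rw [hσd]; linarith
  set q0 := 2 * Real.pi * (a / A') with hq0
  have hq01 : 2 * Real.pi < q0 := by
    have : 1 < a / A' := by rw [one_lt_div hA'0]; exact ha1
    rw [hq0]; nlinarith
  have hq02 : q0 < 4 * Real.pi := by
    have : a / A' < 2 := by rw [div_lt_iff₀ hA'0]; exact ha3
    rw [hq0]; nlinarith
  set gap := a - (a / A') * A0 with hgap
  have hgap0 : 0 < gap := by
    have : a / A' * A0 < a := by
      rw [div_mul_eq_mul_div, div_lt_iff₀ hA'0]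
      nlinarith
    rw [hgap]; linarith
  set ε := min Real.pi (gap / (ρ ^ 2 + 1)) with hε
  have hε0 : 0 < ε := lt_min hpi (by positivity)
  have hε1 : ε < 2 * Real.pi := (min_le_left _ _).trans_lt (by linarith)
  have hε2 : ε * ρ ^ 2 ≤ gap := by
    have : ε ≤ gap / (ρ ^ 2 + 1) := min_le_right _ _
    rw [le_div_iff₀ (by positivity)] at this
    nlinarith
  let q : ι → ℝ := fun i => if i = i0 then q0 else ε
  have hqi0 : q i0 = q0 := by simp [q]
  have hqi : ∀ i, i ≠ i0 → q i = ε := fun i hi => by simp [q, hi]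
  have hqpos : ∀ i, 0 < q i := by
    intro i
    by_cases hi : i = i0
    · rw [hi, hqi0]; linarith
    · rw [hqi i hi]; exact hε0
  have hq4 : ∀ i, q i ≤ 4 * Real.pi := by
    intro i
    by_cases hi : i = i0
    · rw [hi, hqi0]; linarith
    · rw [hqi i hi]; linarith
  set κ := min (min (ε / 2) (2 * Real.pi - ε)) (min (q0 / 2 - Real.pi) (4 * Real.pi - q0)) with hκd
  have hk1 : κ ≤ ε / 2 := (min_le_left _ _).trans (min_le_left _ _)
  have hk2 : κ ≤ 2 * Real.pi - ε := (min_le_left _ _).trans (min_le_right _ _)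
  have hk3 : κ ≤ q0 / 2 - Real.pi := (min_le_right _ _).trans (min_le_left _ _)
  have hk4 : κ ≤ 4 * Real.pi - q0 := (min_le_right _ _).trans (min_le_right _ _)
  have hκ : 0 < κ := by
    refine lt_min (lt_min ?_ ?_) (lt_min ?_ ?_) <;> linarith
  let h : CZ ι → ℝ := fun z => (∑ i, q i * ‖z i‖ ^ 2) / 2
  have hhQ : ∀ z, h z = inner ℝ (Qd q z) z / 2 := fun z => by rw [Qd_inner]
  have hhc : Continuous h := by
    simp only [h]; fun_prop
  have hh0 : ∀ z, 0 ≤ h z := fun z => by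
    have : 0 ≤ ∑ i, q i * ‖z i‖ ^ 2 := Finset.sum_nonneg fun i _ => by
      have := hqpos i; positivity
    simp only [h]; positivity
  have hhadd : ∀ z v, h z + inner ℝ (Qd q z) v ≤ h (z + v) := by
    intro z v
    have e : h (z + v) = h z + inner ℝ (Qd q z) v + h v := by
      rw [hhQ, hhQ, hhQ, Qd_add, inner_add_left, inner_add_right, inner_add_right,
        Qd_symm q v z, real_inner_comm v (Qd q z)]
      rw [real_inner_comm]
      ring
    have := hh0 v
    linarith
  have hhup : ∀ z, h z ≤ 2 * Real.pi * ‖z‖ ^ 2 := by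
    intro z
    have : ∑ i, q i * ‖z i‖ ^ 2 ≤ 4 * Real.pi * ‖z‖ ^ 2 := by
      rw [EuclideanSpace.norm_sq_eq, Finset.mul_sum]
      refine Finset.sum_le_sum fun i _ => ?_
      exact mul_le_mul_of_nonneg_right (hq4 i) (by positivity)
    simp only [h]; linarith
  have hhlow : ∀ z, κ * ‖z‖ ^ 2 ≤ h z := by
    intro z
    have : 2 * κ * ‖z‖ ^ 2 ≤ ∑ i, q i * ‖z i‖ ^ 2 := by
      rw [EuclideanSpace.norm_sq_eq, Finset.mul_sum]
      refine Finset.sum_le_sum fun i _ => mul_le_mul_of_nonneg_right ?_ (by positivity)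
      by_cases hi : i = i0
      · rw [hi, hqi0]; linarith
      · rw [hqi i hi]; linarith
    simp only [h]; linarith
  have hhCs : ∀ z ∈ Cs, h z < a := by
    intro z hz
    have h1 : ∑ i, q i * ‖z i‖ ^ 2 ≤ q0 * ‖z i0‖ ^ 2 + ε * ‖z‖ ^ 2 := by
      rw [EuclideanSpace.norm_sq_eq, Finset.mul_sum, ← Finset.add_sum_erase _ _ (Finset.mem_univ i0),
        ← Finset.add_sum_erase _ (fun i => ε * ‖z i‖ ^ 2) (Finset.mem_univ i0), hqi0]
      have : ∑ i ∈ Finset.univ.erase i0, q i * ‖z i‖ ^ 2 =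
          ∑ i ∈ Finset.univ.erase i0, ε * ‖z i‖ ^ 2 := by
        refine Finset.sum_congr rfl fun i hi => ?_
        rw [hqi i (Finset.ne_of_mem_erase hi)]
      rw [this]
      have : 0 ≤ ε * ‖z i0‖ ^ 2 := by positivity
      linarith
    have h2 := hCA z hz
    have h3 : ε * ‖z‖ ^ 2 ≤ gap := by
      have := hρ z hz
      have : ‖z‖ ^ 2 ≤ ρ ^ 2 := by gcongr
      nlinarith
    have h4 : q0 * ‖z i0‖ ^ 2 ≤ 2 * ((a / A') * A0) := by
      have : 0 < a / A' := by positivity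
      rw [hq0]
      nlinarith [mul_le_mul_of_nonneg_left h2 this.le]
    simp only [h]
    rw [hgap] at h3 hgap0
    linarith
  have hpC : p ∈ Cs := by
    by_contra hcon
    have h1 := hout p hcon
    rw [hp p (by simpa using hr)] at h1
    linarith
  -- modified Hamiltonian
  let Hb : CZ ι → ℝ := fun z => H z + zetaS σ (h z - a)
  let g : CZ ι → CZ ι := fun z => gr H z + clampS σ (h z - a) • Qd q z
  have hcl := clampS_cont σ
  have hQc := Qd_continuous q
  have hzc : Continuous (zetaS σ) := continuous_iff_continuousAt.2 fun u =>
    (zetaS_deriv hσ u).continuousAt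
  obtain ⟨r', hr', hr'h⟩ : ∃ r' > 0, ∀ z, ‖z‖ < r' → Hb (p + z) = 0 := by
    have h1 : ∀ᶠ z in nhds (0 : CZ ι), h (p + z) < a := by
      have : Continuous fun z => h (p + z) := by fun_prop
      refine this.continuousAt.eventually_lt continuousAt_const ?_
      simpa using hhCs p hpC
    obtain ⟨r1, hr1, hr2⟩ := Metric.eventually_nhds_iff.1 h1
    refine ⟨min r r1, lt_min hr hr1, fun z hz => ?_⟩
    have e1 := hp (p + z) (by simpa using hz.trans_le (min_le_left _ _))
    have e2 := hr2 (y := z) (by simpa using hz.trans_le (min_le_right _ _))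
    simp only [Hb]
    rw [e1, zetaS_neg hσ (by linarith), add_zero]
  have hyp : HZHyp Hb g q i0 p (2 * K + 1) (Bg + 4 * Real.pi * Real.sqrt ((a + σ) / κ)) (a + σ / 2)
      ((m + 4 * Real.pi * ‖p‖ ^ 2) / r' ^ 4 + 4 * Real.pi / r' ^ 2) κ := by
    constructor
    · have := hH.continuous
      simp only [Hb]
      fun_prop
    · simp only [g]
      fun_prop
    · positivity
    · intro z v
      have e1 := quad_of_lip hHd K hK z v
      have e2 := zetaS_conv hσ (h z - a) (h (z + v) - a)
      have e3 := mul_le_mul_of_nonneg_left (hhadd z v) (clampS_nonneg σ (h z - a))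
      simp only [Hb, g]
      rw [inner_add_left, inner_gr, real_inner_smul_left]
      have : 0 ≤ ‖v‖ ^ 2 := by positivity
      nlinarith
    · intro z
      exact add_nonneg (h0 z) (zetaS_nonneg hσ _)
    · intro z
      have e : g z - Qd q z = gr H z + (clampS σ (h z - a) - 1) • Qd q z := by
        simp only [g]
        rw [sub_smul, one_smul]; abel
      rw [e]
      refine (norm_add_le _ _).trans (add_le_add (hgn z) ?_)
      rcases le_total σ (h z - a) with hs | hs
      · rw [clampS_big hσ hs]
        simp
        positivity
      · have h1 : ‖z‖ ≤ Real.sqrt ((a + σ) / κ) := by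
          refine Real.le_sqrt_of_sq_le ?_
          rw [le_div_iff₀ hκ]
          have := hhlow z
          linarith
        have h2 : ‖Qd q z‖ ≤ 4 * Real.pi * ‖z‖ := by
          rw [← sq_le_sq₀ (norm_nonneg _) (by positivity), mul_pow, EuclideanSpace.norm_sq_eq,
            EuclideanSpace.norm_sq_eq, Finset.mul_sum]
          refine Finset.sum_le_sum fun i _ => ?_
          rw [Qd_apply, norm_mul, mul_pow, Complex.norm_real, Real.norm_of_nonneg (hqpos i).le]
          have := hq4 i
          have := (hqpos i).le
          gcongr
        rw [norm_smul]
        have h3 : ‖clampS σ (h z - a) - 1‖ ≤ 1 := by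
          rw [Real.norm_eq_abs, abs_le]
          constructor <;> linarith [clampS_nonneg σ (h z - a), clampS_le σ (h z - a)]
        calc _ ≤ 1 * ‖Qd q z‖ := by gcongr
          _ ≤ 4 * Real.pi * ‖z‖ := by rw [one_mul]; exact h2
          _ ≤ _ := by gcongr
    · intro z
      have e1 := zetaS_low hσ (h z - a)
      have e2 := h0 z
      have : h z - (a + σ / 2) ≤ Hb z := by
        simp only [Hb]; linarith
      exact this
    · positivity
    · intro z
      rcases lt_or_ge ‖z‖ r' with hz | hz
      · rw [hr'h z hz]
        positivity
      · have e1 : Hb (p + z) ≤ m + 2 * Real.pi * ‖p + z‖ ^ 2 := by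
          have := zetaS_up hσ (u := h (p + z) - a) (h (p + z)) (hh0 _) (by linarith)
          have := hm (p + z)
          have := hhup (p + z)
          simp only [Hb]; linarith
        have e2 : ‖p + z‖ ^ 2 ≤ 2 * ‖p‖ ^ 2 + 2 * ‖z‖ ^ 2 := by
          have : ‖p + z‖ ^ 2 ≤ (‖p‖ + ‖z‖) ^ 2 := by
            gcongr
            exact norm_add_le p z
          nlinarith [sq_nonneg (‖p‖ - ‖z‖)]
        have e3 : (m + 4 * Real.pi * ‖p‖ ^ 2) ≤ (m + 4 * Real.pi * ‖p‖ ^ 2) / r' ^ 4 * ‖z‖ ^ 4 := by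
          rw [div_mul_eq_mul_div, le_div_iff₀ (by positivity)]
          gcongr
        have e4 : 4 * Real.pi * ‖z‖ ^ 2 ≤ 4 * Real.pi / r' ^ 2 * ‖z‖ ^ 4 := by
          rw [div_mul_eq_mul_div, le_div_iff₀ (by positivity)]
          have : r' ^ 2 ≤ ‖z‖ ^ 2 := by gcongr
          have h5 : 4 * Real.pi * ‖z‖ ^ 2 * r' ^ 2 ≤ 4 * Real.pi * ‖z‖ ^ 2 * ‖z‖ ^ 2 := by gcongr
          nlinarith
        nlinarith
    · positivity
    · exact hκ
    · intro i
      by_cases hi : i = i0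
      · rw [hi, hqi0]; linarith
      · rw [hqi i hi]; linarith
    · rw [hqi0]; exact hk3
    · intro k i
      by_cases hi : i = i0
      · rw [hi, hqi0]
        have := kap_aux (r := q0 - 2 * Real.pi) (by linarith) (by linarith) (k - 1)
        push_cast at this
        have e : 2 * Real.pi * ((k : ℝ) - 1) - (q0 - 2 * Real.pi) = 2 * Real.pi * k - q0 := by ring
        rw [e] at this
        exact (le_min (by linarith) (by linarith)).trans this
      · rw [hqi i hi]
        exact (le_min (by linarith) (by linarith)).trans (kap_aux hε0 hε1 k)
    · exact hq4
  obtain ⟨x, hx1, hx2, t0, ht0⟩ := hz_abstract hyp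
  -- energy
  have hE : ∀ t, HasDerivAt (fun s => Hb (x s)) 0 t := by
    intro t
    have e1 : HasDerivAt (fun s => H (x s)) (fderiv ℝ H (x t) (Complex.I • g (x t))) t :=
      (hHd (x t)).hasFDerivAt.comp_hasDerivAt t (hx2 t)
    have e2 : HasDerivAt (fun s => Qd q (x s)) (Qd q (Complex.I • g (x t))) t :=
      (QdL q).hasFDerivAt.comp_hasDerivAt t (hx2 t)
    have e3 : HasDerivAt (fun s => h (x s)) (inner ℝ (Qd q (x t)) (Complex.I • g (x t))) t := by
      have := (e2.inner ℝ (hx2 t)).div_const 2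
      have e : (inner ℝ (Qd q (x t)) (Complex.I • g (x t)) +
          inner ℝ (Qd q (Complex.I • g (x t))) (x t)) / 2 =
          inner ℝ (Qd q (x t)) (Complex.I • g (x t)) := by
        rw [Qd_symm q (Complex.I • g (x t)), real_inner_comm (Qd q (x t))]
        ring
      rw [e] at this
      simpa only [hhQ] using this
    have e4 := (zetaS_deriv hσ (h (x t) - a)).comp t (e3.sub_const a)
    have e5 := e1.add e4
    have e6 : fderiv ℝ H (x t) (Complex.I • g (x t)) + clampS σ (h (x t) - a) *
        inner ℝ (Qd q (x t)) (Complex.I • g (x t)) = 0 := by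
      rw [← inner_gr, ← real_inner_smul_left, ← inner_add_left]
      exact inner_I_self (g (x t))
    rw [e6] at e5
    exact e5
  have hEc : ∀ t, Hb (x t) = Hb (x t0) := fun t =>
    is_const_of_deriv_eq_zero (fun t => (hE t).differentiableAt) (fun t => (hE t).deriv) t t0
  have hlt0 : H (x t0) < m := by
    refine lt_of_le_of_ne (hm _) fun hcon => ?_
    have e1 : gr H (x t0) = 0 := by
      unfold gr
      rw [crit_max hm _ hcon]; simp
    simp only [g, Hb, e1, zero_add, real_inner_smul_left] at ht0
    rw [mul_div_assoc, ← hhQ, hcon] at ht0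
    unfold zetaS at ht0
    have c0 := clampS_nonneg σ (h (x t0) - a)
    have c1 := clampS_le σ (h (x t0) - a)
    set s := clampS σ (h (x t0) - a)
    have : s ^ 2 ≤ s := by nlinarith
    have : a + σ / 2 = m := by rw [hσd]; ring
    nlinarith
  have hin : ∀ z, H z < m → h z < a := fun z hz => hhCs z (by
    by_contra hcon
    exact hz.ne (hout z hcon))
  have hlt : ∀ t, H (x t) < m := by
    intro t
    have e1 := hEc t
    have e2 := zetaS_nonneg hσ (h (x t) - a)
    have e3 := zetaS_neg hσ (u := h (x t0) - a) (by linarith [hin _ hlt0])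
    simp only [Hb, e3] at e1
    linarith
  have hg : ∀ t, g (x t) = gr H (x t) := by
    intro t
    simp only [g]
    rw [clampS_neg hσ (by linarith [hin _ (hlt t)]), zero_smul, add_zero]
  refine ⟨x, hx1, fun t => ?_, hlt, t0, fun hcon => ?_⟩
  · rw [← hg t]; exact hx2 t
  · rw [hg t0, hcon, inner_zero_left] at ht0
    have : 0 ≤ Hb (x t0) := add_nonneg (h0 _) (zetaS_nonneg hσ _)
    linarith

end Part9

section Part10
theorem loc_inv {E F : Type*} [NormedAddCommGroup E] [NormedSpace ℝ E] [FiniteDimensional ℝ E]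
    [NormedAddCommGroup F] [NormedSpace ℝ F] [FiniteDimensional ℝ F]
    (hEF : Module.finrank ℝ E = Module.finrank ℝ F) {Φ : E → F} (hΦ : ContDiff ℝ 2 Φ) (y : E)
    (hinj : ∀ u, fderiv ℝ Φ y u = 0 → u = 0) :
    ∃ S : F → E, ContDiffAt ℝ 2 S (Φ y) ∧ S (Φ y) = y ∧ ∀ᶠ z in nhds (Φ y), Φ (S z) = z := by
  have : CompleteSpace E := FiniteDimensional.complete ℝ E
  have hi : Function.Injective (fderiv ℝ Φ y : E →ₗ[ℝ] F) := by
    rw [← LinearMap.ker_eq_bot, LinearMap.ker_eq_bot']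
    exact hinj
  let e : E ≃L[ℝ] F := (LinearMap.linearEquivOfInjective (fderiv ℝ Φ y : E →ₗ[ℝ] F) hi hEF).toContinuousLinearEquiv
  have he : (e : E →L[ℝ] F) = fderiv ℝ Φ y := by
    ext u
    rfl
  have hd : HasFDerivAt Φ (e : E →L[ℝ] F) y := by
    rw [he]
    exact (hΦ.differentiable (by norm_num) y).hasFDerivAt
  have hc : ContDiffAt ℝ 2 Φ y := hΦ.contDiffAt
  have hs := hc.hasStrictFDerivAt' hd (by norm_num)
  exact ⟨hc.localInverse hd (by norm_num), hc.to_localInverse hd (by norm_num),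
    hc.localInverse_apply_image hd (by norm_num), hs.eventually_right_inverse⟩

abbrev PhX (d : ℕ) := ((Fin d → ℝ) × (Fin d → ℝ)) × ℝ × ℝ

/-- logarithmic chart -/
def Lm {d : ℕ} (g : ℝ → ℝ) (R : ℝ × ℝ → ℝ) (y : PhX d) : CZ (Option (Fin d)) :=
  WithLp.toLp 2 fun o => o.elim
    (((1 / 2 * Real.log (R y.2 / Real.pi) : ℝ) : ℂ) + ((2 * Real.pi * g y.2.1 : ℝ) : ℂ) * Complex.I)
    (fun i => ((y.1.2 i : ℝ) : ℂ) + ((y.1.1 i : ℝ) : ℂ) * Complex.I)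

/-- exponential in the last coordinate -/
def EX {d : ℕ} (z : CZ (Option (Fin d))) : CZ (Option (Fin d)) :=
  WithLp.toLp 2 fun o => o.elim (Complex.exp (z none)) (fun i => z (some i))

theorem cz_contDiff {E : Type*} [NormedAddCommGroup E] [NormedSpace ℝ E] {ι : Type} [Fintype ι]
    {n : WithTop ℕ∞} (f : E → ι → ℂ) (hf : ∀ i, ContDiff ℝ n fun y => f y i) :
    ContDiff ℝ n fun y => (WithLp.toLp 2 (f y) : CZ ι) :=
  ((PiLp.continuousLinearEquiv 2 ℝ (fun _ : ι => ℂ)).symm :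
    (ι → ℂ) →L[ℝ] CZ ι).contDiff.comp (contDiff_pi.2 hf)

theorem cz_coord_contDiff {ι : Type} [Fintype ι] {n : WithTop ℕ∞} (i : ι) :
    ContDiff ℝ n fun z : CZ ι => z i :=
  ((EuclideanSpace.proj (𝕜 := ℂ) i : CZ ι →L[ℂ] ℂ).restrictScalars ℝ).contDiff

theorem Lm_contDiff {d : ℕ} {g : ℝ → ℝ} {R : ℝ × ℝ → ℝ} (hg : ContDiff ℝ 2 g) (hR : ContDiff ℝ 2 R)
    (hR0 : ∀ w, 0 < R w) : ContDiff ℝ 2 (Lm g R : PhX d → _) := by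
  refine cz_contDiff _ fun o => ?_
  have hof : ContDiff ℝ 2 (fun r : ℝ => (r : ℂ)) := Complex.ofRealCLM.contDiff
  cases o with
  | none =>
    simp only [Option.elim]
    refine ContDiff.add (hof.comp ?_) (ContDiff.mul (hof.comp ?_) contDiff_const)
    · refine contDiff_const.mul (ContDiff.log ?_ fun y => ?_)
      · exact (hR.comp contDiff_snd).div_const _
      · exact (div_pos (hR0 _) Real.pi_pos).ne'
    · exact contDiff_const.mul (hg.comp (contDiff_fst.comp contDiff_snd))
  | some i =>
    simp only [Option.elim]
    refine ContDiff.add (hof.comp ?_) (ContDiff.mul (hof.comp ?_) contDiff_const)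
    · fun_prop
    · fun_prop

theorem EX_contDiff {d : ℕ} : ContDiff ℝ 2 (EX : CZ (Option (Fin d)) → _) := by
  refine cz_contDiff _ fun o => ?_
  cases o with
  | none =>
    simp only [Option.elim]
    exact Complex.contDiff_exp.comp (cz_coord_contDiff none)
  | some i =>
    simp only [Option.elim]
    exact cz_coord_contDiff (some i)

theorem line_deriv {E F : Type*} [NormedAddCommGroup E] [NormedSpace ℝ E]
    [NormedAddCommGroup F] [NormedSpace ℝ F] {f : E → F} (hf : Differentiable ℝ f) (y u : E) :
    HasDerivAt (fun s : ℝ => f (y + s • u)) (fderiv ℝ f y u) 0 := by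
  have h1 : HasDerivAt (fun s : ℝ => y + s • u) u 0 := by
    simpa using ((hasDerivAt_id (0 : ℝ)).smul_const u).const_add y
  have h2 := (hf (y + (0 : ℝ) • u)).hasFDerivAt.comp_hasDerivAt 0 h1
  simp only [zero_smul, add_zero] at h2
  exact h2

theorem coord_deriv {ι : Type} [Fintype ι] {x : ℝ → CZ ι} {v : CZ ι} {t : ℝ} (h : HasDerivAt x v t)
    (i : ι) : HasDerivAt (fun s => x s i) (v i) t :=
  ((EuclideanSpace.proj (𝕜 := ℂ) i : CZ ι →L[ℂ] ℂ).restrictScalars ℝ).hasFDerivAt.comp_hasDerivAt t h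

theorem Lm_fderiv_some {d : ℕ} {g : ℝ → ℝ} {R : ℝ × ℝ → ℝ} (hg : ContDiff ℝ 2 g) (hR : ContDiff ℝ 2 R)
    (hR0 : ∀ w, 0 < R w) (y u : PhX d) (i : Fin d) :
    fderiv ℝ (Lm g R) y u (some i) = ((u.1.2 i : ℝ) : ℂ) + ((u.1.1 i : ℝ) : ℂ) * Complex.I := by
  have h1 := coord_deriv (line_deriv ((Lm_contDiff hg hR hR0).differentiable (by norm_num)) y u) (some i)
  refine h1.unique ?_
  have e : (fun s : ℝ => Lm g R (y + s • u) (some i)) = fun s : ℝ =>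
      (((y.1.2 i + s * u.1.2 i : ℝ) : ℂ) + ((y.1.1 i + s * u.1.1 i : ℝ) : ℂ) * Complex.I) := by
    ext s
    simp [Lm]
  rw [e]
  have h2 : ∀ a b : ℝ, HasDerivAt (fun s : ℝ => ((a + s * b : ℝ) : ℂ)) (b : ℂ) 0 := by
    intro a b
    have : HasDerivAt (fun s : ℝ => a + s * b) b 0 := by
      simpa using ((hasDerivAt_id (0 : ℝ)).mul_const b).const_add a
    exact this.ofReal_comp
  exact (h2 _ _).add ((h2 _ _).mul_const _)

theorem Lm_fderiv_none {d : ℕ} {g : ℝ → ℝ} {R : ℝ × ℝ → ℝ} (hg : ContDiff ℝ 2 g) (hR : ContDiff ℝ 2 R)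
    (hR0 : ∀ w, 0 < R w) (y u : PhX d) :
    fderiv ℝ (Lm g R) y u none = ((fderiv ℝ R y.2 u.2 / (2 * R y.2) : ℝ) : ℂ) +
      ((2 * Real.pi * (deriv g y.2.1 * u.2.1) : ℝ) : ℂ) * Complex.I := by
  have h1 := coord_deriv (line_deriv ((Lm_contDiff hg hR hR0).differentiable (by norm_num)) y u) none
  refine h1.unique ?_
  have hpi := Real.pi_pos
  have hr := hR0 y.2
  have h2 := line_deriv (hR.differentiable (by norm_num)) y.2 u.2
  have h3 : HasDerivAt (fun s : ℝ => 1 / 2 * Real.log (R (y.2 + s • u.2) / Real.pi))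
      (fderiv ℝ R y.2 u.2 / (2 * R y.2)) 0 := by
    have := ((h2.div_const Real.pi).log (div_pos (hR0 _) hpi).ne').const_mul (1 / 2)
    refine this.congr_deriv ?_
    rw [zero_smul, add_zero]
    field_simp
  have h4 : HasDerivAt (fun s : ℝ => 2 * Real.pi * g (y.2.1 + s * u.2.1))
      (2 * Real.pi * (deriv g y.2.1 * u.2.1)) 0 := by
    have a1 : HasDerivAt (fun s : ℝ => y.2.1 + s * u.2.1) u.2.1 0 := by
      simpa using ((hasDerivAt_id (0 : ℝ)).mul_const u.2.1).const_add y.2.1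
    have a2 : HasDerivAt g (deriv g y.2.1) (y.2.1 + 0 * u.2.1) := by
      rw [zero_mul, add_zero]
      exact (hg.differentiable (by norm_num) _).hasDerivAt
    exact (a2.comp (0 : ℝ) a1).const_mul _
  exact h3.ofReal_comp.add (h4.ofReal_comp.mul_const _)

end Part10

section Part11
/-- Area data for the annulus chart. -/
structure CylD (g : ℝ → ℝ) (R : ℝ × ℝ → ℝ) (ρ : ℝ × ℝ → ℝ) (A0 : ℝ) : Prop where
  hg : ContDiff ℝ 2 g
  hR : ContDiff ℝ 2 R
  hR0 : ∀ w, 0 < R w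
  hRA : ∀ w, R w ≤ A0
  hgd : ∀ θ, 0 < deriv g θ
  hgp : ∀ θ, g (θ + 1) = g θ + 1
  hRp : ∀ θ μ, R (θ + 1, μ) = R (θ, μ)
  hρ : ∀ w, fderiv ℝ R w (0, 1) * deriv g w.1 = ρ w
  hρ0 : ∀ w, 0 < ρ w

/-- the chart -/
def Phc {d : ℕ} (g : ℝ → ℝ) (R : ℝ × ℝ → ℝ) (y : PhX d) : CZ (Option (Fin d)) := EX (Lm g R y)

theorem fd_two (R : ℝ × ℝ → ℝ) (w u : ℝ × ℝ) :
    fderiv ℝ R w u = u.1 * fderiv ℝ R w (1, 0) + u.2 * fderiv ℝ R w (0, 1) := by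
  have : u = u.1 • ((1 : ℝ), (0 : ℝ)) + u.2 • ((0 : ℝ), (1 : ℝ)) := by
    ext <;> simp
  conv_lhs => rw [this]
  rw [map_add, map_smul, map_smul, smul_eq_mul, smul_eq_mul]

theorem Lm_some {d : ℕ} (g : ℝ → ℝ) (R : ℝ × ℝ → ℝ) (y : PhX d) (i : Fin d) :
    Lm g R y (some i) = ((y.1.2 i : ℝ) : ℂ) + ((y.1.1 i : ℝ) : ℂ) * Complex.I := rfl
theorem Lm_none {d : ℕ} (g : ℝ → ℝ) (R : ℝ × ℝ → ℝ) (y : PhX d) :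
    Lm g R y none = ((1 / 2 * Real.log (R y.2 / Real.pi) : ℝ) : ℂ) +
      ((2 * Real.pi * g y.2.1 : ℝ) : ℂ) * Complex.I := rfl
theorem EX_some {d : ℕ} (z : CZ (Option (Fin d))) (i : Fin d) : EX z (some i) = z (some i) := rfl
theorem EX_none {d : ℕ} (z : CZ (Option (Fin d))) : EX z none = Complex.exp (z none) := rfl

theorem ri_ext {a b c e : ℝ} (h : (a : ℂ) + (b : ℂ) * Complex.I = (c : ℂ) + (e : ℂ) * Complex.I) :
    a = c ∧ b = e := by
  have h1 := congrArg Complex.re h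
  have h2 := congrArg Complex.im h
  simp at h1 h2
  exact ⟨h1, h2⟩

theorem CylD.g_int {g R ρ A0} (D : CylD g R ρ A0) (θ : ℝ) (j : ℤ) : g (θ + j) = g θ + j := by
  have h1 : ∀ (n : ℕ) θ, g (θ + n) = g θ + n := by
    intro n
    induction n with
    | zero => simp
    | succ n ih =>
      intro θ
      push_cast
      rw [← add_assoc, D.hgp, ih, add_assoc]
  obtain ⟨n, rfl | rfl⟩ := j.eq_nat_or_neg
  · simpa using h1 n θ
  · have := h1 n (θ + -n)
    rw [neg_add_cancel_right] at this
    push_cast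
    linarith

theorem CylD.R_int {g R ρ A0} (D : CylD g R ρ A0) (θ μ : ℝ) (j : ℤ) : R (θ + j, μ) = R (θ, μ) := by
  have h1 : ∀ (n : ℕ) θ, R (θ + n, μ) = R (θ, μ) := by
    intro n
    induction n with
    | zero => simp
    | succ n ih =>
      intro θ
      push_cast
      rw [← add_assoc, D.hRp, ih]
  obtain ⟨n, rfl | rfl⟩ := j.eq_nat_or_neg
  · simpa using h1 n θ
  · have := h1 n (θ + -n)
    rw [neg_add_cancel_right] at this
    push_cast
    exact this.symm

theorem CylD.Rmu {g R ρ A0} (D : CylD g R ρ A0) (w : ℝ × ℝ) : 0 < fderiv ℝ R w (0, 1) := by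
  have h1 := D.hρ w
  have h2 := D.hρ0 w
  have h3 := D.hgd w.1
  rw [← h1] at h2
  exact (pos_iff_pos_of_mul_pos h2).2 h3

theorem CylD.R_mono {g R ρ A0} (D : CylD g R ρ A0) (θ : ℝ) : StrictMono fun μ => R (θ, μ) := by
  refine strictMono_of_deriv_pos fun μ => ?_
  have h2 : HasDerivAt (fun s => R (θ, s)) (fderiv ℝ R (θ, μ) (0, 1)) μ :=
    (D.hR.differentiable (by norm_num) (θ, μ)).hasFDerivAt.comp_hasDerivAt μ
      ((hasDerivAt_const μ θ).prodMk (hasDerivAt_id μ))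
  rw [h2.deriv]
  exact D.Rmu _

theorem CylD.Lm_inj {d : ℕ} {g R ρ A0} (D : CylD g R ρ A0) {y y' : PhX d}
    (h : Lm g R y = Lm g R y') : y = y' := by
  have hs : ∀ i, y.1.2 i = y'.1.2 i ∧ y.1.1 i = y'.1.1 i := fun i => by
    have := congrArg (fun z : CZ (Option (Fin d)) => z (some i)) h
    simp only [Lm_some] at this
    exact ri_ext this
  have hn := congrArg (fun z : CZ (Option (Fin d)) => z none) h
  simp only [Lm_none] at hn
  obtain ⟨h1, h2⟩ := ri_ext hn
  have hpi := Real.pi_pos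
  have hθ : y.2.1 = y'.2.1 := by
    have hm : StrictMono g := strictMono_of_deriv_pos D.hgd
    exact hm.injective (mul_left_cancel₀ (by positivity) h2)
  have hRR : R y.2 = R y'.2 := by
    have h3 : Real.log (R y.2 / Real.pi) = Real.log (R y'.2 / Real.pi) := by linarith
    have h4 := Real.log_injOn_pos (div_pos (D.hR0 y.2) hpi) (div_pos (D.hR0 y'.2) hpi) h3
    field_simp at h4
    exact h4
  obtain ⟨⟨p, q⟩, θ, μ⟩ := y
  obtain ⟨⟨p', q'⟩, θ', μ'⟩ := y'
  simp only at hs hθ hRR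
  subst hθ
  have hμ := (D.R_mono θ).injective hRR
  subst hμ
  have e1 : p = p' := funext fun i => (hs i).2
  have e2 : q = q' := funext fun i => (hs i).1
  rw [e1, e2]

theorem CylD.Lm_fd_inj {d : ℕ} {g R ρ A0} (D : CylD g R ρ A0) (y u : PhX d)
    (h : fderiv ℝ (Lm g R) y u = 0) : u = 0 := by
  have hs : ∀ i, u.1.2 i = 0 ∧ u.1.1 i = 0 := fun i => by
    have := congrArg (fun z : CZ (Option (Fin d)) => z (some i)) h
    simp only [Lm_fderiv_some D.hg D.hR D.hR0] at this
    have h0 : ((0 : CZ (Option (Fin d))) (some i)) = ((0 : ℝ) : ℂ) + ((0 : ℝ) : ℂ) * Complex.I := by simp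
    rw [h0] at this
    exact ri_ext this
  have hn := congrArg (fun z : CZ (Option (Fin d)) => z none) h
  simp only [Lm_fderiv_none D.hg D.hR D.hR0] at hn
  have h0 : ((0 : CZ (Option (Fin d))) none) = ((0 : ℝ) : ℂ) + ((0 : ℝ) : ℂ) * Complex.I := by simp
  rw [h0] at hn
  obtain ⟨h1, h2⟩ := ri_ext hn
  have hpi := Real.pi_pos
  have hr := D.hR0 y.2
  have hθ : u.2.1 = 0 := by
    have := D.hgd y.2.1
    have h3 : 2 * Real.pi * deriv g y.2.1 ≠ 0 := by positivity
    rw [← mul_assoc] at h2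
    exact (mul_eq_zero.1 h2).resolve_left h3
  have hμ : u.2.2 = 0 := by
    rw [div_eq_zero_iff] at h1
    have h3 := h1.resolve_right (by positivity)
    rw [fd_two, hθ, zero_mul, zero_add] at h3
    exact (mul_eq_zero.1 h3).resolve_right (D.Rmu _).ne'
  obtain ⟨⟨p, q⟩, θ, μ⟩ := u
  simp only at hs hθ hμ
  subst hθ hμ
  have e1 : p = 0 := funext fun i => (hs i).2
  have e2 : q = 0 := funext fun i => (hs i).1
  rw [e1, e2]
  rfl

theorem CylD.Phc_contDiff {d : ℕ} {g R ρ A0} (D : CylD g R ρ A0) :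
    ContDiff ℝ 2 (Phc g R : PhX d → _) :=
  EX_contDiff.comp (Lm_contDiff D.hg D.hR D.hR0)

theorem CylD.Phc_fd_some {d : ℕ} {g R ρ A0} (D : CylD g R ρ A0) (y u : PhX d) (i : Fin d) :
    fderiv ℝ (Phc g R) y u (some i) = ((u.1.2 i : ℝ) : ℂ) + ((u.1.1 i : ℝ) : ℂ) * Complex.I := by
  rw [← Lm_fderiv_some D.hg D.hR D.hR0 y u i]
  exact (coord_deriv (line_deriv (D.Phc_contDiff.differentiable (by norm_num)) y u) (some i)).unique
    (coord_deriv (line_deriv ((Lm_contDiff D.hg D.hR D.hR0).differentiable (by norm_num)) y u) (some i))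

theorem CylD.Phc_fd_none {d : ℕ} {g R ρ A0} (D : CylD g R ρ A0) (y u : PhX d) :
    fderiv ℝ (Phc g R) y u none = Phc g R y none * (fderiv ℝ (Lm g R) y u none) := by
  have h1 := (coord_deriv (line_deriv ((Lm_contDiff D.hg D.hR D.hR0).differentiable (by norm_num)) y u) none).cexp
  simp only [zero_smul, add_zero] at h1
  exact (coord_deriv (line_deriv (D.Phc_contDiff.differentiable (by norm_num)) y u) none).unique h1

theorem CylD.Phc_fd_inj {d : ℕ} {g R ρ A0} (D : CylD g R ρ A0) (y u : PhX d)
    (h : fderiv ℝ (Phc g R) y u = 0) : u = 0 := by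
  refine D.Lm_fd_inj y u ?_
  ext o
  have h1 := congrArg (fun z : CZ (Option (Fin d)) => z o) h
  cases o with
  | none =>
    simp only [D.Phc_fd_none] at h1
    exact (mul_eq_zero.1 h1).resolve_left (Complex.exp_ne_zero _)
  | some i =>
    simp only [D.Phc_fd_some] at h1
    rw [Lm_fderiv_some D.hg D.hR D.hR0, h1]

theorem CylD.Phc_norm {d : ℕ} {g R ρ A0} (D : CylD g R ρ A0) (y : PhX d) :
    Real.pi * ‖Phc g R y none‖ ^ 2 = R y.2 := by
  have hpi := Real.pi_pos
  have hr := div_pos (D.hR0 y.2) hpi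
  have h1 : ‖Phc g R y none‖ = Real.exp (1 / 2 * Real.log (R y.2 / Real.pi)) := by
    unfold Phc
    rw [EX_none, Complex.norm_exp, Lm_none]
    simp
  rw [h1, ← Real.exp_nat_mul]
  have : ((2 : ℕ) : ℝ) * (1 / 2 * Real.log (R y.2 / Real.pi)) = Real.log (R y.2 / Real.pi) := by
    push_cast; ring
  rw [this, Real.exp_log hr]
  field_simp

theorem Phc_some {d : ℕ} (g : ℝ → ℝ) (R : ℝ × ℝ → ℝ) (y : PhX d) (i : Fin d) :
    Phc g R y (some i) = Lm g R y (some i) := rfl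
theorem Phc_none {d : ℕ} (g : ℝ → ℝ) (R : ℝ × ℝ → ℝ) (y : PhX d) :
    Phc g R y none = Complex.exp (Lm g R y none) := rfl

theorem CylD.Lm_shift {d : ℕ} {g R ρ A0} (D : CylD g R ρ A0) (y : PhX d) (j : ℤ) :
    Lm g R (y.1, y.2.1 + j, y.2.2) none = Lm g R y none + j * (2 * Real.pi * Complex.I) := by
  rw [Lm_none, Lm_none]
  simp only [D.g_int, D.R_int]
  push_cast
  ring

theorem CylD.Phc_shift {d : ℕ} {g R ρ A0} (D : CylD g R ρ A0) (y : PhX d) (j : ℤ) :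
    Phc g R (y.1, y.2.1 + j, y.2.2) = Phc g R y := by
  ext o
  cases o with
  | none =>
    rw [Phc_none, Phc_none, D.Lm_shift, Complex.exp_eq_exp_iff_exists_int]
    exact ⟨j, rfl⟩
  | some i => rfl

theorem CylD.Lm_lift {d : ℕ} {g R ρ A0} (D : CylD g R ρ A0) (y : PhX d) (v : CZ (Option (Fin d)))
    (h : EX v = Phc g R y) : ∃ j : ℤ, Lm g R (y.1, y.2.1 + j, y.2.2) = v := by
  have hn := congrArg (fun z : CZ (Option (Fin d)) => z none) h
  simp only [Phc_none, EX_none] at hn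
  rw [Complex.exp_eq_exp_iff_exists_int] at hn
  obtain ⟨j, hj⟩ := hn
  refine ⟨j, ?_⟩
  ext o
  cases o with
  | none => rw [D.Lm_shift, hj]
  | some i =>
    have := congrArg (fun z : CZ (Option (Fin d)) => z (some i)) h
    simp only [Phc_some, EX_some] at this
    rw [this]
    rfl

theorem CylD.Phc_eq {d : ℕ} {g R ρ A0} (D : CylD g R ρ A0) {y y' : PhX d}
    (h : Phc g R y' = Phc g R y) : ∃ j : ℤ, y' = (y.1, y.2.1 + j, y.2.2) := by
  obtain ⟨j, hj⟩ := D.Lm_lift y (Lm g R y') h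
  exact ⟨j, (D.Lm_inj hj).symm⟩

theorem CylD.symp {d : ℕ} {g R ρ A0} (D : CylD g R ρ A0) (y u v : PhX d) :
    inner ℝ ((-Complex.I) • fderiv ℝ (Phc g R) y u) (fderiv ℝ (Phc g R) y v) =
      ∑ i, (u.1.1 i * v.1.2 i - u.1.2 i * v.1.1 i) + ρ y.2 * (u.2.1 * v.2.2 - u.2.2 * v.2.1) := by
  simp only [PiLp.inner_apply, PiLp.smul_apply, Complex.inner, Fintype.sum_option, D.Phc_fd_some,
    D.Phc_fd_none]
  rw [add_comm]
  congr 1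
  · refine Finset.sum_congr rfl fun i _ => ?_
    simp
    ring
  · have hpi := Real.pi_pos
    have hr := D.hR0 y.2
    have h1 := D.Phc_norm y
    rw [← Complex.normSq_eq_norm_sq, Complex.normSq_apply] at h1
    rw [Lm_fderiv_none D.hg D.hR D.hR0, Lm_fderiv_none D.hg D.hR D.hR0, ← D.hρ, fd_two R y.2 u.2,
      fd_two R y.2 v.2]
    generalize fderiv ℝ R y.2 (1, 0) = r1
    generalize fderiv ℝ R y.2 (0, 1) = r2
    generalize deriv g y.2.1 = g1
    generalize Phc g R y none = c at *
    generalize R y.2 = r at *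
    obtain ⟨a, b⟩ := c
    simp only at h1
    simp only [Complex.mul_re, Complex.mul_im, Complex.add_re, Complex.add_im, Complex.ofReal_re,
      Complex.ofReal_im, Complex.I_re, Complex.I_im, Complex.neg_re, Complex.neg_im, smul_eq_mul,
      map_mul, Complex.conj_re, Complex.conj_im]
    subst h1
    have h2 : a ^ 2 + b ^ 2 ≠ 0 := by
      intro h; rw [← sq, ← sq, h] at hr; simp at hr
    field_simp
    ring

end Part11

section Part12
theorem exp_lift {w0 w1 : ℝ → ℂ} (hd : ∀ t, HasDerivAt w0 (w1 t) t) (hc : Continuous w1)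
    (hne : ∀ t, w0 t ≠ 0) :
    ∃ l : ℝ → ℂ, (∀ t, HasDerivAt l (w1 t / w0 t) t) ∧ ∀ t, Complex.exp (l t) = w0 t := by
  have hw : Continuous w0 := continuous_iff_continuousAt.2 fun t => (hd t).continuousAt
  have hq : Continuous fun t => w1 t / w0 t := hc.div hw hne
  let l : ℝ → ℂ := fun t => Complex.log (w0 0) + ∫ s in (0 : ℝ)..t, w1 s / w0 s
  have hl : ∀ t, HasDerivAt l (w1 t / w0 t) t := fun t =>
    (intervalIntegral.integral_hasDerivAt_right (hq.intervalIntegrable _ _)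
      (hq.stronglyMeasurableAtFilter _ _) hq.continuousAt).const_add _
  refine ⟨l, hl, fun t => ?_⟩
  have h1 : ∀ t, HasDerivAt (fun t => w0 t * Complex.exp (-l t)) 0 t := fun t => by
    refine ((hd t).mul (hl t).neg.cexp).congr_deriv ?_
    have := hne t
    field_simp
    ring
  have h2 := is_const_of_deriv_eq_zero (fun t => (h1 t).differentiableAt) (fun t => (h1 t).deriv) t 0
  have h3 : l 0 = Complex.log (w0 0) := by simp [l]
  simp only [h3, Complex.exp_neg, Complex.exp_log (hne 0), mul_inv_cancel₀ (hne 0)] at h2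
  field_simp [Complex.exp_ne_zero] at h2
  exact h2.symm

theorem H_int {d : ℕ} {H : PhX d → ℝ}
    (hper : ∀ x θ μ, H (x, θ + 1, μ) = H (x, θ, μ)) (y : PhX d) (j : ℤ) :
    H (y.1, y.2.1 + j, y.2.2) = H y := by
  have h1 : ∀ (n : ℕ) (y : PhX d), H (y.1, y.2.1 + n, y.2.2) = H y := by
    intro n
    induction n with
    | zero => simp
    | succ n ih =>
      intro y
      push_cast
      rw [← add_assoc, hper, ih]
  obtain ⟨n, rfl | rfl⟩ := j.eq_nat_or_neg
  · simpa using h1 n y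
  · have := h1 n (y.1, y.2.1 + -n, y.2.2)
    simp only [neg_add_cancel_right] at this
    push_cast
    exact this.symm

open Classical in
/-- transported Hamiltonian -/
def Ht {d : ℕ} (g : ℝ → ℝ) (R : ℝ × ℝ → ℝ) (H : PhX d → ℝ) (m : ℝ) (z : CZ (Option (Fin d))) : ℝ :=
  if h : ∃ y, Phc g R y = z then H h.choose else m

theorem CylD.Ht_apply {d : ℕ} {g R ρ A0} (D : CylD g R ρ A0) {H : PhX d → ℝ} {m : ℝ}
    (hper : ∀ x θ μ, H (x, θ + 1, μ) = H (x, θ, μ)) (y : PhX d) :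
    Ht g R H m (Phc g R y) = H y := by
  have h : ∃ y', Phc g R y' = Phc g R y := ⟨y, rfl⟩
  unfold Ht
  rw [dif_pos h]
  obtain ⟨j, hj⟩ := D.Phc_eq h.choose_spec
  rw [hj, H_int hper]

theorem finrk {d : ℕ} : Module.finrank ℝ (PhX d) = Module.finrank ℝ (CZ (Option (Fin d))) := by
  rw [finrank_real_of_complex]
  simp
  ring

theorem cyl_main {d : ℕ} {g R ρ A0} (D : CylD g R ρ A0) {H : PhX d → ℝ} (hH : ContDiff ℝ 2 H)
    (hper : ∀ x θ μ, H (x, θ + 1, μ) = H (x, θ, μ)) (h0 : ∀ z, 0 ≤ H z) {m : ℝ}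
    (hm : ∀ z, H z ≤ m) (hzero : ∃ V : Set (PhX d), IsOpen V ∧ V.Nonempty ∧ ∀ z ∈ V, H z = 0)
    {K : Set (PhX d)} (hK : IsCompact K)
    (hout : ∀ z : PhX d,
      z ∉ {w : PhX d | ∃ v ∈ K, ∃ j : ℤ, w = (v.1, v.2.1 + j, v.2.2)} → H z = m)
    (hA0 : 0 < A0) (hA0m : A0 < m)
    (hρK : ∀ v ∈ K, ∀ j : ℤ, ρ (v.2.1 + j, v.2.2) = 1) :
    ∃ (z z' : ℝ → PhX d) (j : ℤ), (∀ t, HasDerivAt z (z' t) t) ∧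
      (∀ t ξ, ∑ i, ((z' t).1.1 i * ξ.1.2 i - (z' t).1.2 i * ξ.1.1 i) +
        ((z' t).2.1 * ξ.2.2 - (z' t).2.2 * ξ.2.1) = fderiv ℝ H (z t) ξ) ∧
      (∃ t, z' t ≠ 0) ∧ ∀ t, z (t + 1) = z t + (0, (j : ℝ), 0) := by
  set Φ : PhX d → CZ (Option (Fin d)) := Phc g R with hΦ
  set G := Ht g R H m with hG
  have hGΦ : ∀ y, G (Φ y) = H y := fun y => D.Ht_apply hper y
  have hGno : ∀ z, (¬ ∃ y, Φ y = z) → G z = m := fun z hz => by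
    rw [hG]; unfold Ht; rw [dif_neg hz]
  have hΦc : ContDiff ℝ 2 Φ := D.Phc_contDiff
  have hlt : ∀ z, G z < m → ∃ v ∈ K, Φ v = z := by
    intro z hz
    by_contra hcon
    by_cases h : ∃ y, Φ y = z
    · obtain ⟨y, rfl⟩ := h
      rw [hGΦ] at hz
      refine hz.ne (hout y ?_)
      rintro ⟨v, hv, j, rfl⟩
      exact hcon ⟨v, hv, (D.Phc_shift v j).symm⟩
    · exact hz.ne (hGno z h)
  have hGm : ∀ z, G z ≤ m := by
    intro z
    by_cases h : ∃ y, Φ y = z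
    · obtain ⟨y, rfl⟩ := h
      rw [hGΦ]; exact hm y
    · rw [hGno z h]
  have hm0 : 0 < m := hA0.trans hA0m
  have hG0 : ∀ z, 0 ≤ G z := by
    intro z
    by_cases h : ∃ y, Φ y = z
    · obtain ⟨y, rfl⟩ := h
      rw [hGΦ]; exact h0 y
    · rw [hGno z h]; exact hm0.le
  have hCs : IsCompact (Φ '' K) := hK.image hΦc.continuous
  have hGout : ∀ z, z ∉ Φ '' K → G z = m := by
    intro z hz
    by_contra hne
    obtain ⟨v, hv, hvz⟩ := hlt z (lt_of_le_of_ne (hGm z) hne)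
    exact hz ⟨v, hv, hvz⟩
  have hSt : ∀ y, ∃ S : CZ (Option (Fin d)) → PhX d, ContDiffAt ℝ 2 S (Φ y) ∧ S (Φ y) = y ∧
      ∀ᶠ z in nhds (Φ y), Φ (S z) = z := fun y =>
    loc_inv finrk hΦc y (D.Phc_fd_inj y)
  have hGc : ContDiff ℝ 2 G := by
    rw [contDiff_iff_contDiffAt]
    intro z
    by_cases hz : z ∈ Φ '' K
    · obtain ⟨y, -, rfl⟩ := hz
      obtain ⟨S, hS1, hS2, hS3⟩ := hSt y
      have : ContDiffAt ℝ 2 (fun z => H (S z)) (Φ y) := hH.contDiffAt.comp _ hS1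
      refine this.congr_of_eventuallyEq ?_
      filter_upwards [hS3] with z hz
      rw [← hGΦ, hz]
    · have : ContDiffAt ℝ 2 (fun _ : CZ (Option (Fin d)) => m) z := contDiffAt_const
      refine this.congr_of_eventuallyEq ?_
      filter_upwards [hCs.isClosed.isOpen_compl.mem_nhds hz] with w hw
      exact hGout w hw
  obtain ⟨V, hVo, ⟨v, hv⟩, hV⟩ := hzero
  obtain ⟨r, hr, hball⟩ : ∃ r > 0, ∀ z, ‖z - Φ v‖ < r → G z = 0 := by
    obtain ⟨S, hS1, hS2, hS3⟩ := hSt v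
    have h1 : ∀ᶠ z in nhds (Φ v), S z ∈ V := by
      have h2 := hS1.continuousAt
      refine h2 ?_
      rw [hS2]
      exact hVo.mem_nhds hv
    have h2 : ∀ᶠ z in nhds (Φ v), G z = 0 := by
      filter_upwards [h1, hS3] with z hz1 hz2
      rw [← hz2, hGΦ]
      exact hV _ hz1
    obtain ⟨r, hr, hb⟩ := Metric.eventually_nhds_iff.1 h2
    exact ⟨r, hr, fun z hz => hb (by rwa [dist_eq_norm])⟩
  obtain ⟨x, hxp, hxd, hxm, t0, ht0⟩ := hz_euclid hGc hG0 hGm (Φ v) r hr hball hCs hGout none hA0 hA0m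
    (by rintro _ ⟨y, -, rfl⟩
        rw [hΦ, D.Phc_norm]
        exact D.hRA _)
  have hxr : ∀ t, ∃ y ∈ K, Φ y = x t := fun t => hlt _ (hxm t)
  have hne : ∀ t, x t none ≠ 0 := by
    intro t
    obtain ⟨y, -, hy⟩ := hxr t
    rw [← hy, hΦ, Phc_none]
    exact Complex.exp_ne_zero _
  have hxc : Continuous x := continuous_iff_continuousAt.2 fun t => (hxd t).continuousAt
  have hgrc : Continuous fun t => Complex.I • gr G (x t) := by
    unfold gr
    have h1 : Continuous fun t => fderiv ℝ G (x t) := (hGc.continuous_fderiv (by norm_num)).comp hxc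
    have h2 := (InnerProductSpace.toDual ℝ (CZ (Option (Fin d)))).symm.continuous.comp h1
    exact h2.const_smul Complex.I
  have hcoordc : Continuous fun z : CZ (Option (Fin d)) => z none :=
    (cz_coord_contDiff (n := 0) none).continuous
  obtain ⟨l, hl, hle⟩ := exp_lift (fun t => coord_deriv (hxd t) none) (hcoordc.comp hgrc) hne
  let W : ℝ → CZ (Option (Fin d)) := fun t => WithLp.toLp 2 fun o => o.elim (l t) (fun i => x t (some i))
  have hWn : ∀ t, W t none = l t := fun t => rfl
  have hWs : ∀ t i, W t (some i) = x t (some i) := fun t i => rfl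
  have hWE : ∀ t, EX (W t) = x t := by
    intro t
    ext o
    cases o with
    | none => rw [EX_none, hWn, hle]
    | some i => rfl
  have hWd : ∀ t, ∃ W', HasDerivAt W W' t := by
    intro t
    refine ⟨WithLp.toLp 2 fun o => o.elim ((Complex.I • gr G (x t)) none / x t none)
      (fun i => (Complex.I • gr G (x t)) (some i)), cz_hasDerivAt _ _ _ fun o => ?_⟩
    cases o with
    | none => exact hl t
    | some i => exact coord_deriv (hxd t) (some i)
  have hWr : ∀ t, ∃ y, Lm g R y = W t := by
    intro t
    obtain ⟨y, -, hy⟩ := hxr t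
    obtain ⟨j, hj⟩ := D.Lm_lift y (W t) (by rw [hWE, ← hy])
    exact ⟨_, hj⟩
  choose z hz using hWr
  have hΦz : ∀ t, Φ (z t) = x t := fun t => by
    rw [hΦ]; unfold Phc; rw [hz, hWE]
  have hzd : ∀ t, DifferentiableAt ℝ z t := by
    intro t
    obtain ⟨S, hS1, hS2, hS3⟩ := loc_inv finrk (Lm_contDiff D.hg D.hR D.hR0) (z t) (D.Lm_fd_inj (z t))
    obtain ⟨W', hW'⟩ := hWd t
    rw [hz t] at hS1 hS3
    have h1 : ∀ᶠ s in nhds t, z s = S (W s) := by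
      filter_upwards [hW'.continuousAt.eventually hS3] with s hs
      refine D.Lm_inj ?_
      rw [hs, hz]
    have h2 : DifferentiableAt ℝ (fun s => S (W s)) t :=
      (hS1.differentiableAt (by norm_num)).comp t hW'.differentiableAt
    exact h2.congr_of_eventuallyEq h1
  have hDz : ∀ t, fderiv ℝ Φ (z t) (deriv z t) = Complex.I • gr G (x t) := by
    intro t
    have h1 := (hΦc.differentiable (by norm_num) (z t)).hasFDerivAt.comp_hasDerivAt t (hzd t).hasDerivAt
    have h2 : Φ ∘ z = x := funext hΦz
    rw [h2] at h1
    exact h1.unique (hxd t)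
  have hρ1 : ∀ t, ρ (z t).2 = 1 := by
    intro t
    obtain ⟨y, hyK, hy⟩ := hxr t
    obtain ⟨j, hj⟩ := D.Phc_eq (y := y) (y' := z t) ((hΦz t).trans hy.symm)
    rw [hj]
    exact hρK y hyK j
  have hper1 : ∃ j : ℤ, ∀ t, l (t + 1) = l t + j * (2 * Real.pi * Complex.I) := by
    have h1 : ∀ t, HasDerivAt (fun t => l (t + 1) - l t) 0 t := by
      intro t
      have h2 : HasDerivAt (fun t => l (t + 1)) _ t := (hl (t + 1)).comp_add_const t 1
      refine (h2.sub (hl t)).congr_deriv ?_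
      rw [hxp, sub_self]
    have h2 := is_const_of_deriv_eq_zero (fun t => (h1 t).differentiableAt) (fun t => (h1 t).deriv)
    have h3 : Complex.exp (l (0 + 1)) = Complex.exp (l 0) := by rw [hle, hle, hxp]
    obtain ⟨j, hj⟩ := Complex.exp_eq_exp_iff_exists_int.1 h3
    refine ⟨j, fun t => ?_⟩
    have h4 := h2 t 0
    rw [hj] at h4
    linear_combination h4
  obtain ⟨j, hj⟩ := hper1
  refine ⟨z, deriv z, j, fun t => (hzd t).hasDerivAt, fun t ξ => ?_, ⟨t0, fun h => ?_⟩, fun t => ?_⟩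
  · have h1 := D.symp (z t) (deriv z t) ξ
    rw [hρ1, one_mul, ← hΦ, hDz] at h1
    rw [← h1, smul_smul]
    simp only [neg_mul, Complex.I_mul_I, neg_neg, one_smul]
    rw [inner_gr, ← hΦz]
    have h2 : H = G ∘ Φ := funext fun y => (hGΦ y).symm
    rw [h2, fderiv_comp _ (hGc.differentiable (by norm_num) _) (hΦc.differentiable (by norm_num) _)]
    rfl
  · have h1 := hDz t0
    rw [h, map_zero] at h1
    exact ht0 ((smul_eq_zero.1 h1.symm).resolve_left Complex.I_ne_zero)
  · have h1 : Lm g R (z (t + 1)) = Lm g R ((z t).1, (z t).2.1 + j, (z t).2.2) := by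
      rw [hz]
      ext o
      cases o with
      | none => rw [D.Lm_shift, hz, hWn, hWn, hj]
      | some i =>
        rw [hWs, hxp, Lm_some]
        simp only
        rw [← Lm_some g R, hz, hWs]
    rw [D.Lm_inj h1]
    ext <;> simp

end Part12

section Part13
section
open MeasureTheory

theorem prim_contDiff {w : ℝ × ℝ → ℝ} (hw : ContDiff ℝ 2 w) {B : ℝ}
    (hB : ∀ θ μ, B ≤ |μ| → w (θ, μ) = 0) :
    ContDiff ℝ 2 fun q : ℝ × ℝ => ∫ s in (-B)..q.2, w (q.1, s) := by
  let f : ℝ → ℝ := (Ici (0 : ℝ)).indicator fun _ => 1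
  have hf : LocallyIntegrable f volume := (locallyIntegrable_const (1 : ℝ)).indicator measurableSet_Ici
  have h1 := contDiffOn_convolution_right_with_param (𝕜 := ℝ) (μ := volume) (n := 2)
    (ContinuousLinearMap.mul ℝ ℝ) (f := f) (g := fun θ s => w (θ, s)) (s := univ) (k := Icc (-B) B)
    isOpen_univ isCompact_Icc
    (by intro θ s _ hs
        refine hB θ s ?_
        by_contra h
        rw [not_le, abs_lt] at h
        exact hs ⟨h.1.le, h.2.le⟩) hf (by
        have : (Function.HasUncurry.uncurry fun (θ s : ℝ) => w (θ, s)) = w := rfl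
        rw [this]
        exact hw.contDiffOn)
  rw [univ_prod_univ, contDiffOn_univ] at h1
  have h2 : (fun q : ℝ × ℝ => ∫ s in (-B)..q.2, w (q.1, s)) = fun q : ℝ × ℝ =>
      (convolution f (fun s => w (q.1, s)) (ContinuousLinearMap.mul ℝ ℝ) volume) q.2 := by
    ext ⟨θ, μ⟩
    have hc : Continuous fun s => w (θ, s) := hw.continuous.comp (by fun_prop)
    have hi : Integrable (fun s => w (θ, s)) := by
      refine hc.integrable_of_hasCompactSupport (HasCompactSupport.intro (isCompact_Icc (a := -B) (b := B)) ?_)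
      intro s hs
      refine hB θ s ?_
      by_contra h
      rw [not_le, abs_lt] at h
      exact hs ⟨h.1.le, h.2.le⟩
    simp only [convolution_def, ContinuousLinearMap.mul_apply']
    rw [← intervalIntegral.integral_Iic_sub_Iic hi.integrableOn hi.integrableOn]
    have h3 : ∫ s in Iic (-B), w (θ, s) = 0 := by
      refine setIntegral_eq_zero_of_forall_eq_zero fun s hs => hB θ s ?_
      have : s ≤ -B := hs
      exact le_trans (by linarith) (neg_le_abs s)
    rw [h3, sub_zero, ← integral_indicator measurableSet_Iic,
      ← integral_sub_left_eq_self (fun t => f t * w (θ, μ - t)) volume μ]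
    congr 1
    ext s
    by_cases h : s ≤ μ
    · simp [f, indicator, h]
    · simp [f, indicator, h]
  rw [h2]
  exact h1

theorem cyl_exists {χ : ℝ × ℝ → ℝ} (hχ : ContDiff ℝ 2 χ) (hχ0 : ∀ w, 0 ≤ χ w) (hχ1 : ∀ w, χ w ≤ 1)
    (hχp : ∀ θ μ, χ (θ + 1, μ) = χ (θ, μ)) {B : ℝ} (hB0 : 0 < B)
    (hB : ∀ θ μ, B ≤ |μ| → χ (θ, μ) = 0) {A : ℝ}
    (hA : ∫ θ in (0 : ℝ)..1, ∫ μ in (-B)..B, χ (θ, μ) < A) :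
    ∃ g R ρ A0, CylD g R ρ A0 ∧ 0 < A0 ∧ A0 < A ∧ ∀ w, χ w = 1 → ρ w = 1 := by
  have hpi := Real.pi_pos
  obtain ⟨ε, hε0, hε1, hεA⟩ : ∃ ε : ℝ, 0 < ε ∧ ε ≤ 1 ∧
      (∫ θ in (0 : ℝ)..1, ∫ μ in (-B)..B, χ (θ, μ)) + ε * Real.pi < A := by
    set I := ∫ θ in (0 : ℝ)..1, ∫ μ in (-B)..B, χ (θ, μ)
    refine ⟨min 1 ((A - I) / (2 * Real.pi)), ?_, min_le_left _ _, ?_⟩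
    · exact lt_min one_pos (div_pos (by linarith) (by positivity))
    · have h1 : min 1 ((A - I) / (2 * Real.pi)) * Real.pi ≤ (A - I) / (2 * Real.pi) * Real.pi :=
        mul_le_mul_of_nonneg_right (min_le_right _ _) hpi.le
      have h2 : (A - I) / (2 * Real.pi) * Real.pi = (A - I) / 2 := by field_simp
      linarith
  let k' : ℝ → ℝ := fun μ => (1 + μ ^ 2)⁻¹
  let k : ℝ → ℝ := fun μ => Real.arctan μ + Real.pi / 2
  have hk0 : ∀ μ, 0 < k μ := fun μ => by
    have := Real.neg_pi_div_two_lt_arctan μ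
    simp only [k]; linarith
  have hk1 : ∀ μ, k μ < Real.pi := fun μ => by
    have := Real.arctan_lt_pi_div_two μ
    simp only [k]; linarith
  have hk'0 : ∀ μ, 0 < k' μ := fun μ => by simp only [k']; positivity
  have hk'1 : ∀ μ, k' μ ≤ 1 := fun μ => inv_le_one_of_one_le₀ (by nlinarith [sq_nonneg μ])
  have hkc : ContDiff ℝ 2 k := Real.contDiff_arctan.add contDiff_const
  have hk'c : ContDiff ℝ 2 k' := by
    refine ContDiff.inv (by fun_prop) fun μ => ?_
    positivity
  have hkd : ∀ μ, HasDerivAt k (k' μ) μ := fun μ => by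
    have := (Real.hasDerivAt_arctan' μ).add_const (Real.pi / 2)
    exact this
  let w : ℝ × ℝ → ℝ := fun q => χ q * (1 - ε * k' q.2)
  have hwc : ContDiff ℝ 2 w := hχ.mul (contDiff_const.sub (contDiff_const.mul (hk'c.comp contDiff_snd)))
  have hfac : ∀ μ, 0 ≤ 1 - ε * k' μ := fun μ => by nlinarith [hk'0 μ, hk'1 μ]
  have hw0 : ∀ q, 0 ≤ w q := fun q => mul_nonneg (hχ0 q) (hfac _)
  have hwχ : ∀ q, w q ≤ χ q := fun q => by
    have := mul_nonneg (hχ0 q) (mul_nonneg hε0.le (hk'0 q.2).le)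
    simp only [w]; linarith
  have hwB : ∀ θ μ, B ≤ |μ| → w (θ, μ) = 0 := fun θ μ h => by simp only [w, hB θ μ h, zero_mul]
  have hwθ : ∀ θ, Continuous fun s => w (θ, s) := fun θ => hwc.continuous.comp (by fun_prop)
  have hwi : ∀ θ a b, IntervalIntegrable (fun s => w (θ, s)) volume a b :=
    fun θ a b => (hwθ θ).intervalIntegrable a b
  have hJ1 : ∀ θ μ, 0 ≤ ∫ s in (-B)..μ, w (θ, s) := by
    intro θ μ
    rcases le_total (-B) μ with h | h
    · exact intervalIntegral.integral_nonneg h fun s _ => hw0 _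
    · rw [intervalIntegral.integral_zero_ae]
      refine Filter.Eventually.of_forall fun s hs => hwB θ s ?_
      rw [uIoc_of_ge h] at hs
      exact le_trans (by linarith [hs.2]) (neg_le_abs s)
  have hJ2 : ∀ θ μ, 0 ≤ ∫ s in μ..B, w (θ, s) := by
    intro θ μ
    rcases le_total μ B with h | h
    · exact intervalIntegral.integral_nonneg h fun s _ => hw0 _
    · rw [intervalIntegral.integral_zero_ae]
      refine Filter.Eventually.of_forall fun s hs => hwB θ s ?_
      rw [uIoc_of_ge h] at hs
      exact le_trans hs.1.le (le_abs_self s)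
  let F : ℝ × ℝ → ℝ := fun q => ε * k q.2 + ∫ s in (-B)..q.2, w (q.1, s)
  have hFc : ContDiff ℝ 2 F := (contDiff_const.mul (hkc.comp contDiff_snd)).add (prim_contDiff hwc hwB)
  let f : ℝ → ℝ := fun θ => (∫ s in (-B)..B, w (θ, s)) + ε * Real.pi
  have hfc : ContDiff ℝ 2 f := by
    have h1 : ContDiff ℝ 2 fun θ : ℝ => (θ, B) := by fun_prop
    exact ((prim_contDiff hwc hwB).comp h1).add contDiff_const
  have hf0 : ∀ θ, 0 < f θ := fun θ => add_pos_of_nonneg_of_pos (hJ1 θ B) (by positivity)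
  have hF0 : ∀ q, 0 < F q := fun q => add_pos_of_pos_of_nonneg (mul_pos hε0 (hk0 _)) (hJ1 _ _)
  have hFf : ∀ q : ℝ × ℝ, F q < f q.1 := fun q => by
    have h1 := intervalIntegral.integral_add_adjacent_intervals (hwi q.1 (-B) q.2) (hwi q.1 q.2 B)
    have h2 := hJ2 q.1 q.2
    have h3 := mul_lt_mul_of_pos_left (hk1 q.2) hε0
    simp only [F, f]
    linarith
  have hwp : ∀ θ μ, w (θ + 1, μ) = w (θ, μ) := fun θ μ => by simp only [w, hχp]
  have hfp : ∀ θ, f (θ + 1) = f θ := fun θ => by simp only [f, hwp]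
  have hFp : ∀ θ μ, F (θ + 1, μ) = F (θ, μ) := fun θ μ => by simp only [F, hwp]
  have hfi : ∀ a b, IntervalIntegrable f volume a b := fun a b => hfc.continuous.intervalIntegrable a b
  set A0 := ∫ θ in (0 : ℝ)..1, f θ with hA0
  have hA0p : 0 < A0 := intervalIntegral.intervalIntegral_pos_of_pos (hfi 0 1) hf0 one_pos
  have hA0A : A0 < A := by
    refine lt_of_le_of_lt ?_ hεA
    have hχθ : ∀ θ, Continuous fun s => χ (θ, s) := fun θ => hχ.continuous.comp (by fun_prop)
    have hχI : ContDiff ℝ 2 fun θ : ℝ => ∫ s in (-B)..B, χ (θ, s) := by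
      have h1 : ContDiff ℝ 2 fun θ : ℝ => (θ, B) := by fun_prop
      exact (prim_contDiff hχ hB).comp h1
    have h1 : A0 ≤ ∫ θ in (0 : ℝ)..1, ((∫ s in (-B)..B, χ (θ, s)) + ε * Real.pi) := by
      refine intervalIntegral.integral_mono_on zero_le_one (hfi 0 1)
        ((hχI.continuous.add continuous_const).intervalIntegrable _ _) fun θ _ => ?_
      refine add_le_add_left ?_ _
      exact intervalIntegral.integral_mono_on (by linarith) (hwi θ _ _)
        ((hχθ θ).intervalIntegrable _ _) fun s _ => hwχ _
    refine h1.trans_eq ?_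
    rw [intervalIntegral.integral_add (hχI.continuous.intervalIntegrable _ _)
      (continuous_const.intervalIntegrable _ _)]
    simp
  let g : ℝ → ℝ := fun θ => (∫ s in (0 : ℝ)..θ, f s) / A0
  have hgd : ∀ θ, HasDerivAt g (f θ / A0) θ := fun θ =>
    (intervalIntegral.integral_hasDerivAt_right (hfi 0 θ)
      (hfc.continuous.stronglyMeasurableAtFilter _ _) hfc.continuous.continuousAt).div_const _
  have hgderiv : deriv g = fun θ => f θ / A0 := funext fun θ => (hgd θ).deriv
  let R : ℝ × ℝ → ℝ := fun q => A0 * F q / f q.1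
  have hFd : ∀ q : ℝ × ℝ, HasDerivAt (fun s => F (q.1, s)) (ε * k' q.2 + w q) q.2 := fun q =>
    ((hkd q.2).const_mul ε).add (intervalIntegral.integral_hasDerivAt_right (hwi q.1 _ _)
      ((hwθ q.1).stronglyMeasurableAtFilter _ _) (hwθ q.1).continuousAt)
  have hRc : ContDiff ℝ 2 R := (contDiff_const.mul hFc).div (hfc.comp contDiff_fst) fun q => (hf0 _).ne'
  refine ⟨g, R, fun q => ε * k' q.2 + w q, A0, ⟨?_, hRc, ?_, ?_, ?_, ?_, ?_, ?_, ?_⟩, hA0p, hA0A, ?_⟩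
  · have : ContDiff ℝ (1 + 1) g := by
      rw [contDiff_succ_iff_deriv]
      refine ⟨fun θ => (hgd θ).differentiableAt, by simp, ?_⟩
      rw [hgderiv]
      exact (hfc.of_le (by norm_num)).div_const _
    exact this.of_le (by norm_num)
  · exact fun q => div_pos (mul_pos hA0p (hF0 q)) (hf0 _)
  · intro q
    simp only [R]
    rw [div_le_iff₀ (hf0 _)]
    exact mul_le_mul_of_nonneg_left (hFf q).le hA0p.le
  · intro θ
    rw [hgderiv]
    exact div_pos (hf0 θ) hA0p
  · intro θ
    have h1 : (∫ s in (0 : ℝ)..(θ + 1), f s) = (∫ s in (0 : ℝ)..θ, f s) + A0 := by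
      rw [← intervalIntegral.integral_add_adjacent_intervals (hfi 0 θ) (hfi θ (θ + 1))]
      have h2 : Function.Periodic f 1 := hfp
      rw [h2.intervalIntegral_add_eq θ 0, zero_add]
    simp only [g]
    rw [h1, add_div, div_self hA0p.ne']
  · intro θ μ
    simp only [R, hFp, hfp]
  · intro q
    have h1 : HasDerivAt (fun s => R (q.1, s)) (fderiv ℝ R q (0, 1)) q.2 :=
      (hRc.differentiable (by norm_num) (q.1, q.2)).hasFDerivAt.comp_hasDerivAt q.2
        ((hasDerivAt_const q.2 q.1).prodMk (hasDerivAt_id q.2))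
    have h2 : HasDerivAt (fun s => R (q.1, s)) (A0 * (ε * k' q.2 + w q) / f q.1) q.2 :=
      ((hFd q).const_mul A0).div_const (f q.1)
    rw [h1.unique h2, hgderiv]
    have := (hf0 q.1).ne'
    field_simp
  · intro q
    exact add_pos_of_pos_of_nonneg (mul_pos hε0 (hk'0 _)) (hw0 q)
  · intro q hq
    simp only [w, hq]
    ring

end

end Part13

section Part14
section
open MeasureTheory

/-- covering map -/
def Ecv (q : ℝ × ℝ) : ℂ × ℝ := (Complex.exp ((2 * Real.pi * q.1 : ℝ) * Complex.I), q.2)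

theorem Ecv_contDiff : ContDiff ℝ 2 Ecv := by
  have hof : ContDiff ℝ 2 (fun r : ℝ => (r : ℂ)) := Complex.ofRealCLM.contDiff
  have h1 : ContDiff ℝ 2 fun q : ℝ × ℝ => ((2 * Real.pi * q.1 : ℝ) : ℂ) := hof.comp (by fun_prop)
  have h2 : ContDiff ℝ 2 fun q : ℝ × ℝ => ((2 * Real.pi * q.1 : ℝ) : ℂ) * Complex.I :=
    h1.mul contDiff_const
  exact (Complex.contDiff_exp.comp h2).prodMk contDiff_snd

theorem Ecv_eq {q q' : ℝ × ℝ} : Ecv q = Ecv q' ↔ ∃ n : ℤ, q = (q'.1 + n, q'.2) := by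
  unfold Ecv
  have hpi := Real.pi_pos
  rw [Prod.mk.injEq, Complex.exp_eq_exp_iff_exists_int]
  constructor
  · rintro ⟨⟨n, hn⟩, h2⟩
    refine ⟨n, ?_⟩
    have h3 := congrArg Complex.im hn
    simp at h3
    have h4 : q.1 = q'.1 + n := by
      have : 2 * Real.pi * q.1 = 2 * Real.pi * (q'.1 + n) := by rw [h3]; ring
      exact mul_left_cancel₀ (by positivity) this
    ext
    · exact h4
    · exact h2
  · rintro ⟨n, rfl⟩
    refine ⟨⟨n, ?_⟩, rfl⟩
    push_cast
    ring

theorem P_int {P : Set (ℝ × ℝ)} (hPp : ∀ θ μ, (θ + 1, μ) ∈ P ↔ (θ, μ) ∈ P) (θ μ : ℝ) (j : ℤ) :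
    (θ + j, μ) ∈ P ↔ (θ, μ) ∈ P := by
  have h1 : ∀ (n : ℕ) (θ : ℝ), (θ + n, μ) ∈ P ↔ (θ, μ) ∈ P := by
    intro n
    induction n with
    | zero => simp
    | succ n ih =>
      intro θ
      push_cast
      rw [← add_assoc, hPp, ih]
  obtain ⟨n, rfl | rfl⟩ := j.eq_nat_or_neg
  · simpa using h1 n θ
  · have := h1 n (θ + -n)
    rw [neg_add_cancel_right] at this
    push_cast
    exact this.symm

theorem chi_exists {P : Set (ℝ × ℝ)} (hP : IsOpen P) (hPp : ∀ θ μ, (θ + 1, μ) ∈ P ↔ (θ, μ) ∈ P)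
    {B : ℝ} (hB0 : 0 < B) (hPB : ∀ q ∈ P, |q.2| < B) {κ : Set (ℝ × ℝ)} (hκ : IsCompact κ)
    (hκne : κ.Nonempty) (hκP : κ ⊆ P) {A : ℝ}
    (hA : A = (volume {q : ℝ × ℝ | q.1 ∈ Ico (0 : ℝ) 1 ∧ q ∈ P}).toReal) :
    ∃ χ : ℝ × ℝ → ℝ, ContDiff ℝ 2 χ ∧ (∀ w, 0 ≤ χ w) ∧ (∀ w, χ w ≤ 1) ∧
      (∀ θ μ, χ (θ + 1, μ) = χ (θ, μ)) ∧ (∀ θ μ, B ≤ |μ| → χ (θ, μ) = 0) ∧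
      (∫ θ in (0 : ℝ)..1, ∫ μ in (-B)..B, χ (θ, μ) < A) ∧
      ∀ q ∈ κ, ∀ j : ℤ, χ (q.1 + j, q.2) = 1 := by
  have hEc : Continuous Ecv := Ecv_contDiff.continuous
  let Q : Set (ℝ × ℝ) := (Icc 0 1 ×ˢ Icc (-B) B) \ P
  have hQ : IsCompact Q := (isCompact_Icc.prod isCompact_Icc).diff hP
  let s : Set (ℂ × ℝ) := {v | B ≤ |v.2|} ∪ Ecv '' Q
  have hs : IsClosed s :=
    (isClosed_le continuous_const (by fun_prop)).union (hQ.image hEc).isClosed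
  have ht : IsClosed (Ecv '' κ) := (hκ.image hEc).isClosed
  have hdis : Disjoint s (Ecv '' κ) := by
    rw [Set.disjoint_left]
    rintro _ hv ⟨q, hq, rfl⟩
    rcases hv with hv | ⟨q', hq', hv⟩
    · exact absurd (hPB q (hκP hq)) (not_lt.2 hv)
    · obtain ⟨n, rfl⟩ := Ecv_eq.1 hv
      refine hq'.2 ((P_int hPp _ _ _).2 (hκP hq))
  obtain ⟨f, hf, hfr, hf0, hf1⟩ := exists_contMDiff_zero_iff_one_iff_of_isClosed
    (n := 2) (modelWithCornersSelf ℝ (ℂ × ℝ)) hs ht hdis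
  rw [contMDiff_iff_contDiff] at hf
  have hr : ∀ v, f v ∈ Icc (0 : ℝ) 1 := fun v => hfr ⟨v, rfl⟩
  let χ : ℝ × ℝ → ℝ := fun q => f (Ecv q)
  have hχc : ContDiff ℝ 2 χ := hf.comp Ecv_contDiff
  have hχ0 : ∀ q, 0 ≤ χ q := fun q => (hr _).1
  have hχ1 : ∀ q, χ q ≤ 1 := fun q => (hr _).2
  have hχB : ∀ θ μ, B ≤ |μ| → χ (θ, μ) = 0 := fun θ μ h => (hf0 _).1 (Or.inl h)
  have hχP : ∀ q, q ∉ P → χ q = 0 := by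
    intro q hq
    rcases le_or_gt B |q.2| with h | h
    · exact hχB q.1 q.2 h
    · refine (hf0 _).1 (Or.inr ⟨(Int.fract q.1, q.2), ⟨⟨⟨Int.fract_nonneg _, (Int.fract_lt_one _).le⟩,
        (abs_le.1 h.le)⟩, fun hc => hq ?_⟩, ?_⟩)
      · have := (P_int hPp (Int.fract q.1) q.2 ⌊q.1⌋).2 hc
        rwa [Int.fract_add_floor] at this
      · refine (Ecv_eq.2 ⟨⌊q.1⌋, ?_⟩).symm
        simp only [Int.fract_add_floor]
  obtain ⟨q0, hq0, hmax⟩ := hκ.exists_isMaxOn hκne (continuous_snd (X := ℝ) (Y := ℝ)).continuousOn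
  have hlt1 : ∀ q : ℝ × ℝ, q0.2 < q.2 → χ q < 1 := by
    intro q hq
    refine lt_of_le_of_ne (hχ1 q) fun h => ?_
    obtain ⟨q', hq', he⟩ := (hf1 _).2 h
    have h1 : (Ecv q').2 = (Ecv q).2 := congrArg Prod.snd he
    simp only [Ecv] at h1
    have h2 : q'.2 ≤ q0.2 := hmax hq'
    linarith
  let W : Set (ℝ × ℝ) := (P ∩ {q | q0.2 < q.2}) ∩ {q | q.1 ∈ Ioo (0 : ℝ) 1}
  have hWo : IsOpen W := (hP.inter (isOpen_lt continuous_const continuous_snd)).inter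
    (isOpen_Ioo.preimage continuous_fst)
  have hWne : W.Nonempty := by
    have h0 : (Int.fract q0.1, q0.2) ∈ P := by
      rw [← P_int hPp _ _ ⌊q0.1⌋, Int.fract_add_floor]
      exact hκP hq0
    have hc : Continuous fun s : ℝ => (Int.fract q0.1 + s, q0.2 + s) := by fun_prop
    have h1 : ∀ᶠ s in nhds (0 : ℝ), (Int.fract q0.1 + s, q0.2 + s) ∈ P := by
      refine hc.continuousAt.eventually (hP.mem_nhds ?_)
      simpa using h0
    have h2 : ∀ᶠ s in nhds (0 : ℝ), s < 1 - Int.fract q0.1 :=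
      gt_mem_nhds (by linarith [Int.fract_lt_one q0.1])
    have h3 : ∀ᶠ s in nhdsWithin (0 : ℝ) (Ioi 0), s ∈ Ioi (0 : ℝ) := eventually_mem_nhdsWithin
    obtain ⟨s, ⟨h4, h5⟩, h6⟩ := (((h1.and h2).filter_mono nhdsWithin_le_nhds).and h3).exists
    have h6' : 0 < s := h6
    exact ⟨_, ⟨⟨h4, by simpa using h6'⟩, by
      have := Int.fract_nonneg q0.1
      constructor
      · simp only; linarith
      · simp only; linarith⟩⟩
  let S : Set (ℝ × ℝ) := Ioo 0 1 ×ˢ Ioo (-B) B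
  have hSm : MeasurableSet S := measurableSet_Ioo.prod measurableSet_Ioo
  have hSsub : S ⊆ Icc 0 1 ×ˢ Icc (-B) B := prod_mono Ioo_subset_Icc_self Ioo_subset_Icc_self
  have hKc : IsCompact ((Icc (0 : ℝ) 1) ×ˢ Icc (-B) B) := isCompact_Icc.prod isCompact_Icc
  have hχi : IntegrableOn χ S := (hχc.continuous.continuousOn.integrableOn_compact hKc).mono_set hSsub
  have hSfin : volume S ≠ ⊤ := ((measure_mono hSsub).trans_lt hKc.measure_lt_top).ne
  have hPi : IntegrableOn (P.indicator fun _ => (1 : ℝ)) S := by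
    refine IntegrableOn.indicator ?_ hP.measurableSet
    exact integrableOn_const hSfin
  have hpos : 0 < ∫ q in S, (P.indicator (fun _ => (1 : ℝ)) q - χ q) := by
    rw [setIntegral_pos_iff_support_of_nonneg_ae]
    · refine lt_of_lt_of_le (hWo.measure_pos volume hWne) (measure_mono ?_)
      rintro q ⟨⟨hq1, hq2⟩, hq3⟩
      refine ⟨?_, hq3, abs_lt.1 (hPB q hq1)⟩
      rw [Function.mem_support, indicator_of_mem hq1]
      exact (sub_pos.2 (hlt1 q hq2)).ne'
    · refine Filter.Eventually.of_forall fun q => ?_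
      by_cases hq : q ∈ P
      · simp only [Pi.zero_apply, indicator_of_mem hq]
        linarith [hχ1 q]
      · simp only [Pi.zero_apply, indicator_of_notMem hq, hχP q hq, sub_zero, le_refl]
    · exact hPi.sub hχi
  rw [integral_sub hPi hχi, setIntegral_indicator hP.measurableSet, setIntegral_const, smul_eq_mul,
    mul_one] at hpos
  have hle : volume.real (S ∩ P) ≤ A := by
    rw [hA]
    refine ENNReal.toReal_mono ?_ (measure_mono ?_)
    · refine ((measure_mono (t := Icc (0 : ℝ) 1 ×ˢ Icc (-B) B) ?_).trans_lt hKc.measure_lt_top).ne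
      rintro q ⟨h1, h2⟩
      exact ⟨Ico_subset_Icc_self h1, abs_le.1 (hPB q h2).le⟩
    · rintro q ⟨⟨h1, -⟩, h2⟩
      exact ⟨Ioo_subset_Ico_self h1, h2⟩
  have hintg : ∫ q in S, χ q = ∫ θ in (0 : ℝ)..1, ∫ μ in (-B)..B, χ (θ, μ) := by
    rw [Measure.volume_eq_prod] at hχi ⊢
    rw [setIntegral_prod _ hχi, intervalIntegral.integral_of_le zero_le_one, integral_Ioc_eq_integral_Ioo]
    congr 1
    ext θ
    rw [intervalIntegral.integral_of_le (by linarith), integral_Ioc_eq_integral_Ioo]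
  refine ⟨χ, hχc, hχ0, hχ1, fun θ μ => ?_, hχB, ?_, fun q hq j => ?_⟩
  · simp only [χ]
    congr 1
    exact Ecv_eq.2 ⟨1, by simp⟩
  · rw [← hintg]
    linarith
  · refine (hf1 _).1 ⟨q, hq, (Ecv_eq.2 ⟨j, rfl⟩).symm⟩

end

end Part14

/-- Theorem 3.1 of the paper — the Hofer–Viterbo/Lu-type
existence theorem on `M × T*S¹` for `M = (ℝ^{2d}, ω₀)`, stated in the
universal cover `ℝ^{2d} × ℝ × ℝ` of `ℝ^{2d} × T*S¹`: here `X` is the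
Hamiltonian vector field of `H` with respect to `Ω`, i.e. `Ω(X(z), ξ) = DH(z)ξ`,
and the closing-up condition `z(t+T) = z(t) + (0, j, 0)` encodes that the
homotopy class of the resulting orbit on `ℝ^{2d} × T*S¹` lies in `π₁(S¹)`. -/
theorem stmt8 {d : ℕ} (hd : 1 ≤ d)
    {H : Phase d × ℝ × ℝ → ℝ} (hHsmooth : ContDiff ℝ (⊤ : ℕ∞) H)
    (hper : ∀ (x : Phase d) (θ μ : ℝ), H (x, θ + 1, μ) = H (x, θ, μ))
    (hnonneg : ∀ z, 0 ≤ H z)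
    (hzero : ∃ V : Set (Phase d × ℝ × ℝ), IsOpen V ∧ V.Nonempty ∧ ∀ z ∈ V, H z = 0)
    {m : ℝ} (hm : 0 < m) (hmax : ∀ z, H z ≤ m)
    {K : Set (Phase d × ℝ × ℝ)} (hK : IsCompact K)
    (hout : ∀ z : Phase d × ℝ × ℝ,
      z ∉ {w : Phase d × ℝ × ℝ | ∃ v ∈ K, ∃ j : ℤ, w = (v.1, v.2.1 + j, v.2.2)} → H z = m)
    {U : Set (Phase d × ℝ × ℝ)} (hU : IsOpen U)
    (hKU : {w : Phase d × ℝ × ℝ | ∃ v ∈ K, ∃ j : ℤ, w = (v.1, v.2.1 + j, v.2.2)} ⊆ U)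
    (hUinv : ∀ (x : Phase d) (θ μ : ℝ), (x, θ + 1, μ) ∈ U ↔ (x, θ, μ) ∈ U)
    (hUcomp : IsCompact (closure U ∩ {z : Phase d × ℝ × ℝ | z.2.1 ∈ Set.Icc (0 : ℝ) 1}))
    {A : ℝ}
    (hA : A = (MeasureTheory.volume
      {q : ℝ × ℝ | q.1 ∈ Set.Ico (0 : ℝ) 1 ∧ ∃ x : Phase d, (x, q.1, q.2) ∈ U}).toReal)
    (X : Phase d × ℝ × ℝ → Phase d × ℝ × ℝ)
    (hX : ∀ z ξ, OmegaP (X z) ξ = fderiv ℝ H z ξ) :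
    ∃ (z : ℝ → Phase d × ℝ × ℝ) (T : ℝ) (j : ℤ),
      (∀ t, HasDerivAt z (X (z t)) t) ∧ (∃ t t', z t ≠ z t') ∧
      0 < T ∧ T < A / m ∧
      ∀ t, z (t + T) = z t + (0, (j : ℝ), 0) := by
  have hK0 : K.Nonempty := by
    rw [nonempty_iff_ne_empty]
    rintro rfl
    obtain ⟨V, -, ⟨v, hv⟩, hV⟩ := hzero
    have h1 := hout v (by simp)
    rw [hV v hv] at h1
    exact hm.ne h1
  let P : Set (ℝ × ℝ) := (fun z : Phase d × ℝ × ℝ => z.2) '' U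
  have hP : IsOpen P := isOpenMap_snd U hU
  have hPmem : ∀ θ μ : ℝ, (θ, μ) ∈ P ↔ ∃ x : Phase d, (x, θ, μ) ∈ U := by
    intro θ μ
    constructor
    · rintro ⟨⟨x, q⟩, hz, rfl⟩
      exact ⟨x, hz⟩
    · rintro ⟨x, hx⟩
      exact ⟨_, hx, rfl⟩
  have hPp : ∀ θ μ, (θ + 1, μ) ∈ P ↔ (θ, μ) ∈ P := fun θ μ => by
    rw [hPmem, hPmem]
    exact exists_congr fun x => hUinv x θ μ
  obtain ⟨B, hB0, hPB⟩ : ∃ B : ℝ, 0 < B ∧ ∀ q ∈ P, |q.2| < B := by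
    have h1 : BddAbove ((fun z : Phase d × ℝ × ℝ => |z.2.2|) ''
        (closure U ∩ {z : Phase d × ℝ × ℝ | z.2.1 ∈ Set.Icc (0 : ℝ) 1})) :=
      (hUcomp.image (by fun_prop)).bddAbove
    obtain ⟨b, hb⟩ := h1
    refine ⟨|b| + 1, by positivity, ?_⟩
    rintro ⟨θ, μ⟩ hq
    have h2 : (Int.fract θ, μ) ∈ P := by
      rw [← P_int hPp _ _ ⌊θ⌋, Int.fract_add_floor]
      exact hq
    obtain ⟨x, hx⟩ := (hPmem _ _).1 h2
    have h3 : |μ| ≤ b := hb ⟨_, ⟨subset_closure hx, Int.fract_nonneg θ, (Int.fract_lt_one θ).le⟩, rfl⟩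
    exact lt_of_le_of_lt (h3.trans (le_abs_self b)) (lt_add_one _)
  have hκP : (fun z : Phase d × ℝ × ℝ => z.2) '' K ⊆ P := by
    rintro _ ⟨v, hv, rfl⟩
    exact ⟨v, hKU ⟨v, hv, 0, by simp⟩, rfl⟩
  have hA' : A = (MeasureTheory.volume {q : ℝ × ℝ | q.1 ∈ Set.Ico (0 : ℝ) 1 ∧ q ∈ P}).toReal := by
    rw [hA]
    congr 2
    ext q
    simp only [Set.mem_ofPred_eq]
    exact and_congr_right fun _ => (hPmem q.1 q.2).symm
  obtain ⟨χ, hχc, hχ0, hχ1, hχp, hχB, hχA, hχK⟩ := chi_exists hP hPp hB0 hPB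
    (hK.image continuous_snd) (hK0.image _) hκP hA'
  obtain ⟨g, R, ρ, A0, D, hA0, hA0A, hρ⟩ := cyl_exists hχc hχ0 hχ1 hχp hB0 hχB hχA
  obtain ⟨T, hT1, hT2⟩ := exists_between (div_lt_div_of_pos_right hA0A hm)
  have hT0 : 0 < T := (div_pos hA0 hm).trans hT1
  have hH2 : ContDiff ℝ 2 H := contDiff_infty.1 hHsmooth 2
  obtain ⟨z, z', j, hzd, hzO, ⟨t0, ht0⟩, hzp⟩ := cyl_main D (H := fun y => T * H y) (m := T * m)
    (contDiff_const.mul hH2) (fun x θ μ => by simp only [hper])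
    (fun y => mul_nonneg hT0.le (hnonneg y)) (fun y => mul_le_mul_of_nonneg_left (hmax y) hT0.le)
    (by
      obtain ⟨V, h1, h2, h3⟩ := hzero
      exact ⟨V, h1, h2, fun y hy => by simp only [h3 y hy, mul_zero]⟩) hK
    (fun y hy => by simp only [hout y hy]) hA0 (by rwa [div_lt_iff₀ hm] at hT1)
    (fun v hv i => hρ _ (hχK v.2 ⟨v, hv, rfl⟩ i))
  have hnd : ∀ u v : Phase d × ℝ × ℝ, (∀ ξ, OmegaP u ξ = OmegaP v ξ) → u = v := by
    intro u v h
    have e1 : ∀ i, u.1.1 i = v.1.1 i := fun i => by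
      have := h ((0, Pi.single i 1), 0, 0)
      simpa [OmegaP, omega0, Pi.single_apply] using this
    have e2 : ∀ i, u.1.2 i = v.1.2 i := fun i => by
      have := h ((Pi.single i 1, 0), 0, 0)
      simpa [OmegaP, omega0, Pi.single_apply] using this
    have e3 : u.2.1 = v.2.1 := by
      have := h (0, 0, 1)
      simpa [OmegaP, omega0] using this
    have e4 : u.2.2 = v.2.2 := by
      have := h (0, 1, 0)
      simpa [OmegaP, omega0] using this
    exact Prod.ext (Prod.ext (funext e1) (funext e2)) (Prod.ext e3 e4)
  have hder : ∀ t, T⁻¹ • z' t = X (z t) := by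
    intro t
    refine hnd _ _ fun ξ => ?_
    rw [hX]
    have h1 := hzO t ξ
    have h2 : fderiv ℝ (fun y => T * H y) (z t) = T • fderiv ℝ H (z t) :=
      fderiv_const_mul (hH2.differentiable (by norm_num) _) T
    rw [h2] at h1
    have h3 : OmegaP (T⁻¹ • z' t) ξ = T⁻¹ * OmegaP (z' t) ξ := by
      simp only [OmegaP, omega0, Prod.smul_fst, Prod.smul_snd, Pi.smul_apply, smul_eq_mul]
      rw [mul_sub, mul_add, Finset.mul_sum]
      congr 1
      · congr 1
        · exact Finset.sum_congr rfl fun i _ => by ring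
        · ring
      · ring
    have h4 : OmegaP (z' t) ξ = T * fderiv ℝ H (z t) ξ := by
      have h5 : (T • fderiv ℝ H (z t)) ξ = T * fderiv ℝ H (z t) ξ := rfl
      rw [← h5, ← h1]
      simp only [OmegaP, omega0]
      ring
    rw [h3, h4, inv_mul_cancel_left₀ hT0.ne']
  refine ⟨fun t => z (t / T), T, j, fun t => ?_, ?_, hT0, hT2, fun t => ?_⟩
  · have h1 : HasDerivAt (fun t : ℝ => t / T) T⁻¹ t := by
      simpa using (hasDerivAt_id t).div_const T
    have h2 := (hzd (t / T)).scomp t h1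
    rw [hder] at h2
    exact h2
  · by_contra hcon
    push Not at hcon
    refine ht0 ((hzd t0).unique ?_)
    have h1 : z = fun _ => z 0 := by
      ext1 t
      have := hcon (t * T) 0
      rwa [mul_div_cancel_right₀ _ hT0.ne', zero_div] at this
    rw [h1]
    exact hasDerivAt_const _ _
  · have h1 : (t + T) / T = t / T + 1 := by rw [add_div, div_self hT0.ne']
    simp only [h1]
    exact hzp _
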